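/- arXiv:2412.13759 — 4 statements merged into one kernel-verified Lean document; each statement's English description precedes it below -/
import Mathlib

section
/- Let X be a complete metric space that is locally Euclidean of dimension n, i.e. every point of X has an open neighborhood isometric to an open subset of ℝⁿ. Let {f_t}_{t=1}^m be contractive similitudes on X with ratios ρ_t ∈ (0,1) satisfying the open set condition (OSC), and let K be a nonempty compact set with K = ⋃_{t=1}^m f_t(K). Then the Hausdorff dimension of K is the unique real number α satisfying Σ_{t=1}^m ρ_t^α = 1. -/
open Set Metric MeasureTheory
open scoped ENNReal NNReal

section SelfSim
variable {X : Type*} {m : ℕ}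

/-- composition along a word -/
def ssWord (f : Fin m → X → X) : List (Fin m) → X → X
  | [] => id
  | t :: l => f t ∘ ssWord f l

/-- ratio of a word -/
def ssRat (ρ : Fin m → ℝ) (l : List (Fin m)) : ℝ := (l.map ρ).prod

lemma ssWord_append (f : Fin m → X → X) (l l' : List (Fin m)) :
    ssWord f (l ++ l') = ssWord f l ∘ ssWord f l' := by
  induction l with
  | nil => rfl
  | cons t l ih => simp [ssWord, ih, Function.comp_assoc]

lemma ssRat_append (ρ : Fin m → ℝ) (l l' : List (Fin m)) :
    ssRat ρ (l ++ l') = ssRat ρ l * ssRat ρ l' := by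
  simp [ssRat]

lemma ssRat_pos {ρ : Fin m → ℝ} (hρ : ∀ t, 0 < ρ t ∧ ρ t < 1) (l : List (Fin m)) :
    0 < ssRat ρ l := by
  induction l with
  | nil => simp [ssRat]
  | cons t l ih => simpa [ssRat] using mul_pos (hρ t).1 ih

lemma ssRat_le_pow {ρ : Fin m → ℝ} (hρ : ∀ t, 0 < ρ t ∧ ρ t < 1) {M : ℝ}
    (hM : ∀ t, ρ t ≤ M) (hM0 : 0 ≤ M) (l : List (Fin m)) :
    ssRat ρ l ≤ M ^ l.length := by
  induction l with
  | nil => simp [ssRat]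
  | cons t l ih =>
    have h := ssRat_pos hρ l
    have : ssRat ρ (t :: l) = ρ t * ssRat ρ l := by simp [ssRat]
    rw [this, List.length_cons, pow_succ']
    exact mul_le_mul (hM t) ih h.le hM0

lemma ssRat_rpow {ρ : Fin m → ℝ} (hρ : ∀ t, 0 < ρ t ∧ ρ t < 1) (α : ℝ) (l : List (Fin m)) :
    ssRat ρ l ^ α = (l.map (fun t => ρ t ^ α)).prod := by
  induction l with
  | nil => simp [ssRat]
  | cons t l ih =>
    have : ssRat ρ (t :: l) = ρ t * ssRat ρ l := by simp [ssRat]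
    rw [this, Real.mul_rpow (hρ t).1.le (ssRat_pos hρ l).le, ih]; simp

lemma ssWord_dist [MetricSpace X] {f : Fin m → X → X} {ρ : Fin m → ℝ}
    (hsim : ∀ t, ∀ x y : X, dist (f t x) (f t y) = ρ t * dist x y)
    (l : List (Fin m)) (x y : X) :
    dist (ssWord f l x) (ssWord f l y) = ssRat ρ l * dist x y := by
  induction l with
  | nil => simp [ssWord, ssRat]
  | cons t l ih => simp [ssWord, ssRat, hsim, ih, mul_assoc] 

lemma ssWord_image_subset {f : Fin m → X → X} {U : Set X} (hU : ∀ t, f t '' U ⊆ U)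
    (l : List (Fin m)) : ssWord f l '' U ⊆ U := by
  induction l with
  | nil => simp [ssWord]
  | cons t l ih => 
    rw [ssWord, image_comp]
    exact (image_mono ih).trans (hU t)

lemma ssWord_disj {f : Fin m → X → X} {U : Set X} (hU : ∀ t, f t '' U ⊆ U)
    (hinj : ∀ t, Function.Injective (f t))
    (hd : ∀ t₁ t₂ : Fin m, t₁ ≠ t₂ → (f t₁ '' U) ∩ (f t₂ '' U) = ∅)
    (l l' : List (Fin m)) (h : ¬ l <+: l') (h' : ¬ l' <+: l) :
    Disjoint (ssWord f l '' U) (ssWord f l' '' U) := by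
  induction l generalizing l' with
  | nil => simp at h
  | cons t l ih =>
    cases l' with
    | nil => simp at h'
    | cons t' l' =>
      rw [ssWord, ssWord, image_comp, image_comp]
      by_cases e : t = t'
      · subst e
        rw [disjoint_image_iff (hinj t)]
        exact ih l' (by simpa using h) (by simpa using h')
      · exact (disjoint_iff_inter_eq_empty.2 (hd t t' e)).mono
          (image_mono (ssWord_image_subset hU l)) (image_mono (ssWord_image_subset hU l'))

/-- stopping words at scale `r` -/
def ssStop (ρ : Fin m → ℝ) (r : ℝ) (l : List (Fin m)) : Prop :=
  ssRat ρ l ≤ r ∧ ∀ p, p <+: l → p ≠ l → r < ssRat ρ p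

lemma ssStop_not_prefix {ρ : Fin m → ℝ} {r : ℝ} {l l' : List (Fin m)} (h : ssStop ρ r l)
    (h' : ssStop ρ r l') (hne : l ≠ l') : ¬ l <+: l' := fun hp =>
  absurd (h'.2 l hp hne) (not_lt.2 h.1)

lemma ssStop_lower {ρ : Fin m → ℝ} (hρ : ∀ t, 0 < ρ t ∧ ρ t < 1) {r c : ℝ} (hr0 : 0 < r)
    (hr : r < 1) (hc : ∀ t, c ≤ ρ t) {l : List (Fin m)} (h : ssStop ρ r l) :
    c * r ≤ ssRat ρ l := by
  rcases List.eq_nil_or_concat l with rfl | ⟨p, t, rfl⟩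
  · have := h.1; simp [ssRat] at this; linarith
  · have h1 := h.2 p (by simp) (by simp)
    have h2 : ssRat ρ (p ++ [t]) = ssRat ρ p * ρ t := by simp [ssRat]
    simp only [List.concat_eq_append] at *
    rw [h2]
    nlinarith [hc t, (hρ t).1]

/-- initial word -/
def ssPre (ω : ℕ → Fin m) (k : ℕ) : List (Fin m) := List.ofFn (fun i : Fin k => ω i)

lemma ssPre_succ (ω : ℕ → Fin m) (k : ℕ) : ssPre ω (k+1) = ssPre ω k ++ [ω k] := by
  rw [ssPre, List.ofFn_succ']; simp [ssPre]

lemma ssPre_take (ω : ℕ → Fin m) (k j : ℕ) (h : j ≤ k) : (ssPre ω k).take j = ssPre ω j := by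
  apply List.ext_getElem
  · simp [ssPre, h]
  · intro i h1 h2; simp [ssPre]

lemma ssPre_stop {ρ : Fin m → ℝ} (hρ : ∀ t, 0 < ρ t ∧ ρ t < 1) {M : ℝ}
    (hM : ∀ t, ρ t ≤ M) (hM0 : 0 ≤ M) (hM1 : M < 1) {r : ℝ} (hr : 0 < r) (ω : ℕ → Fin m) :
    ∃ k, ssStop ρ r (ssPre ω k) := by
  classical
  have hex : ∃ k, ssRat ρ (ssPre ω k) ≤ r := by
    obtain ⟨k, hk⟩ := exists_pow_lt_of_lt_one hr hM1
    refine ⟨k, (ssRat_le_pow hρ hM hM0 _).trans ?_⟩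
    simpa [ssPre] using hk.le
  refine ⟨Nat.find hex, Nat.find_spec hex, fun p hp hne => ?_⟩
  have hlen : p.length ≤ Nat.find hex := hp.length_le.trans_eq List.length_ofFn
  have hp' : p = ssPre ω p.length := by
    rw [← ssPre_take ω _ _ hlen]; exact List.prefix_iff_eq_take.1 hp
  have hlt : p.length < Nat.find hex := by
    refine lt_of_le_of_ne hlen fun e => hne ?_
    rw [hp', e]
  have := Nat.find_min hex hlt
  rw [hp']; exact not_le.1 this


lemma ss_cover {f : Fin m → X → X} {K : Set X} (hK : K = ⋃ t, f t '' K) (k : ℕ) :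
    K ⊆ ⋃ w : Fin k → Fin m, ssWord f (List.ofFn w) '' K := by
  induction k with
  | zero => intro x hx; simpa [ssWord] using hx
  | succ k ih =>
    intro x hx
    rw [hK] at hx
    obtain ⟨t, y, hy, rfl⟩ := mem_iUnion.1 hx
    obtain ⟨w, z, hz, rfl⟩ := mem_iUnion.1 (ih hy)
    refine mem_iUnion.2 ⟨Fin.cons t w, z, hz, ?_⟩
    simp [List.ofFn_succ, ssWord]

lemma ssWord_lip [MetricSpace X] {f : Fin m → X → X} {ρ : Fin m → ℝ}
    (hρ : ∀ t, 0 < ρ t ∧ ρ t < 1)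
    (hsim : ∀ t, ∀ x y : X, dist (f t x) (f t y) = ρ t * dist x y)
    (l : List (Fin m)) : LipschitzWith (ssRat ρ l).toNNReal (ssWord f l) := by
  apply LipschitzWith.of_dist_le_mul
  intro x y
  rw [ssWord_dist hsim, Real.coe_toNNReal _ (ssRat_pos hρ l).le]

lemma ssWord_antilip [MetricSpace X] {f : Fin m → X → X} {ρ : Fin m → ℝ}
    (hρ : ∀ t, 0 < ρ t ∧ ρ t < 1)
    (hsim : ∀ t, ∀ x y : X, dist (f t x) (f t y) = ρ t * dist x y)
    (l : List (Fin m)) : AntilipschitzWith (ssRat ρ l).toNNReal⁻¹ (ssWord f l) := by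
  apply AntilipschitzWith.of_le_mul_dist
  intro x y
  have := ssRat_pos hρ l
  rw [ssWord_dist hsim, NNReal.coe_inv, Real.coe_toNNReal _ this.le,
    inv_mul_cancel_left₀ this.ne']

lemma ss_max (hm : 0 < m) {ρ : Fin m → ℝ} (hρ : ∀ t, 0 < ρ t ∧ ρ t < 1) :
    ∃ M : ℝ, (∀ t, ρ t ≤ M) ∧ 0 ≤ M ∧ M < 1 := by
  have : Nonempty (Fin m) := ⟨⟨0, hm⟩⟩
  obtain ⟨t, ht⟩ := Finite.exists_max ρ
  exact ⟨ρ t, ht, (hρ t).1.le, (hρ t).2⟩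

lemma ss_min (hm : 0 < m) {ρ : Fin m → ℝ} (hρ : ∀ t, 0 < ρ t ∧ ρ t < 1) :
    ∃ c : ℝ, (∀ t, c ≤ ρ t) ∧ 0 < c := by
  have : Nonempty (Fin m) := ⟨⟨0, hm⟩⟩
  obtain ⟨t, ht⟩ := Finite.exists_min ρ
  exact ⟨ρ t, ht, (hρ t).1⟩

lemma ss_exists_alpha (hm : 0 < m) {ρ : Fin m → ℝ} (hρ : ∀ t, 0 < ρ t ∧ ρ t < 1) :
    ∃ α : ℝ, 0 ≤ α ∧ (∑ t, ρ t ^ α) = 1 ∧ ∀ β : ℝ, (∑ t, ρ t ^ β) = 1 → β = α := by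
  have : Nonempty (Fin m) := ⟨⟨0, hm⟩⟩
  have hanti : StrictAnti (fun β : ℝ => ∑ t, ρ t ^ β) := by
    intro a b hab
    exact Finset.sum_lt_sum_of_nonempty Finset.univ_nonempty
      fun t _ => Real.rpow_lt_rpow_of_exponent_gt (hρ t).1 (hρ t).2 hab
  have hcont : Continuous (fun β : ℝ => ∑ t, ρ t ^ β) := by
    refine continuous_finsetSum _ fun t _ => ?_
    exact Real.continuous_const_rpow (hρ t).1.ne'
  have h0 : 1 ≤ ∑ t, ρ t ^ (0:ℝ) := by
    simp; exact_mod_cast hm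
  have hlim : Filter.Tendsto (fun β : ℝ => ∑ t, ρ t ^ β) Filter.atTop (nhds 0) := by
    have : Filter.Tendsto (fun β : ℝ => ∑ t, ρ t ^ β) Filter.atTop (nhds (∑ t : Fin m, 0)) := by
      refine tendsto_finsetSum _ fun t _ => ?_
      exact tendsto_rpow_atTop_of_base_lt_one _ (by linarith [(hρ t).1]) (hρ t).2
    simpa using this
  obtain ⟨b, hb1, hb0⟩ := ((hlim.eventually (gt_mem_nhds zero_lt_one)).and
    (Filter.eventually_ge_atTop 0)).exists
  obtain ⟨α, hα, hα1⟩ := intermediate_value_Icc' hb0 hcont.continuousOn ⟨hb1.le, h0⟩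
  exact ⟨α, hα.1, hα1, fun β hβ => hanti.injective (hβ.trans hα1.symm)⟩

lemma ss_upper [MetricSpace X] [MeasurableSpace X] [BorelSpace X] (hm : 0 < m)
    {f : Fin m → X → X} {ρ : Fin m → ℝ}
    (hρ : ∀ t, 0 < ρ t ∧ ρ t < 1)
    (hsim : ∀ t, ∀ x y : X, dist (f t x) (f t y) = ρ t * dist x y)
    {K : Set X} (hKcpt : IsCompact K) (hK : K = ⋃ t, f t '' K) {α : ℝ} (hα : 0 ≤ α)
    (hsum : ∑ t, ρ t ^ α = 1) : μH[α] K ≠ ⊤ := by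
  obtain ⟨M, hM, hM0, hM1⟩ := ss_max hm hρ
  have hD : ediam K ≠ ⊤ := hKcpt.isBounded.ediam_ne_top
  have hdiam : ∀ l : List (Fin m),
      ediam (ssWord f l '' K) ≤ ENNReal.ofReal (ssRat ρ l) * ediam K := fun l =>
    (ssWord_lip hρ hsim l).ediam_image_le K
  have key := Measure.hausdorffMeasure_le_liminf_sum (β := ℕ) (ι := fun k => Fin k → Fin m) α K
    (l := Filter.atTop) (fun k => ENNReal.ofReal (M ^ k) * ediam K) (by
      have h1 : Filter.Tendsto (fun k : ℕ => ENNReal.ofReal (M ^ k)) Filter.atTop (nhds 0) := by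
        have := ENNReal.tendsto_ofReal (tendsto_pow_atTop_nhds_zero_of_lt_one hM0 hM1)
        simpa using this
      have := ENNReal.Tendsto.mul_const h1 (Or.inr hD)
      simpa using this)
    (fun k w => ssWord f (List.ofFn w) '' K) (by
      refine Filter.Eventually.of_forall fun k w => (hdiam _).trans ?_
      gcongr
      simpa using ssRat_le_pow hρ hM hM0 (List.ofFn w)) 
    (Filter.Eventually.of_forall fun k => ss_cover hK k)
  have hbd : ∀ k : ℕ, ∑ w : Fin k → Fin m, ediam (ssWord f (List.ofFn w) '' K) ^ α
      ≤ ediam K ^ α := by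
    intro k
    calc _ ≤ ∑ w : Fin k → Fin m, ENNReal.ofReal (∏ i, ρ (w i) ^ α) * ediam K ^ α := by
          refine Finset.sum_le_sum fun w _ => ?_
          refine (ENNReal.rpow_le_rpow (hdiam _) hα).trans_eq ?_
          rw [ENNReal.mul_rpow_of_nonneg _ _ hα, ENNReal.ofReal_rpow_of_nonneg
            (ssRat_pos hρ _).le hα, ssRat_rpow hρ]
          congr 2
          simp [List.prod_ofFn, Function.comp_def]
      _ = ediam K ^ α := by
          rw [← Finset.sum_mul, ← ENNReal.ofReal_sum_of_nonneg, ← Fintype.sum_pow (fun t => ρ t ^ α), hsum]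
          · simp
          · intro w _
            exact Finset.prod_nonneg fun i _ => Real.rpow_nonneg (hρ _).1.le _
  have hle : μH[α] K ≤ ediam K ^ α := by
    refine key.trans ((Filter.liminf_le_liminf (Filter.Eventually.of_forall hbd)).trans ?_)
    simp
  exact ne_top_of_le_ne_top (ENNReal.rpow_ne_top_of_nonneg hα hD) hle

/-- volume of the Euclidean unit ball w.r.t. Hausdorff measure -/
noncomputable def ssVol (n : ℕ) : ℝ≥0∞ :=
  μH[(n : ℝ)] (ball (0 : EuclideanSpace ℝ (Fin n)) 1)

lemma ss_haar (n : ℕ) :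
    (μH[(n : ℝ)] : Measure (EuclideanSpace ℝ (Fin n))).IsAddHaarMeasure := by
  have := MeasureTheory.isAddHaarMeasure_hausdorffMeasure (E := EuclideanSpace ℝ (Fin n))
  simpa using this

lemma ssVol_ne_top (n : ℕ) : ssVol n ≠ ⊤ := by
  have := ss_haar n
  exact measure_ball_lt_top.ne

lemma ss_patch_upper [MetricSpace X] [MeasurableSpace X] [BorelSpace X] {n : ℕ} {P : Set X}
    {V : Set (EuclideanSpace ℝ (Fin n))} (e : P ≃ᵢ V) {x : X} (hx : x ∈ P) {R : ℝ} (hR : 0 ≤ R)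
    (hs : closedBall x R ⊆ P) :
    μH[(n : ℝ)] (closedBall x R) ≤ ENNReal.ofReal (R ^ n) * ssVol n := by
  have := ss_haar n
  have hn : (0:ℝ) ≤ n := n.cast_nonneg
  set S : Set P := Subtype.val ⁻¹' closedBall x R
  have h1 : closedBall x R = Subtype.val '' S := by
    rw [Subtype.image_preimage_coe, inter_eq_right.2 hs]
  have hg : Isometry (fun p : P => (e p : EuclideanSpace ℝ (Fin n))) :=
    isometry_subtype_coe.comp e.isometry
  rw [h1, isometry_subtype_coe.hausdorffMeasure_image (Or.inl hn),
    ← hg.hausdorffMeasure_image (Or.inl hn)]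
  refine (measure_mono (t := closedBall (e ⟨x, hx⟩ : EuclideanSpace ℝ (Fin n)) R) ?_).trans_eq ?_
  · rintro _ ⟨p, hp, rfl⟩
    have := hg.dist_eq p ⟨x, hx⟩
    rw [mem_closedBall, this]
    exact hp
  · rw [Measure.addHaar_closedBall _ _ hR]; simp [ssVol]

lemma ss_patch_pos [MetricSpace X] [MeasurableSpace X] [BorelSpace X] {n : ℕ} {P : Set X}
    {V : Set (EuclideanSpace ℝ (Fin n))} (hV : IsOpen V) (e : P ≃ᵢ V) {B : Set X}
    (hB : IsOpen B) (hBne : B.Nonempty) (hs : B ⊆ P) :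
    0 < μH[(n : ℝ)] B := by
  have := ss_haar n
  have hn : (0:ℝ) ≤ n := n.cast_nonneg
  set S : Set P := Subtype.val ⁻¹' B
  have h1 : B = Subtype.val '' S := by
    rw [Subtype.image_preimage_coe, inter_eq_right.2 hs]
  have hg : Isometry (fun p : P => (e p : EuclideanSpace ℝ (Fin n))) :=
    isometry_subtype_coe.comp e.isometry
  rw [h1, isometry_subtype_coe.hausdorffMeasure_image (Or.inl hn),
    ← hg.hausdorffMeasure_image (Or.inl hn)]
  apply IsOpen.measure_pos
  · have : IsOpenMap (fun p : P => (e p : EuclideanSpace ℝ (Fin n))) :=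
      hV.isOpenMap_subtype_val.comp e.toHomeomorph.isOpenMap
    exact this _ (hB.preimage continuous_subtype_val)
  · obtain ⟨b, hb⟩ := hBne
    exact ⟨_, ⟨b, hs hb⟩, hb, rfl⟩

lemma ss_coding [MetricSpace X] [CompleteSpace X] [MeasurableSpace X] [BorelSpace X] (hm : 0 < m)
    {f : Fin m → X → X} {ρ : Fin m → ℝ}
    (hρ : ∀ t, 0 < ρ t ∧ ρ t < 1)
    (hsim : ∀ t, ∀ x y : X, dist (f t x) (f t y) = ρ t * dist x y)
    {K : Set X} (hKne : K.Nonempty) (hKcpt : IsCompact K) (hK : K = ⋃ t, f t '' K) :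
    ∃ π : (ℕ → Fin m) → X, Measurable π ∧ ∀ ω k, π ω ∈ ssWord f (ssPre ω k) '' K := by
  obtain ⟨M, hM, hM0, hM1⟩ := ss_max hm hρ
  obtain ⟨a, ha⟩ := hKne
  have hKt : ∀ t, f t '' K ⊆ K := fun t => by
    conv_rhs => rw [hK]
    exact subset_iUnion (fun t => f t '' K) t
  have hcau : ∀ ω : ℕ → Fin m, CauchySeq (fun k => ssWord f (ssPre ω k) a) := by
    intro ω
    refine cauchySeq_of_le_geometric M (Metric.diam K) hM1 fun k => ?_
    rw [ssPre_succ, ssWord_append, Function.comp_apply, ssWord_dist hsim, mul_comm]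
    have h1 : ssRat ρ (ssPre ω k) ≤ M ^ k := by
      simpa [ssPre] using ssRat_le_pow hρ hM hM0 (ssPre ω k)
    refine mul_le_mul ?_ h1 (ssRat_pos hρ _).le Metric.diam_nonneg
    exact Metric.dist_le_diam_of_mem hKcpt.isBounded ha (hKt (ω k) ⟨a, ha, rfl⟩)
  choose π hπ using fun ω => cauchySeq_tendsto_of_complete (hcau ω)
  refine ⟨π, ?_, fun ω k => ?_⟩
  · refine measurable_of_tendsto_metrizable (f := fun k ω => ssWord f (ssPre ω k) a) (fun k => ?_)
      (tendsto_pi_nhds.2 hπ)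
    have : (fun ω : ℕ → Fin m => ssWord f (ssPre ω k) a) =
      (fun w : Fin k → Fin m => ssWord f (List.ofFn w) a) ∘ (fun ω i => ω i) := rfl
    rw [this]
    exact (measurable_of_countable _).comp (by fun_prop)
  · have hcl : IsClosed (ssWord f (ssPre ω k) '' K) :=
      (hKcpt.image (ssWord_lip hρ hsim _).continuous).isClosed
    refine hcl.mem_of_tendsto (hπ ω) ?_
    filter_upwards [Filter.eventually_ge_atTop k] with j hj
    have : ssPre ω j = ssPre ω k ++ (ssPre ω j).drop k := by
      rw [← ssPre_take ω j k hj, List.take_append_drop]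
    rw [this, ssWord_append]
    exact ⟨_, ssWord_image_subset hKt _ ⟨a, ha, rfl⟩, rfl⟩

lemma ss_measure {ρ : Fin m → ℝ} (hρ : ∀ t, 0 < ρ t ∧ ρ t < 1) {α : ℝ}
    (hsum : ∑ t, ρ t ^ α = 1) :
    ∃ ν : Measure (ℕ → Fin m), IsProbabilityMeasure ν ∧ ∀ l : List (Fin m),
      ν {τ | ∃ k, ssPre τ k = l} ≤ ENNReal.ofReal (ssRat ρ l ^ α) := by
  have hp : ∑ t, ENNReal.ofReal (ρ t ^ α) = 1 := by
    rw [← ENNReal.ofReal_sum_of_nonneg (fun t _ => Real.rpow_nonneg (hρ t).1.le _), hsum]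
    simp
  let p : PMF (Fin m) := PMF.ofFintype (fun t => ENNReal.ofReal (ρ t ^ α)) hp
  refine ⟨Measure.infinitePi (fun _ : ℕ => p.toMeasure), inferInstance, fun l => ?_⟩
  by_cases hl : ∃ ω : ℕ → Fin m, ∃ k, ssPre ω k = l
  · obtain ⟨ω, k, rfl⟩ := hl
    have hsub : {τ : ℕ → Fin m | ∃ j, ssPre τ j = ssPre ω k} ⊆
        Set.pi (Finset.range k) (fun i => {ω i}) := by
      rintro τ ⟨j, hj⟩
      have hjk : j = k := by simpa [ssPre] using congrArg List.length hj
      subst hjk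
      have h2 := List.ofFn_injective hj
      intro i hi
      have hi' : i < j := by simpa using hi
      exact congrFun h2 ⟨i, hi'⟩
    refine (measure_mono hsub).trans_eq ?_
    rw [Measure.infinitePi_pi _ (fun _ _ => measurableSet_singleton _), ssRat_rpow hρ, ssPre,
      List.map_ofFn, List.prod_ofFn, ENNReal.ofReal_prod_of_nonneg
        (f := (fun t => ρ t ^ α) ∘ fun i : Fin k => ω i)
        (fun i _ => Real.rpow_nonneg (hρ _).1.le _),
      ← Fin.prod_univ_eq_prod_range (fun i => p.toMeasure {ω i})]
    refine Finset.prod_congr rfl fun i _ => ?_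
    rw [PMF.toMeasure_apply_singleton _ _ (measurableSet_singleton _)]
    rfl
  · have : {τ : ℕ → Fin m | ∃ j, ssPre τ j = l} = ∅ := by
      ext τ; simpa using fun k hk => hl ⟨τ, k, hk⟩
    rw [this]; simp

lemma ss_image_measure [MetricSpace X] [MeasurableSpace X] [BorelSpace X]
    {f : Fin m → X → X} {ρ : Fin m → ℝ}
    (hρ : ∀ t, 0 < ρ t ∧ ρ t < 1)
    (hsim : ∀ t, ∀ x y : X, dist (f t x) (f t y) = ρ t * dist x y) (n : ℕ)
    (l : List (Fin m)) (B : Set X) :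
    ENNReal.ofReal (ssRat ρ l ^ n) * μH[(n:ℝ)] B ≤ μH[(n:ℝ)] (ssWord f l '' B) := by
  have hpos := ssRat_pos hρ l
  have h := (ssWord_antilip hρ hsim l).le_hausdorffMeasure_image (d := n) n.cast_nonneg B
  have h0 : (ssRat ρ l).toNNReal ≠ 0 := by simpa using hpos
  rw [ENNReal.coe_inv h0, ENNReal.rpow_natCast, ← ENNReal.inv_pow] at h
  rw [ENNReal.ofReal_pow hpos.le]
  change ENNReal.ofReal _ ^ n * _ ≤ _
  have hne : ENNReal.ofReal (ssRat ρ l) ^ n ≠ 0 := pow_ne_zero _ (by simpa using hpos)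
  have hnt : ENNReal.ofReal (ssRat ρ l) ^ n ≠ ⊤ := by finiteness
  calc _ ≤ ENNReal.ofReal (ssRat ρ l) ^ n *
        ((ENNReal.ofReal (ssRat ρ l) ^ n)⁻¹ * μH[(n:ℝ)] (ssWord f l '' B)) := by gcongr; exact h
    _ = _ := by rw [← mul_assoc, ENNReal.mul_inv_cancel hne hnt, one_mul]

lemma ss_core [MetricSpace X] [CompleteSpace X] [MeasurableSpace X] [BorelSpace X] (hm : 0 < m)
    {n : ℕ} {f : Fin m → X → X} {ρ : Fin m → ℝ}
    (hρ : ∀ t, 0 < ρ t ∧ ρ t < 1)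
    (hsim : ∀ t, ∀ x y : X, dist (f t x) (f t y) = ρ t * dist x y)
    {U : Set X} (hU : ∀ t, f t '' U ⊆ U)
    (hd : ∀ t₁ t₂ : Fin m, t₁ ≠ t₂ → (f t₁ '' U) ∩ (f t₂ '' U) = ∅)
    {K : Set X} {B : Set X} (hB : MeasurableSet B) (hBU : B ⊆ U) (hB0 : μH[(n:ℝ)] B ≠ 0)
    (hBt : μH[(n:ℝ)] B ≠ ⊤) {D : ℝ} (hD0 : 0 ≤ D) (hD : ∀ y ∈ B, ∀ z ∈ K, dist y z ≤ D)
    {c : ℝ} (hc0 : 0 < c) (hc : ∀ t, c ≤ ρ t)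
    {α : ℝ} (hα : 0 ≤ α)
    {ν : Measure (ℕ → Fin m)}
    (hν : ∀ l : List (Fin m), ν {τ | ∃ k, ssPre τ k = l} ≤ ENNReal.ofReal (ssRat ρ l ^ α))
    {π : (ℕ → Fin m) → X} (hπ : ∀ ω k, π ω ∈ ssWord f (ssPre ω k) '' K)
    {r : ℝ} (hr0 : 0 < r) (hr1 : r < 1) {s : Set X} (hs : ∀ x ∈ s, ∀ y ∈ s, dist x y ≤ r)
    (hvol : ∀ x ∈ K, μH[(n:ℝ)] (closedBall x ((D+1)*r)) ≤
      ENNReal.ofReal (((D+1)*r)^n) * ssVol n) :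
    ν (π ⁻¹' s) ≤ ENNReal.ofReal (r ^ α) *
      (ENNReal.ofReal ((D+1)^n) * ssVol n / (ENNReal.ofReal (c^n) * μH[(n:ℝ)] B)) := by
  obtain ⟨M, hM, hM0, hM1⟩ := ss_max hm hρ
  rcases (π ⁻¹' s).eq_empty_or_nonempty with he | ⟨ω₀, hω₀⟩
  · rw [he]; simp
  have hxK : π ω₀ ∈ K := by
    obtain ⟨z, hz, hz'⟩ := hπ ω₀ 0
    have : z = π ω₀ := by simpa [ssPre, ssWord] using hz'
    exact this ▸ hz
  set N : Set (List (Fin m)) := {l | ssStop ρ r l ∧ ∃ ω k, π ω ∈ s ∧ ssPre ω k = l} with hN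
  have hcov : π ⁻¹' s ⊆ ⋃ l ∈ N, {τ | ∃ k, ssPre τ k = l} := by
    intro ω hω
    obtain ⟨k, hk⟩ := ssPre_stop hρ hM hM0 hM1 hr0 ω
    exact mem_iUnion₂.2 ⟨ssPre ω k, ⟨hk, ω, k, hω, rfl⟩, k, rfl⟩
  have hinj : ∀ l, Function.Injective (ssWord f l) := fun l => (ssWord_antilip hρ hsim l).injective
  have hinj1 : ∀ t, Function.Injective (f t) := fun t => by simpa [ssWord] using hinj [t]
  have hmeas : ∀ l, MeasurableSet (ssWord f l '' B) := fun l =>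
    ((ssWord_antilip hρ hsim l).isClosedEmbedding
      (ssWord_lip hρ hsim l).uniformContinuous).measurableEmbedding.measurableSet_image.2 hB
  set q : ℝ≥0∞ := ENNReal.ofReal ((c*r)^n) * μH[(n:ℝ)] B with hq
  have hcr : 0 < (c*r)^n := by positivity
  have hq0 : q ≠ 0 := mul_ne_zero (by simpa using hcr) hB0
  have hqt : q ≠ ⊤ := ENNReal.mul_ne_top ENNReal.ofReal_ne_top hBt
  have hterm : ∀ l ∈ N, ν {τ | ∃ k, ssPre τ k = l} ≤
      ENNReal.ofReal (r ^ α) * q⁻¹ * μH[(n:ℝ)] (ssWord f l '' B) := by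
    rintro l ⟨hl, -⟩
    have h1 : ENNReal.ofReal (ssRat ρ l ^ α) ≤ ENNReal.ofReal (r ^ α) :=
      ENNReal.ofReal_le_ofReal (Real.rpow_le_rpow (ssRat_pos hρ l).le hl.1 hα)
    have h2 : q ≤ μH[(n:ℝ)] (ssWord f l '' B) := by
      refine le_trans ?_ (ss_image_measure hρ hsim n l B)
      rw [hq]
      gcongr
      exact ssStop_lower hρ hr0 hr1 hc hl
    calc _ ≤ ENNReal.ofReal (r ^ α) := (hν l).trans h1
      _ = ENNReal.ofReal (r ^ α) * q⁻¹ * q := by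
        rw [mul_assoc, ENNReal.inv_mul_cancel hq0 hqt, mul_one]
      _ ≤ _ := by gcongr
  have hdisj : N.PairwiseDisjoint (fun l => ssWord f l '' B) := by
    intro l hl l' hl' hne
    exact (ssWord_disj hU hinj1 hd l l' (ssStop_not_prefix hl.1 hl'.1 hne)
      (ssStop_not_prefix hl'.1 hl.1 hne.symm)).mono (image_mono hBU) (image_mono hBU)
  have hball : (⋃ l ∈ N, ssWord f l '' B) ⊆ closedBall (π ω₀) ((D+1)*r) := by
    refine iUnion₂_subset ?_
    rintro l ⟨hl, ω, k, hω, rfl⟩ _ ⟨y, hy, rfl⟩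
    obtain ⟨z, hz, hz'⟩ := hπ ω k
    rw [mem_closedBall]
    have h1 := dist_triangle (ssWord f (ssPre ω k) y) (π ω) (π ω₀)
    have h2 := hs _ hω _ hω₀
    have h3 : dist (ssWord f (ssPre ω k) y) (π ω) ≤ r * D := by
      rw [← hz', ssWord_dist hsim]
      exact mul_le_mul hl.1 (hD y hy z hz) dist_nonneg hr0.le
    linarith
  have hNc : N.Countable := N.to_countable
  calc ν (π ⁻¹' s) ≤ ν (⋃ l ∈ N, {τ | ∃ k, ssPre τ k = l}) := measure_mono hcov
    _ ≤ ∑' l : N, ν {τ | ∃ k, ssPre τ k = l} := measure_biUnion_le _ hNc _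
    _ ≤ ∑' l : N, ENNReal.ofReal (r ^ α) * q⁻¹ * μH[(n:ℝ)] (ssWord f l '' B) :=
        ENNReal.tsum_le_tsum fun l => hterm l l.2
    _ = ENNReal.ofReal (r ^ α) * q⁻¹ * μH[(n:ℝ)] (⋃ l ∈ N, ssWord f l '' B) := by
        rw [ENNReal.tsum_mul_left, measure_biUnion hNc hdisj fun l _ => hmeas l]
    _ ≤ ENNReal.ofReal (r ^ α) * q⁻¹ * (ENNReal.ofReal (((D+1)*r)^n) * ssVol n) := by
        gcongr
        exact (measure_mono hball).trans (hvol _ hxK)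
    _ = _ := by
        rw [mul_assoc]
        congr 1
        rw [mul_comm, ← div_eq_mul_inv, hq, mul_pow, mul_pow, mul_comm (c^n), mul_comm ((D+1)^n),
          ENNReal.ofReal_mul (by positivity), ENNReal.ofReal_mul (by positivity), mul_assoc,
          mul_assoc, ENNReal.mul_div_mul_left]
        · have : 0 < r ^ n := by positivity
          simpa using this
        · exact ENNReal.ofReal_ne_top

lemma ss_lower [MetricSpace X] [CompleteSpace X] [MeasurableSpace X] [BorelSpace X] (n : ℕ)
    (hLocEuc : ∀ x : X, ∃ U : Set X, IsOpen U ∧ x ∈ U ∧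
      ∃ V : Set (EuclideanSpace ℝ (Fin n)), IsOpen V ∧ Nonempty (U ≃ᵢ V)) (hm : 0 < m)
    {f : Fin m → X → X} {ρ : Fin m → ℝ}
    (hρ : ∀ t, 0 < ρ t ∧ ρ t < 1)
    (hsim : ∀ t, ∀ x y : X, dist (f t x) (f t y) = ρ t * dist x y)
    {U : Set X} (hUne : U.Nonempty) (hUo : IsOpen U) (hU : ∀ t, f t '' U ⊆ U)
    (hd : ∀ t₁ t₂ : Fin m, t₁ ≠ t₂ → (f t₁ '' U) ∩ (f t₂ '' U) = ∅)
    {K : Set X} (hKne : K.Nonempty) (hKcpt : IsCompact K) (hK : K = ⋃ t, f t '' K)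
    {α : ℝ} (hα : 0 < α) (hsum : ∑ t, ρ t ^ α = 1) : μH[α] K ≠ 0 := by
  obtain ⟨π, hπm, hπ⟩ := ss_coding hm hρ hsim hKne hKcpt hK
  obtain ⟨ν, hνp, hν⟩ := ss_measure hρ hsum
  obtain ⟨c, hc, hc0⟩ := ss_min hm hρ
  -- the ball inside `U`
  obtain ⟨a, haU⟩ := hUne
  obtain ⟨P, hPo, haP, V, hV, ⟨e⟩⟩ := hLocEuc a
  obtain ⟨R, hR0, hR⟩ := Metric.nhds_basis_closedBall.mem_iff.1
    ((hUo.inter hPo).mem_nhds ⟨haU, haP⟩)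
  set B := ball a R with hBdef
  have hBU : B ⊆ U := ball_subset_closedBall.trans (hR.trans inter_subset_left)
  have hB0 : μH[(n:ℝ)] B ≠ 0 := (ss_patch_pos hV e isOpen_ball ⟨a, mem_ball_self hR0⟩
    (ball_subset_closedBall.trans (hR.trans inter_subset_right))).ne'
  have hBt : μH[(n:ℝ)] B ≠ ⊤ := by
    refine ne_top_of_le_ne_top (ENNReal.mul_ne_top ENNReal.ofReal_ne_top (ssVol_ne_top n))
      ((measure_mono ball_subset_closedBall).trans
      (ss_patch_upper e haP hR0.le (hR.trans inter_subset_right)))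
  -- distance bound
  have hbdd : Bornology.IsBounded (B ∪ K) := isBounded_ball.union hKcpt.isBounded
  set D := Metric.diam (B ∪ K) with hDdef
  have hD0 : 0 ≤ D := Metric.diam_nonneg
  have hD : ∀ y ∈ B, ∀ z ∈ K, dist y z ≤ D := fun y hy z hz =>
    Metric.dist_le_diam_of_mem hbdd (Or.inl hy) (Or.inr hz)
  -- Lebesgue number
  choose Q hQo hQx W hWo hW using hLocEuc
  obtain ⟨δ, hδ0, hδ⟩ := lebesgue_number_lemma_of_metric hKcpt hQo
    (fun x _ => mem_iUnion.2 ⟨x, hQx x⟩)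
  set ε : ℝ := min (1/2) (δ / (2 * (D + 1))) with hε
  have hε0 : 0 < ε := by positivity
  set A : ℝ≥0∞ := ENNReal.ofReal ((D+1)^n) * ssVol n / (ENNReal.ofReal (c^n) * μH[(n:ℝ)] B) with hA
  have hAt : A ≠ ⊤ := by
    refine ENNReal.div_ne_top (ENNReal.mul_ne_top ENNReal.ofReal_ne_top (ssVol_ne_top n))
      (mul_ne_zero ?_ hB0)
    have : 0 < c ^ n := by positivity
    simpa using this
  have hcore : ∀ r : ℝ, 0 < r → r ≤ ε → ∀ s : Set X, (∀ x ∈ s, ∀ y ∈ s, dist x y ≤ r) →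
      ν (π ⁻¹' s) ≤ ENNReal.ofReal (r ^ α) * A := by
    intro r hr0 hr s hs
    have hr1 : r < 1 := by
      have : r ≤ 1/2 := hr.trans (min_le_left _ _)
      linarith
    have hrδ : (D+1) * r < δ := by
      have h1 : r ≤ δ / (2 * (D + 1)) := hr.trans (min_le_right _ _)
      have h2 : 0 < 2 * (D+1) := by positivity
      rw [le_div_iff₀ h2] at h1
      nlinarith
    refine ss_core hm hρ hsim hU hd measurableSet_ball hBU hB0 hBt hD0 hD hc0 hc hα.le hν hπ
      hr0 hr1 hs fun x hx => ?_
    obtain ⟨i, hi⟩ := hδ x hx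
    obtain ⟨e'⟩ := hW i
    exact ss_patch_upper e' (hi (mem_ball_self hδ0)) (by positivity)
      ((closedBall_subset_ball hrδ).trans hi)
  -- the measure
  set μ : Measure X := ν.map π with hμ
  have hμs : ∀ s : Set X, ediam s ≤ ENNReal.ofReal (ε / 2) → μ s ≤ ediam s ^ α * A := by
    intro s hs
    have hst : ediam s ≠ ⊤ := ne_top_of_le_ne_top ENNReal.ofReal_ne_top hs
    have hdl : (ediam s).toReal ≤ ε / 2 := ENNReal.toReal_le_of_le_ofReal (by positivity) hs
    have h1 : ∀ r : ℝ, (ediam s).toReal < r → r ≤ ε → μ s ≤ ENNReal.ofReal (r ^ α) * A := by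
      intro r hr hrε
      refine (measure_mono subset_closure).trans ?_
      rw [hμ, Measure.map_apply hπm isClosed_closure.measurableSet]
      refine hcore r (ENNReal.toReal_nonneg.trans_lt hr) hrε _ fun x hx y hy => ?_
      have h3 : edist x y ≤ ediam s := by
        rw [← Metric.ediam_closure]; exact Metric.edist_le_ediam_of_mem hx hy
      rw [dist_edist]
      exact (ENNReal.toReal_mono hst h3).trans hr.le
    have h2 : Filter.Tendsto (fun r : ℝ => ENNReal.ofReal (r ^ α) * A)
        (nhdsWithin (ediam s).toReal (Ioi (ediam s).toReal))
        (nhds (ENNReal.ofReal ((ediam s).toReal ^ α) * A)) := by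
      refine ENNReal.Tendsto.mul_const ?_ (Or.inr hAt)
      refine ENNReal.tendsto_ofReal ?_
      exact ((Real.continuous_rpow_const hα.le).tendsto _).mono_left nhdsWithin_le_nhds
    have h3 : ENNReal.ofReal ((ediam s).toReal ^ α) = ediam s ^ α := by
      rw [← ENNReal.ofReal_rpow_of_nonneg ENNReal.toReal_nonneg hα.le, ENNReal.ofReal_toReal hst]
    rw [h3] at h2
    refine ge_of_tendsto h2 ?_
    filter_upwards [Ioc_mem_nhdsGT (show (ediam s).toReal < ε by linarith)] with r hr
    exact h1 r hr.1 hr.2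
  have hA1 : A + 1 ≠ ⊤ := by finiteness
  have hle : (A + 1)⁻¹ • μ ≤ μH[α] := by
    refine Measure.le_hausdorffMeasure α _ (ENNReal.ofReal (ε/2)) (by simpa using hε0) fun s hs => ?_
    rw [Measure.smul_apply, smul_eq_mul]
    calc _ ≤ (A+1)⁻¹ * (ediam s ^ α * (A + 1)) := by
          gcongr
          refine (hμs s hs).trans ?_
          gcongr
          exact le_self_add
      _ = ediam s ^ α := by
          rw [mul_comm, mul_assoc, ENNReal.mul_inv_cancel (by simp) hA1, mul_one]
  have hμK : μ K = 1 := by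
    rw [hμ, Measure.map_apply hπm hKcpt.isClosed.measurableSet]
    have : π ⁻¹' K = univ := by
      refine eq_univ_of_forall fun ω => ?_
      obtain ⟨z, hz, hz'⟩ := hπ ω 0
      have : z = π ω := by simpa [ssPre, ssWord] using hz'
      exact (show π ω ∈ K from this ▸ hz)
    rw [this]; simp
  have h := hle K
  rw [Measure.smul_apply, hμK, smul_eq_mul, mul_one] at h
  intro h0
  rw [h0, nonpos_iff_eq_zero, ENNReal.inv_eq_zero] at h
  exact hA1 h

end SelfSim



/-- Theorem 1.3(b) of the paper.  Let `X` be a complete, locally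
Euclidean metric space and `{f_t}_{t=1}^m` contractive similitudes on `X` with ratios
`ρ_t ∈ (0,1)` satisfying the open set condition, and let `K` be a nonempty compact set
with `K = ⋃_t f_t(K)`.  Then `dim_H K` is the unique real number `α` with
`∑_t ρ_t^α = 1`. -/
theorem hausdorff_dimension_of_self_similar_set_osc
    {X : Type*} [MetricSpace X] [CompleteSpace X] (n : ℕ)
    -- `X` is locally Euclidean of dimension `n`
    (hLocEuc : ∀ x : X, ∃ U : Set X, IsOpen U ∧ x ∈ U ∧
      ∃ V : Set (EuclideanSpace ℝ (Fin n)), IsOpen V ∧ Nonempty (U ≃ᵢ V))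
    (m : ℕ) (hm : 0 < m) (f : Fin m → X → X) (ρ : Fin m → ℝ)
    (hρ : ∀ t, 0 < ρ t ∧ ρ t < 1)
    (hsim : ∀ t, ∀ x y : X, dist (f t x) (f t y) = ρ t * dist x y)
    -- the open set condition (OSC)
    (hOSC : ∃ U : Set X, U.Nonempty ∧ IsOpen U ∧ Bornology.IsBounded U ∧
      (⋃ t, f t '' U) ⊆ U ∧
      ∀ t₁ t₂ : Fin m, t₁ ≠ t₂ → (f t₁ '' U) ∩ (f t₂ '' U) = ∅)
    (K : Set X) (hKne : K.Nonempty) (hKcpt : IsCompact K)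
    (hK : K = ⋃ t, f t '' K) :
    ∃ α : ℝ, (∑ t, ρ t ^ α) = 1 ∧
      (∀ β : ℝ, (∑ t, ρ t ^ β) = 1 → β = α) ∧
      dimH K = ENNReal.ofReal α := by
  borelize X
  obtain ⟨α, hα, hsum, huniq⟩ := ss_exists_alpha hm hρ
  refine ⟨α, hsum, huniq, le_antisymm ?_ ?_⟩
  · apply dimH_le_of_hausdorffMeasure_ne_top
    rw [Real.coe_toNNReal _ hα]
    exact ss_upper hm hρ hsim hKcpt hK hα hsum
  · rcases hα.eq_or_lt with h0 | h0
    · simp [← h0]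
    · obtain ⟨U, hUne, hUo, -, hU, hd⟩ := hOSC
      apply le_dimH_of_hausdorffMeasure_ne_zero
      rw [Real.coe_toNNReal _ hα]
      exact ss_lower n hLocEuc hm hρ hsim hUne hUo (fun t => (iUnion_subset_iff.1 hU) t) hd
        hKne hKcpt hK h0 hsum
end

section
/- Let 𝒞² = S¹ × [0,2π] be the cylinder {(cos θ, sin θ, z) : θ ∈ [−π,π], z ∈ [0,2π]} with its flat (locally Euclidean) metric, i.e. the product of the arc-length metric on the unit circle with the Euclidean metric on [0,2π]. Let E₀ := 𝒞², fix r ∈ [0, π/2), and let H := {(−1,0,z) : z ∈ [0,2π]}. Define relations on E₀ by: R₁(x) = {(−cos(θ/2), −sin(θ/2), z/2 + π/2)} for x = (cos θ, sin θ, z) ∉ H and R₁(x) = {(0,−1, z/2 + π/2), (0,1, z/2 + π/2)} for x ∈ H; R₂(x) = {(cos(θ/2), sin(θ/2), z/2 + π − r)} for x ∉ H and R₂(x) = {(0,1, z/2 + π − r), (0,−1, z/2 + π − r)} for x ∈ H; R₃(x) = {(cos(θ/2), sin(θ/2), z/2 + r)} for x ∉ H and R₃(x) = {(0,1, z/2 +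 r), (0,−1, z/2 + r)} for x ∈ H. Let E_{n+1} := ⋃_{t=1}^3 R_t(E_n) and K := ⋂_{n=0}^∞ E_n. Then the Hausdorff dimension of K equals log 3 / log 2. -/
open Set Real

/-- The image of a set `F` under a relation `R` (viewed as a set-valued map):
`R(F) := ⋃_{x ∈ F} R(x)`. -/
def relImage {T : Type*} (R : T → Set T) (F : Set T) : Set T := ⋃ x ∈ F, R x

/-- The point `(cos θ, sin θ, z)` of the cylinder `𝒞² ⊆ ℝ³`. -/
noncomputable def cylPt (θ z : ℝ) : EuclideanSpace ℝ (Fin 3) :=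
  (EuclideanSpace.equiv (Fin 3) ℝ).symm ![Real.cos θ, Real.sin θ, z]

namespace CylGosc

/-! ### Symbolic coding in the folded unit square -/

/-- Shift of a sequence. -/
def shift (ω : ℕ → Fin 3) : ℕ → Fin 3 := fun n => ω (n + 1)

/-- Sign of a digit. -/
def sg (t : Fin 3) : ℝ := if t = 0 then 1 else -1

/-- Height offset of a digit. -/
noncomputable def dd (t : Fin 3) : ℝ := if t = 0 then 1 / 4 else if t = 1 then 1 / 2 else 0

lemma abs_sg (t : Fin 3) : |sg t| = 1 := by
  unfold sg; split_ifs <;> simp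

lemma dd_nonneg (t : Fin 3) : 0 ≤ dd t := by
  unfold dd; split_ifs <;> norm_num

lemma dd_le (t : Fin 3) : dd t ≤ 1 / 2 := by
  unfold dd; split_ifs <;> norm_num

/-- `n`-th term of the horizontal series. -/
noncomputable def ut (n : ℕ) (ω : ℕ → Fin 3) : ℝ :=
  (∏ i ∈ Finset.range (n + 1), sg (ω i)) * ((1 / 4) * (-1 / 2) ^ n)

/-- `n`-th term of the vertical series. -/
noncomputable def vt (n : ℕ) (ω : ℕ → Fin 3) : ℝ := dd (ω n) * (1 / 2) ^ n

lemma ut_norm (n : ℕ) (ω : ℕ → Fin 3) : ‖ut n ω‖ = (1 / 4) * (1 / 2 : ℝ) ^ n := by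
  unfold ut
  rw [Real.norm_eq_abs, abs_mul, Finset.abs_prod, Finset.prod_congr rfl (fun i _ => abs_sg (ω i)),
    abs_mul, abs_pow]
  norm_num [abs_div]

lemma vt_norm (n : ℕ) (ω : ℕ → Fin 3) : ‖vt n ω‖ ≤ (1 / 2) * (1 / 2 : ℝ) ^ n := by
  unfold vt
  rw [Real.norm_eq_abs, abs_mul, abs_of_nonneg (dd_nonneg _), abs_of_pos (by positivity)]
  gcongr
  exact dd_le _

lemma geo (c : ℝ) : Summable (fun n : ℕ => c * (1 / 2 : ℝ) ^ n) :=
  hasSum_geometric_two.summable.mul_left c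

lemma ut_summable (ω : ℕ → Fin 3) : Summable (fun n => ut n ω) :=
  Summable.of_norm_bounded (geo (1 / 4)) (fun n => (ut_norm n ω).le)

lemma vt_summable (ω : ℕ → Fin 3) : Summable (fun n => vt n ω) :=
  Summable.of_norm_bounded (geo (1 / 2)) (fun n => vt_norm n ω)

/-- Horizontal coordinate, in `[0,1]`. -/
noncomputable def U (ω : ℕ → Fin 3) : ℝ := 1 / 2 + ∑' n, ut n ω

noncomputable def V (ω : ℕ → Fin 3) : ℝ := ∑' n, vt n ω

lemma U_cont : Continuous U := by
  refine continuous_const.add (continuous_tsum (fun n => ?_) (geo (1 / 4))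
    (fun n ω => (ut_norm n ω).le))
  unfold ut
  refine Continuous.mul (continuous_finsetProd _ fun i _ => ?_) continuous_const
  exact (continuous_of_discreteTopology (f := sg)).comp (continuous_apply i)

lemma V_cont : Continuous V := by
  refine continuous_tsum (fun n => ?_) (geo (1 / 2)) (fun n ω => vt_norm n ω)
  unfold vt
  refine Continuous.mul ?_ continuous_const
  exact (continuous_of_discreteTopology (f := dd)).comp (continuous_apply n)

lemma U_mem (ω : ℕ → Fin 3) : 0 ≤ U ω ∧ U ω ≤ 1 := by
  have h := tsum_of_norm_bounded (hasSum_geometric_two.mul_left (1 / 4)) (fun n => (ut_norm n ω).le)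
  rw [Real.norm_eq_abs, abs_le] at h
  unfold U
  constructor <;> linarith [h.1, h.2]

lemma V_mem (ω : ℕ → Fin 3) : 0 ≤ V ω ∧ V ω ≤ 1 := by
  have h := tsum_of_norm_bounded (hasSum_geometric_two.mul_left (1 / 2)) (fun n => vt_norm n ω)
  rw [Real.norm_eq_abs, abs_le] at h
  unfold V
  refine ⟨tsum_nonneg fun n => mul_nonneg (dd_nonneg _) (by positivity), by linarith [h.2]⟩

lemma V_rec (ω : ℕ → Fin 3) : V ω = dd (ω 0) + V (shift ω) / 2 := by
  unfold V
  rw [(vt_summable ω).tsum_eq_zero_add, div_eq_mul_inv, ← tsum_mul_right]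
  congr 1
  · simp [vt]
  · refine tsum_congr fun n => ?_
    simp only [vt, shift, pow_succ]; ring

lemma U_rec (ω : ℕ → Fin 3) :
    U ω = if ω 0 = 0 then 1 - U (shift ω) / 2 else U (shift ω) / 2 := by
  have : U ω = 1 / 2 + sg (ω 0) * (1 / 4 - (U (shift ω) - 1 / 2) / 2) := by
    unfold U
    rw [(ut_summable ω).tsum_eq_zero_add]
    have : ∑' n, ut (n + 1) ω = (sg (ω 0) * (-1 / 2)) * ∑' n, ut n (shift ω) := by
      rw [← tsum_mul_left]
      refine tsum_congr fun n => ?_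
      simp only [ut, shift]
      rw [Finset.prod_range_succ' _ (n + 1)]
      ring
    rw [this]
    simp [ut]; ring
  rw [this]; unfold sg; split_ifs <;> ring

/-! ### Integer addresses -/

/-- Horizontal address of a word. -/
def aa : (n : ℕ) → (Fin n → Fin 3) → ℤ
  | 0, _ => 0
  | n + 1, w => if w 0 = 0 then 2 ^ (n + 1) - 1 - aa n (Fin.tail w) else aa n (Fin.tail w)

/-- Vertical address of a word. -/
def bb : (n : ℕ) → (Fin n → Fin 3) → ℤ
  | 0, _ => 0
  | n + 1, w => bb n (Fin.tail w) + if w 0 = 0 then 2 ^ n else if w 0 = 1 then 2 ^ (n + 1) else 0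

lemma aa_mem : ∀ (n : ℕ) (w : Fin n → Fin 3), 0 ≤ aa n w ∧ aa n w < 2 ^ n
  | 0, _ => by simp [aa]
  | n + 1, w => by
    have := aa_mem n (Fin.tail w)
    simp only [aa, pow_succ]
    split_ifs <;> constructor <;> linarith [this.1, this.2]

lemma bb_mem : ∀ (n : ℕ) (w : Fin n → Fin 3), 0 ≤ bb n w ∧ bb n w + 2 ≤ 2 ^ (n + 1)
  | 0, _ => by simp [bb]
  | n + 1, w => by
    have := bb_mem n (Fin.tail w)
    have h2 : (0 : ℤ) < 2 ^ n := by positivity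
    simp only [bb, pow_succ] at *
    split_ifs <;> constructor <;> linarith [this.1, this.2]

lemma ab_inj : ∀ (n : ℕ) (w w' : Fin n → Fin 3), aa n w = aa n w' → bb n w = bb n w' → w = w'
  | 0, _, _ => fun _ _ => Subsingleton.elim _ _
  | n + 1, w, w' => fun ha hb => by
    have a1 := aa_mem n (Fin.tail w)
    have a2 := aa_mem n (Fin.tail w')
    have b1 := bb_mem n (Fin.tail w)
    have b2 := bb_mem n (Fin.tail w')
    have h2 : (0 : ℤ) < 2 ^ n := by positivity
    have ih := ab_inj n (Fin.tail w) (Fin.tail w')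
    simp only [aa, bb, pow_succ] at *
    have key : w 0 = w' 0 ∧ aa n (Fin.tail w) = aa n (Fin.tail w') ∧
        bb n (Fin.tail w) = bb n (Fin.tail w') := by
      generalize w 0 = x at *
      generalize w' 0 = y at *
      generalize (2 : ℤ) ^ n = q at *
      fin_cases x <;> fin_cases y <;> simp at ha hb ⊢ <;> omega
    rw [← Fin.cons_self_tail w, ← Fin.cons_self_tail w', key.1, ih key.2.1 key.2.2]

/-- Prefix of a sequence. -/
def pre (n : ℕ) (ω : ℕ → Fin 3) : Fin n → Fin 3 := fun i => ω i

lemma tail_pre (n : ℕ) (ω : ℕ → Fin 3) : Fin.tail (pre (n + 1) ω) = pre n (shift ω) := by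
  ext i; simp [Fin.tail, pre, shift]

lemma U_addr : ∀ (n : ℕ) (ω : ℕ → Fin 3),
    (aa n (pre n ω) : ℝ) ≤ 2 ^ n * U ω ∧ 2 ^ n * U ω ≤ aa n (pre n ω) + 1
  | 0, ω => by simpa [aa] using U_mem ω
  | n + 1, ω => by
    have := U_addr n (shift ω)
    have h0 : pre (n + 1) ω 0 = ω 0 := rfl
    rw [U_rec ω]
    simp only [aa, tail_pre, h0]
    split_ifs <;> push_cast <;> rw [pow_succ] <;> constructor <;> linarith [this.1, this.2]

lemma V_addr : ∀ (n : ℕ) (ω : ℕ → Fin 3),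
    (bb n (pre n ω) : ℝ) ≤ 2 ^ (n + 1) * V ω ∧ 2 ^ (n + 1) * V ω ≤ bb n (pre n ω) + 2
  | 0, ω => by
    have := V_mem ω
    simp only [bb]
    constructor <;> norm_num <;> linarith [this.1, this.2]
  | n + 1, ω => by
    have := V_addr n (shift ω)
    have h0 : pre (n + 1) ω 0 = ω 0 := rfl
    rw [V_rec ω]
    simp only [bb, tail_pre, h0, dd, pow_succ] at *
    split_ifs <;> push_cast <;> constructor <;> linarith [this.1, this.2]

/-! ### The Bernoulli measure -/

open MeasureTheory ENNReal

/-- Uniform Bernoulli measure on sequences. -/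
noncomputable def P : Measure (ℕ → Fin 3) :=
  Measure.infinitePi (fun _ : ℕ => (PMF.uniformOfFintype (Fin 3)).toMeasure)

instance : IsProbabilityMeasure P := by unfold P; infer_instance

lemma P_cyl (n : ℕ) (w : Fin n → Fin 3) : P {ω | pre n ω = w} = (3⁻¹ : ℝ≥0∞) ^ n := by
  have : {ω : ℕ → Fin 3 | pre n ω = w} =
      Set.pi (Finset.range n : Finset ℕ) (fun i => if h : i < n then {w ⟨i, h⟩} else univ) := by
    ext ω
    simp only [mem_ofPred_eq, Set.mem_pi, Finset.coe_range, mem_Iio]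
    constructor
    · rintro rfl i hi
      simp [hi, pre]
    · intro h
      ext i
      have := h i i.2
      simp at this
      simp [pre, this]
  rw [this, P, Measure.infinitePi_pi _ (fun i _ => MeasurableSet.of_discrete)]
  rw [Finset.prod_congr rfl (g := fun _ => (3⁻¹ : ℝ≥0∞))]
  · simp
  · intro i hi
    rw [dif_pos (Finset.mem_range.1 hi), PMF.toMeasure_apply_singleton _ _ (by simp)]
    simp

/-- Counting bound. -/
lemma P_count (n N : ℕ) (S : Set (ℕ → Fin 3))
    (hS : ∀ ω ∈ S, ∀ ω' ∈ S, |aa n (pre n ω) - aa n (pre n ω')| ≤ N ∧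
      |bb n (pre n ω) - bb n (pre n ω')| ≤ N) :
    P S ≤ ((2 * N + 1) ^ 2 : ℕ) * (3⁻¹ : ℝ≥0∞) ^ n := by
  classical
  rcases S.eq_empty_or_nonempty with rfl | ⟨ω₀, h0⟩
  · simp
  let W : Finset (Fin n → Fin 3) := Finset.univ.filter (fun w => ∃ ω ∈ S, pre n ω = w)
  have hsub : S ⊆ ⋃ w ∈ W, {ω | pre n ω = w} := by
    intro ω hω
    simp only [mem_iUnion]
    exact ⟨pre n ω, by simp only [W, Finset.mem_filter]; exact ⟨Finset.mem_univ _, ω, hω, rfl⟩, rfl⟩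
  have hcard : W.card ≤ (2 * N + 1) ^ 2 := by
    let a0 := aa n (pre n ω₀)
    let b0 := bb n (pre n ω₀)
    have : W.card ≤ (Finset.Icc (a0 - N) (a0 + N) ×ˢ Finset.Icc (b0 - N) (b0 + N)).card := by
      refine Finset.card_le_card_of_injOn (fun w => (aa n w, bb n w)) ?_ ?_
      · intro w hw
        simp only [W, Finset.coe_filter, mem_ofPred_eq] at hw
        obtain ⟨-, ω, hω, rfl⟩ := hw
        have := hS ω hω ω₀ h0
        rw [abs_le, abs_le] at this
        simp only [Finset.coe_product, Finset.coe_Icc, Set.mem_prod, mem_Icc, a0, b0]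
        omega
      · intro w _ w' _ h
        simp only [Prod.mk.injEq] at h
        exact ab_inj n w w' h.1 h.2
    refine this.trans (le_of_eq ?_)
    rw [Finset.card_product, Int.card_Icc, Int.card_Icc, sq]
    congr 1 <;> omega
  calc P S ≤ P (⋃ w ∈ W, {ω | pre n ω = w}) := measure_mono hsub
    _ ≤ ∑ w ∈ W, P {ω | pre n ω = w} := measure_biUnion_finset_le _ _
    _ = W.card * (3⁻¹ : ℝ≥0∞) ^ n := by
      rw [Finset.sum_congr rfl (fun w _ => P_cyl n w)]; simp
    _ ≤ _ := by gcongr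

/-! ### Geometry of the cylinder -/

lemma dist_sq (θ z θ' z' : ℝ) : dist (cylPt θ z) (cylPt θ' z') ^ 2 =
    (cos θ - cos θ') ^ 2 + (sin θ - sin θ') ^ 2 + (z - z') ^ 2 := by
  rw [EuclideanSpace.dist_eq, Real.sq_sqrt (by positivity)]
  simp [Fin.sum_univ_three, cylPt, Real.dist_eq, sq_abs]

lemma cyl_inj {θ z θ' z' : ℝ} (h : cylPt θ z = cylPt θ' z') : cos θ = cos θ' ∧ z = z' := by
  have h0 := congrArg (fun p : EuclideanSpace ℝ (Fin 3) => p 0) h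
  have h2 := congrArg (fun p : EuclideanSpace ℝ (Fin 3) => p 2) h
  simp [cylPt] at h0 h2
  exact ⟨h0, h2⟩

lemma dist_le (θ z θ' z' : ℝ) :
    dist (cylPt θ z) (cylPt θ' z') ≤ 2 * |θ - θ'| + |z - z'| := by
  refine abs_le_of_sq_le_sq' ?_ (by positivity) |>.2
  rw [dist_sq]
  have h1 := sq_le_sq' (by linarith [abs_nonneg (cos θ - cos θ'), abs_nonneg (θ - θ')])
    (abs_cos_sub_cos_le θ θ')
  have h2 := sq_le_sq' (by linarith [abs_nonneg (sin θ - sin θ'), abs_nonneg (θ - θ')])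
    (abs_sin_sub_sin_le θ θ')
  rw [sq_abs (cos θ - cos θ')] at h1
  rw [sq_abs (sin θ - sin θ')] at h2
  have := sq_abs (z - z')
  nlinarith [abs_nonneg (θ - θ'), abs_nonneg (z - z'),
    mul_nonneg (abs_nonneg (θ - θ')) (abs_nonneg (z - z')), sq_nonneg |θ - θ'|]

lemma le_dist_z (θ z θ' z' : ℝ) : |z - z'| ≤ dist (cylPt θ z) (cylPt θ' z') := by
  refine abs_le_of_sq_le_sq ?_ dist_nonneg
  rw [dist_sq]; nlinarith [sq_nonneg (cos θ - cos θ'), sq_nonneg (sin θ - sin θ')]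

lemma le_dist_θ {θ z θ' z' : ℝ} (h : |θ - θ'| ≤ π) :
    |θ - θ'| ≤ π / 2 * dist (cylPt θ z) (cylPt θ' z') := by
  refine abs_le_of_sq_le_sq ?_ (by positivity)
  rw [mul_pow, dist_sq]
  have h1 := Real.cos_le_one_sub_mul_cos_sq h
  rw [cos_sub] at h1
  have e : (cos θ - cos θ') ^ 2 + (sin θ - sin θ') ^ 2 =
      2 - 2 * (cos θ * cos θ' + sin θ * sin θ') := by
    nlinarith [sin_sq_add_cos_sq θ, sin_sq_add_cos_sq θ']
  rw [e]
  have h3 : (4 / π ^ 2) * (θ - θ') ^ 2 ≤ 2 - 2 * (cos θ * cos θ' + sin θ * sin θ') := by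
    have : 4 / π ^ 2 = 2 * (2 / π ^ 2) := by ring
    rw [this]; linarith
  have h4 : (θ - θ') ^ 2 = (π / 2) ^ 2 * ((4 / π ^ 2) * (θ - θ') ^ 2) := by
    field_simp; norm_num
  calc (θ - θ') ^ 2 = (π / 2) ^ 2 * ((4 / π ^ 2) * (θ - θ') ^ 2) := h4
    _ ≤ _ := by
      have hzz := sq_nonneg (z - z')
      gcongr
      linarith only [hzz, h3]

/-! ### The coded points -/

/-- Height of a coded point. -/
noncomputable def Z (r : ℝ) (ω : ℕ → Fin 3) : ℝ := 2 * r + (2 * π - 4 * r) * V ω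

/-- The coded point on the cylinder. -/
noncomputable def Pt (r : ℝ) (ω : ℕ → Fin 3) : EuclideanSpace ℝ (Fin 3) :=
  cylPt (π * U ω) (Z r ω)

lemma cylPt_cont : Continuous (fun p : ℝ × ℝ => cylPt p.1 p.2) := by
  unfold cylPt
  refine (EuclideanSpace.equiv (Fin 3) ℝ).symm.continuous.comp (continuous_pi fun i => ?_)
  fin_cases i <;> simp <;> fun_prop

lemma Pt_meas (r : ℝ) : Measurable (Pt r) := by
  have h : Continuous (fun ω => (π * U ω, Z r ω)) :=
    (continuous_const.mul U_cont).prodMk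
      (continuous_const.add (continuous_const.mul V_cont))
  exact (cylPt_cont.comp h).measurable

lemma addr_close (r : ℝ) (hr : r < π / 2) (n : ℕ) (ω ω' : ℕ → Fin 3)
    (h : dist (Pt r ω) (Pt r ω') ≤ (1 / 2) ^ n) :
    |aa n (pre n ω) - aa n (pre n ω')| ≤ (⌈2 / (2 * π - 4 * r)⌉₊ + 2 : ℕ) ∧
    |bb n (pre n ω) - bb n (pre n ω')| ≤ (⌈2 / (2 * π - 4 * r)⌉₊ + 2 : ℕ) := by
  have hL : 0 < 2 * π - 4 * r := by linarith
  have hp : (0 : ℝ) < 2 ^ n := by positivity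
  have hpp : (2 : ℝ) ^ n * (1 / 2) ^ n = 1 := by rw [← mul_pow]; norm_num
  have hceil := Nat.le_ceil (2 / (2 * π - 4 * r))
  have u1 := U_addr n ω
  have u2 := U_addr n ω'
  have v1 := V_addr n ω
  have v2 := V_addr n ω'
  have hU : 2 ^ n * |U ω - U ω'| ≤ 1 / 2 := by
    have e : |π * U ω - π * U ω'| = π * |U ω - U ω'| := by
      rw [← mul_sub, abs_mul, abs_of_pos pi_pos]
    have b : |U ω - U ω'| ≤ 1 := by
      rw [abs_le]
      have := U_mem ω
      have := U_mem ω'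
      constructor <;> linarith
    have h1 := le_dist_θ (θ := π * U ω) (θ' := π * U ω') (z := Z r ω) (z' := Z r ω')
      (by rw [e]; nlinarith [pi_pos])
    rw [e] at h1
    have h2 : |U ω - U ω'| ≤ 1 / 2 * (1 / 2) ^ n := by
      have : π * |U ω - U ω'| ≤ π * (1 / 2 * (1 / 2) ^ n) := by
        calc _ ≤ _ := h1
          _ ≤ π / 2 * (1 / 2) ^ n := by
            have : (0 : ℝ) ≤ π / 2 := by positivity
            exact mul_le_mul_of_nonneg_left h this
          _ = _ := by ring
      exact le_of_mul_le_mul_left this pi_pos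
    calc _ ≤ 2 ^ n * (1 / 2 * (1 / 2 : ℝ) ^ n) := by gcongr
      _ = 1 / 2 * (2 ^ n * (1 / 2 : ℝ) ^ n) := by ring
      _ = 1 / 2 := by rw [hpp]; norm_num
  have hV : 2 ^ (n + 1) * |V ω - V ω'| ≤ 2 / (2 * π - 4 * r) := by
    have h1 := (le_dist_z (π * U ω) (Z r ω) (π * U ω') (Z r ω')).trans h
    have e : |Z r ω - Z r ω'| = (2 * π - 4 * r) * |V ω - V ω'| := by
      unfold Z
      rw [add_sub_add_left_eq_sub, ← mul_sub, abs_mul, abs_of_pos hL]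
    rw [e] at h1
    rw [le_div_iff₀ hL]
    calc _ = 2 * 2 ^ n * ((2 * π - 4 * r) * |V ω - V ω'|) := by ring
      _ ≤ 2 * 2 ^ n * (1 / 2) ^ n := by gcongr
      _ = 2 := by rw [mul_assoc, hpp]; norm_num
  have hU' : |2 ^ n * U ω - 2 ^ n * U ω'| ≤ 1 / 2 := by
    rwa [← mul_sub, abs_mul, abs_of_pos hp]
  have hV' : |2 ^ (n + 1) * V ω - 2 ^ (n + 1) * V ω'| ≤ 2 / (2 * π - 4 * r) := by
    rwa [← mul_sub, abs_mul, abs_of_pos (by positivity)]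
  rw [abs_le] at hU' hV'
  have hc0 : (0 : ℝ) ≤ (⌈2 / (2 * π - 4 * r)⌉₊ : ℝ) := by positivity
  constructor
  · have : |(aa n (pre n ω) : ℝ) - aa n (pre n ω')| ≤ (⌈2 / (2 * π - 4 * r)⌉₊ + 2 : ℕ) := by
      rw [abs_le]; push_cast; constructor <;> linarith
    exact_mod_cast this
  · have : |(bb n (pre n ω) : ℝ) - bb n (pre n ω')| ≤ (⌈2 / (2 * π - 4 * r)⌉₊ + 2 : ℕ) := by
      rw [abs_le]; push_cast; constructor <;> linarith
    exact_mod_cast this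

/-- The exponent. -/
noncomputable def ss : ℝ := Real.log 3 / Real.log 2

lemma ss_pos : 0 < ss := div_pos (Real.log_pos (by norm_num)) (Real.log_pos (by norm_num))

lemma two_rpow_ss : (2 : ℝ) ^ ss = 3 := by
  rw [Real.rpow_def_of_pos (by norm_num), ss,
    mul_div_cancel₀ _ (Real.log_pos (by norm_num)).ne', Real.exp_log (by norm_num)]

lemma half_pow_rpow (n : ℕ) : ((1 / 2 : ℝ) ^ n) ^ ss = (1 / 3) ^ n := by
  rw [← Real.rpow_natCast, ← Real.rpow_mul (by norm_num), mul_comm, Real.rpow_mul (by norm_num),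
    Real.div_rpow (by norm_num) (by norm_num), two_rpow_ss, Real.one_rpow, Real.rpow_natCast]

lemma inv3 (n : ℕ) : (3⁻¹ : ℝ≥0∞) ^ n = ENNReal.ofReal ((1 / 3) ^ n) := by
  rw [ENNReal.ofReal_pow (by norm_num), one_div, ENNReal.ofReal_inv_of_pos (by norm_num)]
  simp

lemma mass_le (r : ℝ) (hr : r < π / 2) : ∃ M : ℕ, M ≠ 0 ∧ ∀ (n : ℕ)
    (A : Set (EuclideanSpace ℝ (Fin 3))), Metric.ediam A ≤ ENNReal.ofReal ((1 / 2) ^ n) →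
      (P.map (Pt r)) A ≤ M * ENNReal.ofReal ((1 / 3) ^ n) := by
  refine ⟨(2 * (⌈2 / (2 * π - 4 * r)⌉₊ + 2) + 1) ^ 2, by positivity, fun n A hA => ?_⟩
  refine (measure_mono subset_closure).trans ?_
  rw [Measure.map_apply (Pt_meas r) isClosed_closure.measurableSet, ← inv3]
  refine P_count n _ _ fun ω hω ω' hω' => addr_close r hr n ω ω' ?_
  have := (Metric.edist_le_ediam_of_mem (s := closure A) (x := Pt r ω) (y := Pt r ω') hω hω').trans ((Metric.ediam_closure A).le.trans hA)
  rwa [edist_dist, ENNReal.ofReal_le_ofReal_iff (by positivity)] at this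

lemma mass_le' (r : ℝ) (hr : r < π / 2) : ∃ M : ℕ, M ≠ 0 ∧
    ∀ A : Set (EuclideanSpace ℝ (Fin 3)), Metric.ediam A ≤ 1 →
      (P.map (Pt r)) A ≤ M * Metric.ediam A ^ ss := by
  obtain ⟨M, hM, h⟩ := mass_le r hr
  refine ⟨M * 3, by positivity, fun A hA => ?_⟩
  have hfin : Metric.ediam A ≠ ⊤ := ne_top_of_le_ne_top ENNReal.one_ne_top hA
  obtain ⟨δ, hδ, hδA⟩ : ∃ δ : ℝ, 0 ≤ δ ∧ Metric.ediam A = ENNReal.ofReal δ :=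
    ⟨(Metric.ediam A).toReal, ENNReal.toReal_nonneg, (ENNReal.ofReal_toReal hfin).symm⟩
  rw [hδA] at hA ⊢
  rw [ENNReal.ofReal_le_one] at hA
  rcases hδ.eq_or_lt with rfl | hpos
  · have ht : Filter.Tendsto (fun n : ℕ => (M : ℝ≥0∞) * ENNReal.ofReal ((1 / 3) ^ n))
        Filter.atTop (nhds (M * ENNReal.ofReal 0)) := by
      refine ENNReal.Tendsto.const_mul ?_ (Or.inr (ENNReal.natCast_ne_top M))
      exact ENNReal.tendsto_ofReal
        (tendsto_pow_atTop_nhds_zero_of_lt_one (by norm_num) (by norm_num))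
    have h0 := ge_of_tendsto' ht (fun n => h n A (by rw [hδA]; simp))
    refine h0.trans ?_
    simp
  · obtain ⟨n, h1, h2⟩ := exists_nat_pow_near_of_lt_one hpos hA
      (by norm_num : (0 : ℝ) < 1 / 2) (by norm_num)
    refine (h n A (by rw [hδA]; exact ENNReal.ofReal_le_ofReal h2)).trans ?_
    rw [ENNReal.ofReal_rpow_of_pos hpos]
    have h3 : (1 / 3 : ℝ) ^ n ≤ 3 * δ ^ ss := by
      have := Real.rpow_le_rpow (by positivity) h1.le ss_pos.le
      rw [half_pow_rpow, pow_succ] at this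
      linarith
    calc _ ≤ (M : ℝ≥0∞) * ENNReal.ofReal (3 * δ ^ ss) := by gcongr
      _ = _ := by
        rw [ENNReal.ofReal_mul (by norm_num)]
        push_cast
        rw [mul_assoc]
        simp

lemma lower (r : ℝ) (hr : r < π / 2) (K : Set (EuclideanSpace ℝ (Fin 3)))
    (hK : ∀ ω, Pt r ω ∈ K) : μH[ss] K ≠ 0 := by
  obtain ⟨M, hM, h⟩ := mass_le' r hr
  have hM0 : (M : ℝ≥0∞) ≠ 0 := by exact_mod_cast hM
  have hMt : (M : ℝ≥0∞) ≠ ⊤ := ENNReal.natCast_ne_top M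
  have hle : (M : ℝ≥0∞)⁻¹ • P.map (Pt r) ≤ μH[ss] := by
    refine Measure.le_hausdorffMeasure ss _ 1 one_pos fun A hA => ?_
    rw [Measure.smul_apply, smul_eq_mul]
    calc _ ≤ (M : ℝ≥0∞)⁻¹ * (M * Metric.ediam A ^ ss) := by gcongr; exact h A hA
      _ = _ := by rw [← mul_assoc, ENNReal.inv_mul_cancel hM0 hMt, one_mul]
  have h1 : (1 : ℝ≥0∞) ≤ P.map (Pt r) K := by
    refine le_trans ?_ (Measure.le_map_apply (Pt_meas r).aemeasurable K)
    have : Pt r ⁻¹' K = univ := eq_univ_of_forall hK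
    rw [this, measure_univ]
  intro h0
  have := hle K
  rw [h0, Measure.smul_apply, smul_eq_mul, nonpos_iff_eq_zero, mul_eq_zero] at this
  rcases this with h2 | h2
  · exact hMt (ENNReal.inv_eq_zero.1 h2)
  · rw [h2] at h1; exact absurd h1 (by norm_num)

/-! ### Upper bound -/

/-- Folded angular maps. -/
noncomputable def FA : (n : ℕ) → (Fin n → Fin 3) → ℝ → ℝ
  | 0, _, x => x
  | n + 1, w, x => if w 0 = 0 then π - FA n (Fin.tail w) x / 2 else FA n (Fin.tail w) x / 2

/-- Height maps. -/
noncomputable def FZ (r : ℝ) : (n : ℕ) → (Fin n → Fin 3) → ℝ → ℝ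
  | 0, _, x => x
  | n + 1, w, x => if w 0 = 0 then FZ r n (Fin.tail w) x / 2 + π / 2 else
      if w 0 = 1 then FZ r n (Fin.tail w) x / 2 + π - r else FZ r n (Fin.tail w) x / 2 + r

lemma FA_mem : ∀ (n : ℕ) (w : Fin n → Fin 3) (x : ℝ), x ∈ Icc 0 π → FA n w x ∈ Icc 0 π
  | 0, _, x => fun h => h
  | n + 1, w, x => fun h => by
    have := FA_mem n (Fin.tail w) x h
    simp only [FA, mem_Icc] at *
    split_ifs <;> constructor <;> linarith [this.1, this.2]

lemma FA_dist : ∀ (n : ℕ) (w : Fin n → Fin 3) (x y : ℝ),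
    |FA n w x - FA n w y| = |x - y| * (1 / 2) ^ n
  | 0, _, x, y => by simp [FA]
  | n + 1, w, x, y => by
    have := FA_dist n (Fin.tail w) x y
    rw [pow_succ, ← mul_assoc, ← this]
    simp only [FA]
    have e : ∀ a : ℝ, |a| * (1 / 2) = |a / 2| := fun a => by rw [abs_div]; norm_num; ring
    rw [e]
    split_ifs
    · rw [abs_sub_comm]; congr 1; ring
    · congr 1; ring

lemma FZ_dist (r : ℝ) : ∀ (n : ℕ) (w : Fin n → Fin 3) (x y : ℝ),
    |FZ r n w x - FZ r n w y| = |x - y| * (1 / 2) ^ n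
  | 0, _, x, y => by simp [FZ]
  | n + 1, w, x, y => by
    have := FZ_dist r n (Fin.tail w) x y
    rw [pow_succ, ← mul_assoc, ← this]
    simp only [FZ]
    have e : ∀ a : ℝ, |a| * (1 / 2) = |a / 2| := fun a => by rw [abs_div]; norm_num; ring
    rw [e]
    split_ifs <;> congr 1 <;> ring

/-- Sign of a Boolean. -/
def sb (b : Bool) : ℝ := if b then 1 else -1

/-- Covering pieces. -/
def piece (r : ℝ) (n : ℕ) (i : (Fin n → Fin 3) × Bool) : Set (EuclideanSpace ℝ (Fin 3)) :=
  {p | ∃ x ∈ Icc 0 π, ∃ y ∈ Icc 0 (2 * π), p = cylPt (sb i.2 * FA n i.1 x) (FZ r n i.1 y)}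

lemma piece_diam (r : ℝ) (n : ℕ) (i : (Fin n → Fin 3) × Bool) :
    Metric.ediam (piece r n i) ≤ ENNReal.ofReal (4 * π * (1 / 2) ^ n) := by
  refine Metric.ediam_le ?_
  rintro _ ⟨x, hx, y, hy, rfl⟩ _ ⟨x', hx', y', hy', rfl⟩
  rw [edist_dist]
  refine ENNReal.ofReal_le_ofReal ((dist_le _ _ _ _).trans ?_)
  have hs : |sb i.2| = 1 := by unfold sb; split_ifs <;> simp
  rw [← mul_sub, abs_mul, hs, FA_dist, FZ_dist]
  have h1 : |x - x'| ≤ π := by rw [abs_le]; constructor <;> linarith [hx.1, hx.2, hx'.1, hx'.2]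
  have h2 : |y - y'| ≤ 2 * π := by
    rw [abs_le]; constructor <;> linarith [hy.1, hy.2, hy'.1, hy'.2]
  have h3 : (0 : ℝ) < (1 / 2) ^ n := by positivity
  nlinarith [mul_le_mul_of_nonneg_right h1 h3.le, mul_le_mul_of_nonneg_right h2 h3.le]

lemma upper (r : ℝ) (K : Set (EuclideanSpace ℝ (Fin 3)))
    (hK : ∀ n, K ⊆ ⋃ i, piece r n i) : μH[ss] K ≠ ⊤ := by
  have h := Measure.hausdorffMeasure_le_liminf_sum ss K (l := Filter.atTop)
    (fun n : ℕ => ENNReal.ofReal (4 * π * (1 / 2) ^ n)) (by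
      have : Filter.Tendsto (fun n : ℕ => 4 * π * (1 / 2 : ℝ) ^ n) Filter.atTop (nhds 0) := by
        simpa using (tendsto_pow_atTop_nhds_zero_of_lt_one (r := (1 / 2 : ℝ))
          (by norm_num) (by norm_num)).const_mul (4 * π)
      simpa using ENNReal.tendsto_ofReal this)
    (piece r) (Filter.Eventually.of_forall fun n i => piece_diam r n i)
    (Filter.Eventually.of_forall hK)
  have hb : ∀ n : ℕ, ∑ i, Metric.ediam (piece r n i) ^ ss ≤
      ENNReal.ofReal (2 * (4 * π) ^ ss) := by
    intro n
    calc _ ≤ ∑ i : (Fin n → Fin 3) × Bool, ENNReal.ofReal ((4 * π) ^ ss * (1 / 3) ^ n) := by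
          refine Finset.sum_le_sum fun i _ => ?_
          refine (ENNReal.rpow_le_rpow (piece_diam r n i) ss_pos.le).trans ?_
          rw [ENNReal.ofReal_rpow_of_pos (by positivity),
            Real.mul_rpow (by positivity) (by positivity), half_pow_rpow]
      _ = ENNReal.ofReal (∑ i : (Fin n → Fin 3) × Bool, ((4 * π) ^ ss * (1 / 3) ^ n)) :=
          (ENNReal.ofReal_sum_of_nonneg fun _ _ => by positivity).symm
      _ ≤ _ := by
          refine ENNReal.ofReal_le_ofReal (le_of_eq ?_)
          simp only [Finset.sum_const, Finset.card_univ, Fintype.card_prod, Fintype.card_fun,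
            Fintype.card_fin, Fintype.card_bool, nsmul_eq_mul]
          push_cast
          have : (3 : ℝ) ^ n * (1 / 3) ^ n = 1 := by rw [← mul_pow]; norm_num
          linear_combination (2 * (4 * π) ^ ss) * this
  refine ne_top_of_le_ne_top (ENNReal.ofReal_ne_top (r := 2 * (4 * π) ^ ss)) (h.trans ?_)
  refine (Filter.liminf_le_liminf (Filter.Eventually.of_forall hb)).trans ?_
  simp

end CylGosc

/-- Example 4.5 of the paper.  On the cylinder
`E₀ = {(cos θ, sin θ, z) : θ ∈ [−π,π], z ∈ [0,2π]}` (realized isometrically—up to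
bi-Lipschitz equivalence, which does not change Hausdorff dimension—as a subset of
`ℝ³`), with `r ∈ [0, π/2)` and relations `R₁, R₂, R₃` given by the half-angle maps
(which are single-valued off `H = {(−1,0,z)}` and doubly valued on `H`, corresponding
to the two representatives `θ = ±π`), the attractor `K = ⋂_n E_n` has Hausdorff
dimension `log 3 / log 2`. -/
theorem hausdorff_dimension_cylinder_gosc_example
    (r : ℝ) (hr0 : 0 ≤ r) (hr : r < π / 2)
    (R : Fin 3 → EuclideanSpace ℝ (Fin 3) → Set (EuclideanSpace ℝ (Fin 3)))
    (hR₁ : ∀ p, R 0 p = {q | ∃ θ z : ℝ, θ ∈ Icc (-π) π ∧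
      p = cylPt θ z ∧ q = cylPt (θ / 2 + π) (z / 2 + π / 2)})
    (hR₂ : ∀ p, R 1 p = {q | ∃ θ z : ℝ, θ ∈ Icc (-π) π ∧
      p = cylPt θ z ∧ q = cylPt (θ / 2) (z / 2 + π - r)})
    (hR₃ : ∀ p, R 2 p = {q | ∃ θ z : ℝ, θ ∈ Icc (-π) π ∧
      p = cylPt θ z ∧ q = cylPt (θ / 2) (z / 2 + r)})
    (E : ℕ → Set (EuclideanSpace ℝ (Fin 3)))
    (hE0 : E 0 = {p | ∃ θ z : ℝ, θ ∈ Icc (-π) π ∧ z ∈ Icc 0 (2 * π) ∧ p = cylPt θ z})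
    (hEsucc : ∀ n : ℕ, E (n + 1) = ⋃ t : Fin 3, relImage (R t) (E n)) :
    dimH (⋂ n : ℕ, E n) = ENNReal.ofReal (Real.log 3 / Real.log 2) := by
  have hmem : ∀ n q, q ∈ E (n + 1) ↔ ∃ t, ∃ p ∈ E n, q ∈ R t p := by
    intro n q
    rw [hEsucc]
    simp [relImage]
  have hlow : ∀ n ω, cylPt (π * CylGosc.U ω) (CylGosc.Z r ω) ∈ E n ∧
      cylPt (-(π * CylGosc.U ω)) (CylGosc.Z r ω) ∈ E n := by
    intro n
    induction n with
    | zero =>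
      intro ω
      have hu := CylGosc.U_mem ω
      have hv := CylGosc.V_mem ω
      have hz : CylGosc.Z r ω ∈ Icc 0 (2 * π) := by
        unfold CylGosc.Z
        constructor <;> nlinarith [pi_pos]
      rw [hE0]
      refine ⟨⟨_, _, ⟨?_, ?_⟩, hz, rfl⟩, ⟨_, _, ⟨?_, ?_⟩, hz, rfl⟩⟩ <;> nlinarith [pi_pos]
    | succ n ih =>
      intro ω
      obtain ⟨i1, i2⟩ := ih (CylGosc.shift ω)
      have hu := CylGosc.U_mem (CylGosc.shift ω)
      have m1 : π * CylGosc.U (CylGosc.shift ω) ∈ Icc (-π) π := by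
        constructor <;> nlinarith [pi_pos]
      have m2 : -(π * CylGosc.U (CylGosc.shift ω)) ∈ Icc (-π) π := by
        constructor <;> nlinarith [pi_pos]
      have hU := CylGosc.U_rec ω
      have hV := CylGosc.V_rec ω
      rw [hmem, hmem]
      generalize hx : ω 0 = x at *
      fin_cases x
      · simp [CylGosc.dd] at hU hV
        have hz : CylGosc.Z r ω = CylGosc.Z r (CylGosc.shift ω) / 2 + π / 2 := by
          unfold CylGosc.Z; rw [hV]; ring
        refine ⟨⟨0, _, i2, ?_⟩, ⟨0, _, i1, ?_⟩⟩ <;> rw [hR₁]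
        · exact ⟨_, _, m2, rfl, by rw [hz, hU]; congr 1; ring⟩
        · refine ⟨_, _, m1, rfl, ?_⟩
          rw [hz, hU]
          have : π * CylGosc.U (CylGosc.shift ω) / 2 + π =
            -(π * (1 - CylGosc.U (CylGosc.shift ω) / 2)) + 2 * π := by ring
          rw [this]
          simp [cylPt]
      · simp [CylGosc.dd] at hU hV
        have hz : CylGosc.Z r ω = CylGosc.Z r (CylGosc.shift ω) / 2 + π - r := by
          unfold CylGosc.Z; rw [hV]; ring
        refine ⟨⟨1, _, i1, ?_⟩, ⟨1, _, i2, ?_⟩⟩ <;> rw [hR₂]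
        · exact ⟨_, _, m1, rfl, by rw [hz, hU]; congr 1; ring⟩
        · exact ⟨_, _, m2, rfl, by rw [hz, hU]; congr 1; ring⟩
      · simp [CylGosc.dd] at hU hV
        have hz : CylGosc.Z r ω = CylGosc.Z r (CylGosc.shift ω) / 2 + r := by
          unfold CylGosc.Z; rw [hV]; ring
        refine ⟨⟨2, _, i1, ?_⟩, ⟨2, _, i2, ?_⟩⟩ <;> rw [hR₃]
        · exact ⟨_, _, m1, rfl, by rw [hz, hU]; congr 1; ring⟩
        · exact ⟨_, _, m2, rfl, by rw [hz, hU]; congr 1; ring⟩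
  have hup : ∀ n, ∀ p ∈ E n, ∃ i, p ∈ CylGosc.piece r n i := by
    intro n
    induction n with
    | zero =>
      intro p hp
      rw [hE0] at hp
      obtain ⟨θ, z, hθ, hz, rfl⟩ := hp
      rcases le_total 0 θ with h | h
      · exact ⟨(fun _ => 0, true), θ, ⟨h, hθ.2⟩, z, hz, by
          simp [CylGosc.sb, CylGosc.FA, CylGosc.FZ]⟩
      · exact ⟨(fun _ => 0, false), -θ, ⟨by linarith, by linarith [hθ.1]⟩, z, hz, by
          simp [CylGosc.sb, CylGosc.FA, CylGosc.FZ]⟩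
    | succ n ih =>
      intro q hq
      rw [hmem] at hq
      obtain ⟨t, p, hp, hq⟩ := hq
      obtain ⟨⟨w, b⟩, x, hx, y, hy, hpc⟩ := ih p hp
      have hfa := CylGosc.FA_mem n w x hx
      have main : ∀ θ z, θ ∈ Icc (-π) π → p = cylPt θ z →
          ∃ b', θ = CylGosc.sb b' * CylGosc.FA n w x ∧ z = CylGosc.FZ r n w y := by
        intro θ z hθ hpθ
        obtain ⟨hc, hz⟩ := CylGosc.cyl_inj (hpθ.symm.trans hpc)
        have hc' : cos |θ| = cos (CylGosc.FA n w x) := by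
          rw [cos_abs, hc]
          unfold CylGosc.sb
          split_ifs <;> simp
        have habs : |θ| = CylGosc.FA n w x :=
          injOn_cos ⟨abs_nonneg _, abs_le.2 hθ⟩ hfa hc'
        rcases le_total 0 θ with h | h
        · exact ⟨true, by rw [← habs, abs_of_nonneg h]; simp [CylGosc.sb], hz⟩
        · exact ⟨false, by rw [← habs, abs_of_nonpos h]; simp [CylGosc.sb], hz⟩
      fin_cases t
      · simp only [Fin.zero_eta, hR₁] at hq
        obtain ⟨θ, z, hθ, hpθ, rfl⟩ := hq
        obtain ⟨b', rfl, rfl⟩ := main θ z hθ hpθ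
        refine ⟨(Fin.cons 0 w, !b'), x, hx, y, hy, ?_⟩
        simp only [CylGosc.FA, CylGosc.FZ, Fin.cons_zero, Fin.tail_cons, if_true]
        cases b'
        · congr 1
          simp [CylGosc.sb]; ring
        · have : CylGosc.sb true * CylGosc.FA n w x / 2 + π =
            CylGosc.sb (!true) * (π - CylGosc.FA n w x / 2) + 2 * π := by
              simp [CylGosc.sb]; ring
          rw [this]
          simp [cylPt]
      · simp only [Fin.mk_one, hR₂] at hq
        obtain ⟨θ, z, hθ, hpθ, rfl⟩ := hq
        obtain ⟨b', rfl, rfl⟩ := main θ z hθ hpθ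
        refine ⟨(Fin.cons 1 w, b'), x, hx, y, hy, ?_⟩
        simp [CylGosc.FA, CylGosc.FZ, mul_div_assoc]
      · simp only [Fin.reduceFinMk, hR₃] at hq
        obtain ⟨θ, z, hθ, hpθ, rfl⟩ := hq
        obtain ⟨b', rfl, rfl⟩ := main θ z hθ hpθ
        refine ⟨(Fin.cons 2 w, b'), x, hx, y, hy, ?_⟩
        simp [CylGosc.FA, CylGosc.FZ, mul_div_assoc]
  have hL := CylGosc.lower r hr (⋂ n, E n) (fun ω => mem_iInter.2 fun n => (hlow n ω).1)
  have hU := CylGosc.upper r (⋂ n, E n) (fun n p hp => mem_iUnion.2 (hup n p (mem_iInter.1 hp n)))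
  have hs : ((Real.toNNReal CylGosc.ss : NNReal) : ℝ) = CylGosc.ss :=
    Real.coe_toNNReal _ CylGosc.ss_pos.le
  rw [← hs] at hL hU
  exact dimH_of_hausdorffMeasure_ne_zero_ne_top hL hU
end

section
/- Let 𝒞² = {(cos θ, sin θ, z) : θ ∈ [−π,π], z ∈ [0,2π]} be the cylinder with its flat metric, let E₀ := 𝒞², fix r ∈ [0,π/2), and let H := {(−1,0,z) : z ∈ [0,2π]}. Define four relations on E₀: for x = (cos θ, sin θ, z) ∉ H, R₁(x) = {(−cos(θ/2), −sin(θ/2), z/2 + π/2)}, R₂(x) = {(cos(θ/2), sin(θ/2), z/2 + π − r)}, R₃(x) = {(cos(θ/2), sin(θ/2), z/2 + π/2)}, R₄(x) = {(cos(θ/2), sin(θ/2), z/2 + r)}; and for x ∈ H, R₁(x) = {(0,−1, z/2 + π/2), (0,1, z/2 + π/2)}, R₂(x) = {(0,1, z/2 + π − r), (0,−1, z/2 + π − r)}, R₃(x) = {(0,1, z/2 + π/2), (0,−1, z/2 + π/2)}, R₄(x) = {(0,1, z/2 + r), (0,−1, z/2 + r)}. Let E_{n+1} := ⋃_{t=1}^4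 R_t(E_n) and K := ⋂_{n=0}^∞ E_n. Then the Hausdorff dimension of K equals log(2 + √2) / log 2. -/
open Set Real

namespace CylEx

/-- Pairs `(x, y)` : `x` the number with bits `b₀ … b_m`, and `y` a signed digit sum with digits
allowed only where two consecutive bits agree. -/
def T : ℕ → Finset (ℤ × ℤ)
  | 0 => {(0, 0), (1, 0)}
  | m + 1 => (T m).image (fun p => (2 * p.1 + (1 - p.1 % 2), 2 * p.2)) ∪
      ((T m).image (fun p => (2 * p.1 + p.1 % 2, 2 * p.2)) ∪
       (T m ∪ (T m).image (fun p => (p.1, p.2 - 1))).image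
         (fun p => (2 * p.1 + p.1 % 2, 2 * p.2 + 1)))

/-- pairs `(x,y)` with `(x,y)` and `(x,y+1)` both in `T m` -/
def TB (m : ℕ) : Finset (ℤ × ℤ) := T m ∩ (T m).image (fun p => (p.1, p.2 - 1))

lemma mem_shift {S : Finset (ℤ × ℤ)} {X Y : ℤ} :
    (X, Y) ∈ S.image (fun p => (p.1, p.2 - 1)) ↔ (X, Y + 1) ∈ S := by
  simp only [Finset.mem_image, Prod.exists, Prod.mk.injEq]
  constructor
  · rintro ⟨a, b, h, rfl, rfl⟩
    simpa using h
  · intro h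
    exact ⟨X, Y + 1, h, rfl, by ring⟩

lemma mem_T_succ {m : ℕ} {X Y : ℤ} : (X, Y) ∈ T (m + 1) ↔
    ∃ x y β ε : ℤ, (x, y) ∈ T m ∧ (β = 0 ∨ β = 1) ∧ (ε = 0 ∨ ((ε = 1 ∨ ε = -1) ∧ β = x % 2)) ∧
      X = 2 * x + β ∧ Y = 2 * y + ε := by
  rw [T]
  simp only [Finset.mem_union, Finset.mem_image, Prod.exists, Prod.mk.injEq]
  constructor
  · rintro (⟨a, b, h, rfl, rfl⟩ | ⟨a, b, h, rfl, rfl⟩ | ⟨a, b, h | ⟨a', b', h, rfl, rfl⟩, rfl, rfl⟩)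
    · exact ⟨a, b, _, 0, h, by omega, Or.inl rfl, rfl, by ring⟩
    · exact ⟨a, b, _, 0, h, by omega, Or.inl rfl, rfl, by ring⟩
    · exact ⟨a, b, _, 1, h, by omega, Or.inr ⟨Or.inl rfl, rfl⟩, rfl, by ring⟩
    · exact ⟨a', b', _, -1, h, by omega, Or.inr ⟨Or.inr rfl, rfl⟩, rfl, by ring⟩
  · rintro ⟨x, y, β, ε, h, hβ, (rfl | ⟨rfl | rfl, hβ'⟩), rfl, rfl⟩
    · by_cases hx : β = x % 2
      · exact Or.inr (Or.inl ⟨x, y, h, by omega, by ring⟩)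
      · exact Or.inl ⟨x, y, h, by omega, by ring⟩
    · exact Or.inr (Or.inr ⟨x, y, Or.inl h, by omega, by ring⟩)
    · exact Or.inr (Or.inr ⟨x, y - 1, Or.inr ⟨x, y, h, rfl, rfl⟩, by omega, by ring⟩)

lemma TB_succ (m : ℕ) : TB (m + 1) =
    (T m).image (fun p => (2 * p.1 + p.1 % 2, 2 * p.2)) ∪
      (T m).image (fun p => (2 * p.1 + p.1 % 2, 2 * p.2 - 1)) := by
  ext ⟨X, Y⟩
  rw [TB, Finset.mem_inter, mem_shift, mem_T_succ, mem_T_succ]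
  simp only [Finset.mem_union, Finset.mem_image, Prod.exists, Prod.mk.injEq]
  constructor
  · rintro ⟨⟨x, y, β, ε, h, hβ, hε, hX, hY⟩, x', y', β', ε', h', hβ', hε', hX', hY'⟩
    by_cases hε0 : ε = 0
    · left; exact ⟨x, y, h, by omega, by omega⟩
    · right; exact ⟨x', y', h', by omega, by omega⟩
  · rintro (⟨a, b, h, rfl, rfl⟩ | ⟨a, b, h, rfl, rfl⟩)
    · exact ⟨⟨a, b, _, 0, h, by omega, Or.inl rfl, rfl, by ring⟩,
        ⟨a, b, _, 1, h, by omega, Or.inr ⟨Or.inl rfl, rfl⟩, rfl, by ring⟩⟩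
    · exact ⟨⟨a, b, _, -1, h, by omega, Or.inr ⟨Or.inr rfl, rfl⟩, rfl, by ring⟩,
        ⟨a, b, _, 0, h, by omega, Or.inl rfl, rfl, by ring⟩⟩

lemma card_TB_succ (m : ℕ) : (TB (m + 1)).card = 2 * (T m).card := by
  rw [TB_succ, Finset.card_union_of_disjoint, Finset.card_image_of_injective,
    Finset.card_image_of_injective]
  · ring
  · rintro ⟨a, b⟩ ⟨c, d⟩ h
    simp only [Prod.mk.injEq] at h ⊢
    omega
  · rintro ⟨a, b⟩ ⟨c, d⟩ h
    simp only [Prod.mk.injEq] at h ⊢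
    omega
  · rw [Finset.disjoint_left]
    rintro ⟨X, Y⟩ h1 h2
    simp only [Finset.mem_image, Prod.exists, Prod.mk.injEq] at h1 h2
    obtain ⟨a, b, -, h3, h4⟩ := h1
    obtain ⟨c, d, -, h5, h6⟩ := h2
    omega

lemma card_T_succ (m : ℕ) : (T (m + 1)).card + (TB m).card = 4 * (T m).card := by
  have hU : (T m ∪ (T m).image (fun p => (p.1, p.2 - 1))).card + (TB m).card
      = 2 * (T m).card := by
    rw [TB, Finset.card_union_add_card_inter, Finset.card_image_of_injective]
    · ring
    · rintro ⟨a, b⟩ ⟨c, d⟩ h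
      simp only [Prod.mk.injEq] at h ⊢
      omega
  rw [T, Finset.card_union_of_disjoint, Finset.card_union_of_disjoint,
    Finset.card_image_of_injective,
    Finset.card_image_of_injective, Finset.card_image_of_injective]
  · omega
  · rintro ⟨a, b⟩ ⟨c, d⟩ h
    simp only [Prod.mk.injEq] at h ⊢
    omega
  · rintro ⟨a, b⟩ ⟨c, d⟩ h
    simp only [Prod.mk.injEq] at h ⊢
    omega
  · rintro ⟨a, b⟩ ⟨c, d⟩ h
    simp only [Prod.mk.injEq] at h ⊢
    omega
  · rw [Finset.disjoint_left]
    rintro ⟨X, Y⟩ h1 h2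
    rw [Finset.mem_image] at h1 h2
    simp only [Prod.exists, Prod.mk.injEq] at h1 h2
    obtain ⟨a, b, -, h3, h4⟩ := h1
    obtain ⟨c, d, -, h5, h6⟩ := h2
    omega
  · rw [Finset.disjoint_left]
    rintro ⟨X, Y⟩ h1 h2
    rw [Finset.mem_union, Finset.mem_image, Finset.mem_image] at h2
    rw [Finset.mem_image] at h1
    simp only [Prod.exists, Prod.mk.injEq] at h1 h2
    obtain ⟨a, b, -, h3, h4⟩ := h1
    rcases h2 with ⟨c, d, -, h5, h6⟩ | ⟨c, d, -, h5, h6⟩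
    · have : a = c := by omega
      subst this
      omega
    · omega

lemma card_TB_le (m : ℕ) : (TB m).card ≤ (T m).card :=
  Finset.card_le_card Finset.inter_subset_left

lemma card_eq (m : ℕ) :
    2 * ((T m).card : ℝ) - (2 - √2) * (TB m).card = 4 * (2 + √2) ^ m := by
  have hs : √2 * √2 = 2 := Real.mul_self_sqrt (by norm_num)
  induction m with
  | zero =>
    have h1 : (T 0).card = 2 := by decide
    have h2 : (TB 0).card = 0 := by decide
    rw [h1, h2]; norm_num
  | succ m ih =>
    have h1 : ((T (m + 1)).card : ℝ) = 4 * (T m).card - (TB m).card := by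
      have := card_T_succ m
      rw [eq_sub_iff_add_eq]; exact_mod_cast this
    have h2 : ((TB (m + 1)).card : ℝ) = 2 * (T m).card := by exact_mod_cast card_TB_succ m
    rw [h1, h2, pow_succ]
    linear_combination (2 + √2) * ih - ((TB m).card : ℝ) * hs

lemma card_lower (m : ℕ) : (2 + √2) ^ m ≤ ((T m).card : ℝ) := by
  have h := card_eq m
  have h2 : (√2) ≤ 2 := by rw [Real.sqrt_le_left (by norm_num)]; norm_num
  have h3 : 0 ≤ (2 - √2) * ((TB m).card : ℝ) := mul_nonneg (by linarith) (by positivity)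
  have h4 : 0 ≤ (2 + √2) ^ m := by positivity
  linarith

lemma card_upper (m : ℕ) : ((T m).card : ℝ) ≤ 4 * (2 + √2) ^ m := by
  have h := card_eq m
  have h1 : 1 ≤ √2 := by rw [Real.one_le_sqrt]; norm_num
  have h2 : (√2) ≤ 2 := by rw [Real.sqrt_le_left (by norm_num)]; norm_num
  have h3 : ((TB m).card : ℝ) ≤ (T m).card := by exact_mod_cast card_TB_le m
  have h4 : (2 - √2) * ((TB m).card : ℝ) ≤ 1 * (T m).card := by
    have : 0 ≤ ((TB m).card : ℝ) := by positivity
    apply mul_le_mul <;> linarith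
  linarith

lemma T_bounds {m : ℕ} {x y : ℤ} (h : (x, y) ∈ T m) :
    0 ≤ x ∧ x + 1 ≤ 2 ^ (m + 1) ∧ y + 1 ≤ 2 ^ m ∧ -(2 ^ m) ≤ y - 1 := by
  induction m generalizing x y with
  | zero =>
    simp only [T, Finset.mem_insert, Finset.mem_singleton, Prod.mk.injEq] at h
    norm_num; omega
  | succ m ih =>
    rw [mem_T_succ] at h
    obtain ⟨x', y', β, ε, h, hβ, hε, rfl, rfl⟩ := h
    obtain ⟨h1, h2, h3, h4⟩ := ih h
    rw [pow_succ _ (m + 1), pow_succ _ m] at *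
    omega

lemma T_compl {m : ℕ} {x y : ℤ} (h : (x, y) ∈ T m) : (2 ^ (m + 1) - 1 - x, y) ∈ T m := by
  induction m generalizing x y with
  | zero =>
    simp only [T, Finset.mem_insert, Finset.mem_singleton, Prod.mk.injEq] at h ⊢
    norm_num; omega
  | succ m ih =>
    rw [mem_T_succ] at h ⊢
    obtain ⟨x', y', β, ε, h, hβ, hε, rfl, rfl⟩ := h
    refine ⟨_, y', 1 - β, ε, ih h, by omega, ?_, by ring, rfl⟩
    rw [pow_succ]
    omega

lemma T_prepend {m : ℕ} {x y b e : ℤ} (h : (x, y) ∈ T m) (hb : b = 0 ∨ b = 1)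
    (he : e = 0 ∨ ((e = 1 ∨ e = -1) ∧ (b = 1 ↔ 2 ^ m ≤ x))) :
    (b * 2 ^ (m + 1) + x, e * 2 ^ m + y) ∈ T (m + 1) := by
  induction m generalizing x y with
  | zero =>
    rw [mem_T_succ]
    simp only [T, Finset.mem_insert, Finset.mem_singleton, Prod.mk.injEq] at h ⊢
    refine ⟨b, 0, x, e, by omega, by omega, by omega, by ring, ?_⟩
    rw [pow_zero]; omega
  | succ m ih =>
    rw [mem_T_succ] at h ⊢
    obtain ⟨x', y', β, ε, h, hβ, hε, rfl, rfl⟩ := h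
    refine ⟨b * 2 ^ (m + 1) + x', e * 2 ^ m + y', β, ε, ih h ?_, hβ, ?_, by ring, by ring⟩
    · rw [pow_succ] at he; omega
    · have : (b * 2 ^ (m + 1) + x') % 2 = x' % 2 := by
        rw [pow_succ, ← mul_assoc]; omega
      omega

lemma T_peel {m : ℕ} {X Y : ℤ} (h : (X, Y) ∈ T (m + 1)) :
    ∃ x y b e : ℤ, (x, y) ∈ T m ∧ (b = 0 ∨ b = 1) ∧
    (e = 0 ∨ ((e = 1 ∨ e = -1) ∧ (b = 1 ↔ 2 ^ m ≤ x))) ∧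
    X = b * 2 ^ (m + 1) + x ∧ Y = e * 2 ^ m + y := by
  induction m generalizing X Y with
  | zero =>
    rw [mem_T_succ] at h
    obtain ⟨x, y, β, ε, h, hβ, hε, rfl, rfl⟩ := h
    simp only [T, Finset.mem_insert, Finset.mem_singleton, Prod.mk.injEq] at h ⊢
    refine ⟨β, 0, x, ε, by omega, by omega, by rw [pow_zero]; omega, by ring, ?_⟩
    rw [pow_zero]; omega
  | succ m ih =>
    rw [mem_T_succ] at h
    obtain ⟨x', y', β, ε, h, hβ, hε, rfl, rfl⟩ := h
    obtain ⟨x, y, b, e, h', hb, he, rfl, rfl⟩ := ih h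
    refine ⟨2 * x + β, 2 * y + ε, b, e, ?_, hb, ?_, by ring, by ring⟩
    · rw [mem_T_succ]
      refine ⟨x, y, β, ε, h', hβ, ?_, rfl, rfl⟩
      have : (b * 2 ^ (m + 1) + x) % 2 = x % 2 := by
        rw [pow_succ, ← mul_assoc]; omega
      omega
    · rw [pow_succ]; omega

end CylEx

namespace CylEx

lemma dist_cylPt_sq (θ z θ' z' : ℝ) :
    dist (cylPt θ z) (cylPt θ' z') ^ 2 = (2 - 2 * cos (θ - θ')) + (z - z') ^ 2 := by
  rw [EuclideanSpace.dist_eq, Real.sq_sqrt (by positivity), Real.cos_sub]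
  simp only [cylPt, Fin.sum_univ_three, Real.dist_eq, sq_abs]
  simp
  linear_combination Real.sin_sq_add_cos_sq θ + Real.sin_sq_add_cos_sq θ'

lemma dist_cylPt_le (θ z θ' z' : ℝ) :
    dist (cylPt θ z) (cylPt θ' z') ≤ |θ - θ'| + |z - z'| := by
  apply le_of_sq_le_sq _ (by positivity)
  rw [dist_cylPt_sq]
  have h := Real.one_sub_sq_div_two_le_cos (x := θ - θ')
  have h1 := sq_abs (θ - θ')
  have h2 := sq_abs (z - z')
  have h3 := mul_nonneg (abs_nonneg (θ - θ')) (abs_nonneg (z - z'))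
  nlinarith

lemma le_dist_cylPt_left (θ z θ' z' : ℝ) (h : |θ - θ'| ≤ π) :
    2 / π * |θ - θ'| ≤ dist (cylPt θ z) (cylPt θ' z') := by
  apply le_of_sq_le_sq _ dist_nonneg
  rw [dist_cylPt_sq, mul_pow, sq_abs, div_pow]
  have h := Real.cos_le_one_sub_mul_cos_sq h
  have h2 := sq_nonneg (z - z')
  have : (2 : ℝ) ^ 2 / π ^ 2 * (θ - θ') ^ 2 = 2 * (2 / π ^ 2 * (θ - θ') ^ 2) := by ring
  linarith

lemma le_dist_cylPt_right (θ z θ' z' : ℝ) :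
    |z - z'| ≤ dist (cylPt θ z) (cylPt θ' z') := by
  apply le_of_sq_le_sq _ dist_nonneg
  rw [dist_cylPt_sq, sq_abs]
  have h := Real.cos_le_one (θ - θ')
  linarith

lemma cylPt_eq {θ z θ' z' : ℝ} (h : cylPt θ z = cylPt θ' z') :
    z = z' ∧ ∃ j : ℤ, θ - θ' = j * (2 * π) := by
  have h1 := dist_cylPt_sq θ z θ' z'
  rw [h, dist_self] at h1
  have h2 := Real.cos_le_one (θ - θ')
  have h3 := sq_nonneg (z - z')
  constructor
  · have : (z - z') ^ 2 = 0 := by linarith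
    have := pow_eq_zero_iff (two_ne_zero) |>.1 this
    linarith
  · have : cos (θ - θ') = 1 := by linarith
    obtain ⟨j, hj⟩ := (Real.cos_eq_one_iff _).1 this
    exact ⟨j, hj.symm⟩

lemma cylPt_congr {θ z θ' z' : ℝ} (hz : z = z') (j : ℤ) (h : θ = θ' + j * (2 * π)) :
    cylPt θ z = cylPt θ' z' := by
  subst hz h
  simp [cylPt, Real.cos_add_int_mul_two_pi, Real.sin_add_int_mul_two_pi]

/-- One step of the iterated relation system (union of the four relations). -/
def Step (c : ℝ) (p q : EuclideanSpace ℝ (Fin 3)) : Prop :=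
  ∃ θ z : ℝ, θ ∈ Icc (-π) π ∧ p = cylPt θ z ∧
    (q = cylPt (θ / 2 + π) (z / 2 + π / 2) ∨
      ∃ ε : ℤ, (ε = 0 ∨ ε = 1 ∨ ε = -1) ∧ q = cylPt (θ / 2) (z / 2 + π / 2 + c * ε))

/-- Covering cells of level `m`. -/
def cell (c : ℝ) (m : ℕ) (t : ℤ × ℤ) : Set (EuclideanSpace ℝ (Fin 3)) :=
  {p | ∃ X z : ℝ, (t.1 : ℝ) ≤ X * 2 ^ (m + 1) ∧ X * 2 ^ (m + 1) ≤ t.1 + 1 ∧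
    |(z - π) * 2 ^ m - 2 * c * t.2| ≤ π ∧ p = cylPt (2 * π * X) z}

lemma cell_step_aux (c X z : ℝ) (m : ℕ) (x y b e : ℤ)
    (h1 : (x : ℝ) ≤ X * 2 ^ (m + 1)) (h2 : X * 2 ^ (m + 1) ≤ x + 1)
    (h3 : |(z - π) * 2 ^ m - 2 * c * y| ≤ π) :
    cylPt (2 * π * ((X + b) / 2)) (z / 2 + π / 2 + c * e) ∈
      cell c (m + 1) (b * 2 ^ (m + 1) + x, e * 2 ^ m + y) := by
  refine ⟨(X + b) / 2, z / 2 + π / 2 + c * e, ?_, ?_, ?_, rfl⟩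
  · push_cast
    rw [pow_succ _ (m + 1)]
    linarith
  · push_cast
    rw [pow_succ _ (m + 1)]
    linarith
  · push_cast
    rw [pow_succ]
    convert h3 using 2
    ring

lemma cell_step {c : ℝ} {m : ℕ} {t : ℤ × ℤ} (ht : t ∈ T m) {p q} (hp : p ∈ cell c m t)
    (h : Step c p q) : ∃ t' ∈ T (m + 1), q ∈ cell c (m + 1) t' := by
  obtain ⟨x, y⟩ := t
  obtain ⟨X, z', h1, h2, h3, rfl⟩ := hp
  simp only at h1 h2 h3
  obtain ⟨θ, z, ⟨hθ1, hθ2⟩, hpe, hq⟩ := h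
  obtain ⟨rfl, j, hj⟩ := cylPt_eq hpe
  have hpi := Real.pi_pos
  obtain ⟨hx0, hx1, -, -⟩ := T_bounds ht
  have hX0 : 0 ≤ X := by
    have : (0 : ℝ) ≤ x := by exact_mod_cast hx0
    have h4 : (0 : ℝ) < 2 ^ (m + 1) := by positivity
    by_contra hc
    have := mul_neg_of_neg_of_pos (not_le.1 hc) h4
    linarith
  have hX1 : X ≤ 1 := by
    have : (x : ℝ) + 1 ≤ 2 ^ (m + 1) := by exact_mod_cast hx1
    have h4 : (0 : ℝ) < 2 ^ (m + 1) := by positivity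
    exact le_of_mul_le_mul_right (by linarith) h4
  have hθ : θ = 2 * π * (X - j) := by linarith
  have hj1 : X - j ≤ 1 / 2 := by
    by_contra hc
    have := mul_pos hpi (sub_pos.2 (not_le.1 hc))
    nlinarith
  have hj2 : -(1 / 2) ≤ X - j := by
    by_contra hc
    have := mul_pos hpi (sub_pos.2 (not_le.1 hc))
    nlinarith
  have hj01 : j = 0 ∨ j = 1 := by
    have a1 : (j : ℝ) < 2 := by linarith
    have a2 : (-1 : ℝ) < j := by linarith
    have a3 : j < 2 := by exact_mod_cast a1
    have a4 : -1 < j := by exact_mod_cast a2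
    omega
  -- replace the cell so that the first bit of `x` is `j`
  obtain ⟨x', hx', h1', h2', hbit⟩ : ∃ x' : ℤ, (x', y) ∈ T m ∧ (x' : ℝ) ≤ X * 2 ^ (m + 1) ∧
      X * 2 ^ (m + 1) ≤ x' + 1 ∧ (j = 1 ↔ 2 ^ m ≤ x') := by
    have hpow : (2 : ℝ) ^ (m + 1) = 2 * 2 ^ m := by ring
    have h4 : (0 : ℝ) < 2 ^ m := by positivity
    have hcomp := T_compl ht
    have hpowZ : (2 : ℤ) ^ (m + 1) = 2 * 2 ^ m := by ring
    rcases hj01 with rfl | rfl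
    · have hXle : X * 2 ^ (m + 1) ≤ 2 ^ m := by rw [hpow]; norm_num at hj1; nlinarith
      by_cases hc : 2 ^ m ≤ x
      · have hxr : (2 : ℝ) ^ m ≤ x := by exact_mod_cast hc
        have hxe : (x : ℝ) = 2 ^ m := le_antisymm (by linarith) hxr
        have hxe' : x = 2 ^ m := by exact_mod_cast hxe
        refine ⟨2 ^ (m + 1) - 1 - x, hcomp, ?_, ?_, ?_⟩
        · push_cast; linarith
        · push_cast; linarith
        · rw [hpowZ]; omega
      · exact ⟨x, ht, h1, h2, by omega⟩
    · have hXle : 2 ^ m ≤ X * 2 ^ (m + 1) := by rw [hpow]; norm_num at hj2; nlinarith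
      by_cases hc : 2 ^ m ≤ x
      · exact ⟨x, ht, h1, h2, by omega⟩
      · have hc' : x + 1 ≤ 2 ^ m := by omega
        have hxr : (x : ℝ) + 1 ≤ 2 ^ m := by exact_mod_cast hc'
        have hxe : (x : ℝ) + 1 = 2 ^ m := le_antisymm hxr (by linarith)
        have hxe' : x + 1 = 2 ^ m := by exact_mod_cast hxe
        refine ⟨2 ^ (m + 1) - 1 - x, hcomp, ?_, ?_, ?_⟩
        · push_cast; linarith
        · push_cast; linarith
        · rw [hpowZ]; omega
  rcases hq with rfl | ⟨ε, hε, rfl⟩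
  · refine ⟨_, T_prepend (b := 1 - j) (e := 0) hx' (by omega) (Or.inl rfl), ?_⟩
    convert cell_step_aux c X z' m x' y (1 - j) 0 h1' h2' h3 using 1
    apply cylPt_congr (by push_cast; ring) 0
    rw [hθ]; push_cast; ring
  · refine ⟨_, T_prepend (b := j) (e := ε) hx' (by omega) (by omega), ?_⟩
    convert cell_step_aux c X z' m x' y j ε h1' h2' h3 using 1
    apply cylPt_congr rfl (-j)
    rw [hθ]; push_cast; ring

lemma cover {c : ℝ} {E : ℕ → Set (EuclideanSpace ℝ (Fin 3))}
    (hE0 : E 0 = {p | ∃ θ z : ℝ, θ ∈ Icc (-π) π ∧ z ∈ Icc 0 (2 * π) ∧ p = cylPt θ z})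
    (hE : ∀ n q, q ∈ E (n + 1) ↔ ∃ p ∈ E n, Step c p q) (m : ℕ) {q} (hq : q ∈ E m) :
    ∃ t ∈ T m, q ∈ cell c m t := by
  induction m generalizing q with
  | zero =>
    rw [hE0] at hq
    obtain ⟨θ, z, ⟨h1, h2⟩, ⟨h3, h4⟩, rfl⟩ := hq
    have hpi := Real.pi_pos
    have hz : |(z - π) * 2 ^ 0 - 2 * c * (0 : ℤ)| ≤ π := by
      rw [abs_le]; constructor <;> · push_cast; linarith
    have hd : 2 * π * (θ / (2 * π)) = θ := by field_simp
    by_cases h : 0 ≤ θ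
    · refine ⟨(0, 0), by simp [T], θ / (2 * π), z, ?_, ?_, hz, ?_⟩
      · push_cast; positivity
      · have : θ / (2 * π) ≤ 1 / 2 := by rw [div_le_iff₀ (by positivity)]; linarith
        push_cast; linarith
      · rw [hd]
    · refine ⟨(1, 0), by simp [T], θ / (2 * π) + 1, z, ?_, ?_, hz, ?_⟩
      · have : -(1 / 2) ≤ θ / (2 * π) := by rw [le_div_iff₀ (by positivity)]; linarith
        push_cast; linarith
      · have : θ / (2 * π) ≤ 0 := by rw [div_le_iff₀ (by positivity)]; linarith
        push_cast; linarith
      · apply cylPt_congr rfl (-1)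
        rw [mul_add, hd]; push_cast; ring
  | succ m ih =>
    obtain ⟨p, hp, hs⟩ := (hE m q).1 hq
    obtain ⟨t, ht, hpt⟩ := ih hp
    exact cell_step ht hpt hs

lemma ediam_cell (c : ℝ) (m : ℕ) (t : ℤ × ℤ) :
    Metric.ediam (cell c m t) ≤ ENNReal.ofReal (3 * π * (2 ^ m)⁻¹) := by
  apply Metric.ediam_le
  rintro p ⟨X, z, h1, h2, h3, rfl⟩ q ⟨X', z', h1', h2', h3', rfl⟩
  rw [edist_dist]
  apply ENNReal.ofReal_le_ofReal
  refine (dist_cylPt_le _ _ _ _).trans ?_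
  have hpi := Real.pi_pos
  have h4 : (0 : ℝ) < 2 ^ m := by positivity
  have hpow : (2 : ℝ) ^ (m + 1) = 2 * 2 ^ m := by ring
  have a1 : |2 * π * X - 2 * π * X'| * 2 ^ m ≤ π := by
    rw [← abs_of_pos h4, ← abs_mul]
    have : (2 * π * X - 2 * π * X') * 2 ^ m = π * (X * 2 ^ (m + 1) - X' * 2 ^ (m + 1)) := by ring
    rw [this, abs_mul, abs_of_pos hpi]
    have : |X * 2 ^ (m + 1) - X' * 2 ^ (m + 1)| ≤ 1 := by
      rw [abs_le]; constructor <;> linarith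
    nlinarith
  have a2 : |z - z'| * 2 ^ m ≤ 2 * π := by
    rw [← abs_of_pos h4, ← abs_mul]
    rw [abs_le] at h3 h3' ⊢
    constructor <;> linarith
  rw [← div_eq_mul_inv, le_div_iff₀ h4]
  linarith

end CylEx

namespace CylEx

open Filter Topology MeasureTheory Measure in
lemma upper_bound {c : ℝ} {E : ℕ → Set (EuclideanSpace ℝ (Fin 3))}
    (hE0 : E 0 = {p | ∃ θ z : ℝ, θ ∈ Icc (-π) π ∧ z ∈ Icc 0 (2 * π) ∧ p = cylPt θ z})
    (hE : ∀ n q, q ∈ E (n + 1) ↔ ∃ p ∈ E n, Step c p q) :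
    dimH (⋂ n : ℕ, E n) ≤ ENNReal.ofReal (Real.log (2 + √2) / Real.log 2) := by
  have hpi := Real.pi_pos
  have hl2 : 0 < Real.log 2 := Real.log_pos (by norm_num)
  have hlam : (1 : ℝ) < 2 + √2 := by have := Real.sqrt_nonneg 2; linarith
  have hl : 0 < Real.log (2 + √2) := Real.log_pos hlam
  set s : ℝ := Real.log (2 + √2) / Real.log 2 with hs
  have hs0 : 0 < s := by positivity
  have h2s : (2 : ℝ) ^ s = 2 + √2 := by
    rw [Real.rpow_def_of_pos (by norm_num), hs, mul_div_cancel₀ _ hl2.ne', Real.exp_log (by linarith)]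
  have hcoe : ((s.toNNReal : NNReal) : ℝ) = s := Real.coe_toNNReal _ hs0.le
  change _ ≤ ((s.toNNReal : NNReal) : ENNReal)
  apply dimH_le_of_hausdorffMeasure_ne_top
  rw [hcoe]
  have hr : Tendsto (fun m : ℕ => ENNReal.ofReal (3 * π * (2 ^ m)⁻¹)) atTop (𝓝 0) := by
    rw [← ENNReal.ofReal_zero]
    apply ENNReal.tendsto_ofReal
    have h : Tendsto (fun m : ℕ => (3 * π) * ((1 / 2 : ℝ)) ^ m) atTop (𝓝 ((3 * π) * 0)) :=
      (tendsto_pow_atTop_nhds_zero_of_lt_one (by norm_num) (by norm_num)).const_mul _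
    rw [mul_zero] at h
    refine h.congr fun m => ?_
    rw [one_div, inv_pow]
  have key := hausdorffMeasure_le_liminf_sum (ι := fun m : ℕ => {t // t ∈ T m}) s (⋂ n : ℕ, E n)
    (l := atTop) _ hr (fun m t => cell c m t.1)
    (Eventually.of_forall fun m t => ediam_cell c m t.1)
    (Eventually.of_forall fun m q hq => by
      obtain ⟨t, ht, hqt⟩ := cover hE0 hE m (mem_iInter.1 hq m)
      exact mem_iUnion.2 ⟨⟨t, ht⟩, hqt⟩)
  refine ne_top_of_le_ne_top (b := ENNReal.ofReal (4 * (3 * π) ^ s)) ENNReal.ofReal_ne_top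
    (key.trans ?_)
  apply liminf_le_of_le
  · isBoundedDefault
  intro b hb
  obtain ⟨m, hm⟩ := hb.exists
  refine hm.trans ?_
  calc ∑ t : {t // t ∈ T m}, Metric.ediam (cell c m t.1) ^ s
      ≤ ∑ t : {t // t ∈ T m}, ENNReal.ofReal (3 * π * (2 ^ m)⁻¹) ^ s :=
        Finset.sum_le_sum fun t _ => ENNReal.rpow_le_rpow (ediam_cell c m t.1) hs0.le
    _ = ENNReal.ofReal ((T m).card * ((3 * π) * (2 ^ m)⁻¹) ^ s) := by
        rw [Finset.sum_const, Finset.card_univ, Fintype.card_coe, nsmul_eq_mul,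
          ENNReal.ofReal_rpow_of_pos (by positivity), ENNReal.ofReal_mul (by positivity),
          ENNReal.ofReal_natCast]
    _ ≤ ENNReal.ofReal (4 * (3 * π) ^ s) := by
        apply ENNReal.ofReal_le_ofReal
        have : (((2 : ℝ) ^ m)⁻¹) ^ s = ((2 + √2) ^ m)⁻¹ := by
          rw [Real.inv_rpow (by positivity), ← h2s, ← Real.rpow_natCast, ← Real.rpow_natCast,
            ← Real.rpow_mul (by norm_num), ← Real.rpow_mul (by norm_num), mul_comm]
        rw [Real.mul_rpow (by positivity) (by positivity), this]
        have h1 := card_upper m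
        have h3 : 0 < (2 + √2) ^ m := by positivity
        have h5 : 0 < (3 * π) ^ s := by positivity
        rw [← mul_assoc, ← div_eq_mul_inv, div_le_iff₀ h3]
        nlinarith

/-- point with normalized coordinates -/
noncomputable def P (c X V : ℝ) : EuclideanSpace ℝ (Fin 3) := cylPt (2 * π * X) (π + 2 * c * V)

lemma step_P {c X V : ℝ} {b e : ℤ} (h0 : 0 ≤ X) (h1 : X ≤ 1) (hb : b = 0 ∨ b = 1)
    (he : e = 0 ∨ ((e = 1 ∨ e = -1) ∧ ((b = 0 ∧ X ≤ 1 / 2) ∨ (b = 1 ∧ 1 / 2 ≤ X)))) :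
    Step c (P c X V) (P c ((b + X) / 2) ((e + V) / 2)) := by
  have hpi := Real.pi_pos
  -- same branch
  have same : ((b = 0 ∧ X ≤ 1 / 2) ∨ (b = 1 ∧ 1 / 2 ≤ X)) →
      Step c (P c X V) (P c ((b + X) / 2) ((e + V) / 2)) := by
    intro hbX
    refine ⟨2 * π * (X - b), π + 2 * c * V, ?_, ?_, Or.inr ⟨e, by omega, ?_⟩⟩
    · rcases hbX with ⟨rfl, h⟩ | ⟨rfl, h⟩ <;> constructor <;> push_cast <;> nlinarith
    · exact cylPt_congr rfl b (by ring)
    · exact cylPt_congr (by ring) b (by ring)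
  rcases he with rfl | ⟨-, he⟩
  · have cross : ((b = 0 ∧ 1 / 2 ≤ X) ∨ (b = 1 ∧ X ≤ 1 / 2)) →
        Step c (P c X V) (P c ((b + X) / 2) (((0 : ℤ) + V) / 2)) := by
      intro hbX
      refine ⟨2 * π * (X - (1 - b)), π + 2 * c * V, ?_, ?_, Or.inl ?_⟩
      · rcases hbX with ⟨rfl, h⟩ | ⟨rfl, h⟩ <;> constructor <;> push_cast <;> nlinarith
      · exact cylPt_congr rfl (1 - b) (by push_cast; ring)
      · exact cylPt_congr (by push_cast; ring) 0 (by push_cast; ring)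
    rcases hb with rfl | rfl <;> rcases le_total X (1 / 2) with h | h
    · exact same (Or.inl ⟨rfl, h⟩)
    · exact cross (Or.inl ⟨rfl, h⟩)
    · exact cross (Or.inr ⟨rfl, h⟩)
    · exact same (Or.inr ⟨rfl, h⟩)
  · exact same he

lemma tail_mem {c : ℝ} (hc0 : 0 ≤ c) (hc1 : c ≤ π / 2) {E : ℕ → Set (EuclideanSpace ℝ (Fin 3))}
    (hE0 : E 0 = {p | ∃ θ z : ℝ, θ ∈ Icc (-π) π ∧ z ∈ Icc 0 (2 * π) ∧ p = cylPt θ z})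
    (hE : ∀ n q, q ∈ E (n + 1) ↔ ∃ p ∈ E n, Step c p q)
    (S : Set (ℝ × ℝ)) (hS01 : ∀ X V, (X, V) ∈ S → 0 ≤ X ∧ X ≤ 1 ∧ |V| ≤ 1)
    (hS : ∀ X V, (X, V) ∈ S → ∃ (m : ℕ) (x y : ℤ) (X' V' : ℝ), (x, y) ∈ T m ∧ (X', V') ∈ S ∧
      X = (x + X') / 2 ^ (m + 1) ∧ V = (2 * y + V') / 2 ^ (m + 1)) (n : ℕ) :
    ∀ (m : ℕ) (x y : ℤ) (X V : ℝ), (x, y) ∈ T m → (X, V) ∈ S →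
      P c ((x + X) / 2 ^ (m + 1)) ((2 * y + V) / 2 ^ (m + 1)) ∈ E n := by
  have hpi := Real.pi_pos
  have bd : ∀ (m : ℕ) (x y : ℤ) (X V : ℝ), (x, y) ∈ T m → (X, V) ∈ S →
      0 ≤ (x + X) / 2 ^ (m + 1) ∧ (x + X) / 2 ^ (m + 1) ≤ 1 ∧
      |(2 * y + V) / 2 ^ (m + 1)| ≤ 1 := by
    intro m x y X V hT hXV
    obtain ⟨a1, a2, a3, a4⟩ := T_bounds hT
    obtain ⟨b1, b2, b3⟩ := hS01 X V hXV
    have a1' : (0 : ℝ) ≤ x := by exact_mod_cast a1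
    have a2' : (x : ℝ) + 1 ≤ 2 ^ (m + 1) := by exact_mod_cast a2
    have a3' : (y : ℝ) + 1 ≤ 2 ^ m := by exact_mod_cast a3
    have a4' : -((2 : ℝ) ^ m) ≤ y - 1 := by exact_mod_cast a4
    have hp : (0 : ℝ) < 2 ^ (m + 1) := by positivity
    have hpp : (2 : ℝ) ^ (m + 1) = 2 * 2 ^ m := by ring
    refine ⟨by positivity, ?_, ?_⟩
    · rw [div_le_one hp]; linarith
    · rw [abs_div, abs_of_pos hp, div_le_one hp]
      rw [abs_le] at b3 ⊢
      constructor <;> linarith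
  induction n with
  | zero =>
    intro m x y X V hT hXV
    obtain ⟨b1, b2, b3⟩ := bd m x y X V hT hXV
    rw [hE0]
    rw [abs_le] at b3
    generalize ((x : ℝ) + X) / 2 ^ (m + 1) = X' at *
    generalize (2 * (y : ℝ) + V) / 2 ^ (m + 1) = V' at *
    have hz : π + 2 * c * V' ∈ Icc 0 (2 * π) := by constructor <;> nlinarith
    rcases le_total X' (1 / 2) with h | h
    · exact ⟨2 * π * X', _, ⟨by nlinarith, by nlinarith⟩, hz, rfl⟩
    · exact ⟨2 * π * (X' - 1), _, ⟨by nlinarith, by nlinarith⟩, hz,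
        cylPt_congr rfl 1 (by push_cast; ring)⟩
  | succ n ih =>
    intro m x y X V hT hXV
    rw [hE]
    cases m with
    | zero =>
      obtain ⟨m, x', y', X', V', hT', hXV', hX, hV⟩ := hS X V hXV
      obtain ⟨b1, b2, b3⟩ := hS01 X V hXV
      have hm := ih m x' y' X' V' hT' hXV'
      rw [← hX, ← hV] at hm
      refine ⟨_, hm, ?_⟩
      simp only [T, Finset.mem_insert, Finset.mem_singleton, Prod.mk.injEq] at hT
      have hy : y = 0 := by omega
      have := step_P (c := c) (X := X) (V := V) (b := x) (e := 0) b1 b2 (by omega) (Or.inl rfl)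
      subst hy
      convert this using 2 <;> push_cast <;> ring
    | succ m =>
      obtain ⟨x', y', b, e, hT', hb, he, rfl, rfl⟩ := T_peel hT
      refine ⟨_, ih m x' y' X V hT' hXV, ?_⟩
      obtain ⟨b1, b2, b3⟩ := bd m x' y' X V hT' hXV
      have hp : (0 : ℝ) < 2 ^ (m + 1) := by positivity
      have hpp : (2 : ℝ) ^ (m + 1) = 2 * 2 ^ m := by ring
      obtain ⟨c1, c2, c3⟩ := hS01 X V hXV
      have := step_P (c := c) (V := (2 * y' + V) / 2 ^ (m + 1)) (b := b) (e := e) b1 b2 hb ?_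
      · convert this using 2
        · push_cast; field_simp; ring
        · push_cast; field_simp; ring
      · rcases he with he | ⟨he, hbx⟩
        · exact Or.inl he
        · refine Or.inr ⟨he, ?_⟩
          rcases hb with rfl | rfl
          · left
            have : x' + 1 ≤ 2 ^ m := by omega
            have : (x' : ℝ) + 1 ≤ 2 ^ m := by exact_mod_cast this
            refine ⟨rfl, ?_⟩
            rw [div_le_iff₀ hp]; linarith
          · right
            have : 2 ^ m ≤ x' := by omega
            have : 2 ^ m ≤ (x' : ℝ) := by exact_mod_cast this
            refine ⟨rfl, ?_⟩
            rw [le_div_iff₀ hp]; linarith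

end CylEx

namespace CylEx

/-- The series `∑ f (a j) q^(j+1)`. -/
noncomputable def Ser {N : ℕ} (q : ℝ) (f : Fin N → ℝ) (a : ℕ → Fin N) : ℝ :=
  ∑' j, f (a j) * q ^ (j + 1)

lemma ser_term_le {N : ℕ} {q : ℝ} {f : Fin N → ℝ} (hq0 : 0 ≤ q)
    (hf : ∀ i, |f i| * q ≤ 1 / 4) (a : ℕ → Fin N) (j : ℕ) :
    ‖f (a j) * q ^ (j + 1)‖ ≤ 1 / 4 * q ^ j := by
  rw [Real.norm_eq_abs, abs_mul, abs_of_nonneg (pow_nonneg hq0 _), pow_succ, mul_comm (q ^ j),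
    ← mul_assoc]
  exact mul_le_mul_of_nonneg_right (hf _) (pow_nonneg hq0 _)

lemma ser_summable {N : ℕ} {q : ℝ} {f : Fin N → ℝ} (hq0 : 0 ≤ q) (hq : q ≤ 1 / 8)
    (hf : ∀ i, |f i| * q ≤ 1 / 4) (a : ℕ → Fin N) :
    Summable fun j => f (a j) * q ^ (j + 1) :=
  Summable.of_norm_bounded ((summable_geometric_of_lt_one hq0 (by linarith)).mul_left (1 / 4))
    (ser_term_le hq0 hf a)

lemma ser_abs_le {N : ℕ} {q : ℝ} {f : Fin N → ℝ} (hq0 : 0 ≤ q) (hq : q ≤ 1 / 8)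
    (hf : ∀ i, |f i| * q ≤ 1 / 4) (a : ℕ → Fin N) : |Ser q f a| ≤ 2 / 7 := by
  have h := tsum_of_norm_bounded
    ((hasSum_geometric_of_lt_one hq0 (by linarith)).mul_left (1 / 4)) (ser_term_le hq0 hf a)
  refine h.trans ?_
  rw [← div_eq_mul_inv, div_le_iff₀ (by linarith)]
  linarith

lemma ser_nonneg {N : ℕ} {q : ℝ} {f : Fin N → ℝ} (hq0 : 0 ≤ q)
    (hf : ∀ i, 0 ≤ f i) (a : ℕ → Fin N) : 0 ≤ Ser q f a :=
  tsum_nonneg fun j => mul_nonneg (hf _) (pow_nonneg hq0 _)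

lemma ser_step {N : ℕ} {q : ℝ} {f : Fin N → ℝ} (hq0 : 0 ≤ q) (hq : q ≤ 1 / 8)
    (hf : ∀ i, |f i| * q ≤ 1 / 4) (a : ℕ → Fin N) :
    Ser q f a = q * (f (a 0) + Ser q f (fun j => a (j + 1))) := by
  rw [Ser, (ser_summable hq0 hq hf a).tsum_eq_zero_add, Ser, mul_add, ← tsum_mul_left]
  congr 1
  · ring
  · congr 1; ext j; ring

lemma ser_sep {N : ℕ} {q : ℝ} (hq0 : 0 < q) (hq : q ≤ 1 / 8) {u : Fin N → ℤ × ℤ}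
    (hu : Function.Injective u)
    (hx0 : ∀ i, (0 : ℝ) ≤ (u i).1) (hx : ∀ i, |((u i).1 : ℝ)| * q ≤ 1 / 4)
    (hy : ∀ i, |2 * ((u i).2 : ℝ)| * q ≤ 1 / 4) (k : ℕ) (a b : ℕ → Fin N)
    (hab : ∀ i < k, a i = b i) (hk : a k ≠ b k) :
    q ^ (k + 1) * (1 / 4) ≤ |Ser q (fun i => ((u i).1 : ℝ)) a - Ser q (fun i => ((u i).1 : ℝ)) b| ∨
    q ^ (k + 1) * (1 / 4) ≤
      |Ser q (fun i => 2 * ((u i).2 : ℝ)) a - Ser q (fun i => 2 * ((u i).2 : ℝ)) b| := by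
  induction k generalizing a b with
  | zero =>
    rw [ser_step hq0.le hq hx a, ser_step hq0.le hq hx b, ser_step hq0.le hq hy a,
      ser_step hq0.le hq hy b, ← mul_sub, ← mul_sub, abs_mul, abs_mul, abs_of_pos hq0]
    have hne : u (a 0) ≠ u (b 0) := fun h => hk (hu h)
    have hX1 := abs_le.1 (ser_abs_le hq0.le hq hx (fun j => a (j + 1)))
    have hX2 := abs_le.1 (ser_abs_le hq0.le hq hx (fun j => b (j + 1)))
    have hX3 := ser_nonneg hq0.le hx0 (fun j => a (j + 1))
    have hX4 := ser_nonneg hq0.le hx0 (fun j => b (j + 1))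
    have hY1 := abs_le.1 (ser_abs_le hq0.le hq hy (fun j => a (j + 1)))
    have hY2 := abs_le.1 (ser_abs_le hq0.le hq hy (fun j => b (j + 1)))
    rw [zero_add, pow_one, mul_le_mul_iff_right₀ hq0, mul_le_mul_iff_right₀ hq0]
    by_cases h1 : (u (a 0)).1 = (u (b 0)).1
    · right
      have h2 : (u (a 0)).2 ≠ (u (b 0)).2 := fun h => hne (Prod.ext h1 h)
      rw [le_abs]
      rcases lt_or_gt_of_ne h2 with h | h
      · have h' : ((u (a 0)).2 : ℝ) + 1 ≤ (u (b 0)).2 := by exact_mod_cast h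
        right; linarith
      · have h' : ((u (b 0)).2 : ℝ) + 1 ≤ (u (a 0)).2 := by exact_mod_cast h
        left; linarith
    · left
      rw [le_abs]
      rcases lt_or_gt_of_ne h1 with h | h
      · have h' : ((u (a 0)).1 : ℝ) + 1 ≤ (u (b 0)).1 := by exact_mod_cast h
        right; linarith
      · have h' : ((u (b 0)).1 : ℝ) + 1 ≤ (u (a 0)).1 := by exact_mod_cast h
        left; linarith
  | succ k ih =>
    have h0 : a 0 = b 0 := hab 0 (by omega)
    rw [ser_step hq0.le hq hx a, ser_step hq0.le hq hx b, ser_step hq0.le hq hy a,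
      ser_step hq0.le hq hy b, ← mul_sub, ← mul_sub, abs_mul, abs_mul, abs_of_pos hq0, h0,
      add_sub_add_left_eq_sub, add_sub_add_left_eq_sub, pow_succ', mul_assoc,
      mul_le_mul_iff_right₀ hq0, mul_le_mul_iff_right₀ hq0]
    exact ih _ _ (fun i hi => hab (i + 1) (by omega)) hk

/-- Abstract lower bound via a Hölder surjection onto `[0,1]`. -/
lemma holder_lower {Z : Type*} [MetricSpace Z] {N n : ℕ} (hN : 1 < N) (hn : 0 < n)
    (Φ : (ℕ → Fin N) → Z) (κ : ℝ) (hκ : 0 < κ)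
    (hΦ : ∀ (k : ℕ) (a b : ℕ → Fin N), (∀ i < k, a i = b i) → a k ≠ b k →
      κ * (((2 : ℝ) ^ n)⁻¹) ^ k ≤ dist (Φ a) (Φ b)) :
    ENNReal.ofReal (Real.log N / (n * Real.log 2)) ≤ dimH (range Φ) := by
  classical
  have hl2 : 0 < Real.log 2 := Real.log_pos (by norm_num)
  have hN' : (1 : ℝ) < N := by exact_mod_cast hN
  have hlN : 0 < Real.log N := Real.log_pos hN'
  have hn' : (0 : ℝ) < n := by exact_mod_cast hn
  set s : ℝ := Real.log N / (n * Real.log 2) with hs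
  have hs0 : 0 < s := by positivity
  have hqs : ((2 : ℝ) ^ n) ^ s = N := by
    rw [Real.rpow_def_of_pos (by positivity), Real.log_pow, hs, mul_div_cancel₀ _ (by positivity),
      Real.exp_log (by linarith)]
  have first : ∀ a b : ℕ → Fin N, a ≠ b → ∃ k, (∀ i < k, a i = b i) ∧ a k ≠ b k := by
    intro a b hab
    have hex : ∃ k, a k ≠ b k := by
      by_contra hcon
      push Not at hcon
      exact hab (funext hcon)
    exact ⟨Nat.find hex, fun i hi => not_not.1 (Nat.find_min hex hi), Nat.find_spec hex⟩
  have hinj : Function.Injective Φ := by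
    intro a b hab
    by_contra hne
    obtain ⟨k, hk1, hk2⟩ := first a b hne
    have := hΦ k a b hk1 hk2
    rw [hab, dist_self] at this
    have h2 : 0 < κ * (((2 : ℝ) ^ n)⁻¹) ^ k := by positivity
    linarith
  have : Nonempty (ℕ → Fin N) := ⟨fun _ => ⟨0, by omega⟩⟩
  set g : Z → ℝ := fun p => Real.ofDigits (Function.invFun Φ p) with hg
  have hgΦ : ∀ a, g (Φ a) = Real.ofDigits a := fun a => by
    simp only [hg, Function.leftInverse_invFun hinj a]
  have hcoe : ((s.toNNReal : NNReal) : ℝ) = s := Real.coe_toNNReal _ hs0.le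
  have hC : 0 ≤ (κ⁻¹) ^ s := by positivity
  have hold : HolderOnWith ((κ⁻¹) ^ s).toNNReal s.toNNReal g (range Φ) := by
    rintro _ ⟨a, rfl⟩ _ ⟨b, rfl⟩
    rw [hgΦ, hgΦ, hcoe, edist_dist, edist_dist,
      ENNReal.ofReal_rpow_of_nonneg dist_nonneg hs0.le]
    change _ ≤ ENNReal.ofReal ((κ⁻¹) ^ s) * _
    rw [← ENNReal.ofReal_mul hC]
    apply ENNReal.ofReal_le_ofReal
    by_cases hab : a = b
    · subst hab
      rw [dist_self]; positivity
    · obtain ⟨k, hk1, hk2⟩ := first a b hab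
      rw [Real.dist_eq]
      refine (Real.abs_ofDigits_sub_ofDigits_le hk1).trans ?_
      rw [← Real.mul_rpow (by positivity) dist_nonneg]
      have h1 : ((N : ℝ) ^ k)⁻¹ = ((((2 : ℝ) ^ n)⁻¹) ^ k) ^ s := by
        rw [← hqs, inv_pow, Real.inv_rpow (by positivity), ← Real.rpow_natCast _ k,
          ← Real.rpow_natCast _ k, ← Real.rpow_mul (by positivity),
          ← Real.rpow_mul (by positivity), mul_comm]
      rw [h1]
      apply Real.rpow_le_rpow (by positivity) _ hs0.le
      rw [inv_mul_eq_div, le_div_iff₀ hκ, mul_comm]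
      exact hΦ k a b hk1 hk2
  have h1 := hold.dimH_image_le (Real.toNNReal_pos.2 hs0)
  have h2 : (1 : ENNReal) ≤ dimH (g '' range Φ) := by
    have hsub : Icc (0 : ℝ) 1 ⊆ g '' range Φ := by
      intro y hy
      obtain ⟨a, -, rfl⟩ := Real.ofDigits_SurjOn hN hy
      exact ⟨Φ a, ⟨a, rfl⟩, hgΦ a⟩
    refine le_trans (le_of_eq ?_) (dimH_mono hsub)
    rw [Real.dimH_of_nonempty_interior]
    · simp
    · rw [interior_Icc]; exact ⟨1 / 2, by norm_num, by norm_num⟩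
  have h3 := h2.trans h1
  have hpos : ((s.toNNReal : NNReal) : ENNReal) ≠ 0 := by
    simpa using hs0
  rw [ENNReal.le_div_iff_mul_le (Or.inl hpos) (Or.inl ENNReal.coe_ne_top), one_mul] at h3
  exact h3

lemma T_pad {m : ℕ} {x y : ℤ} (h : (x, y) ∈ T m) : (x, y) ∈ T (m + 2) := by
  have h1 := T_prepend (b := 0) (e := 0) h (Or.inl rfl) (Or.inl rfl)
  have h2 := T_prepend (b := 0) (e := 0) h1 (Or.inl rfl) (Or.inl rfl)
  simpa using h2

lemma lower_bound_aux {c : ℝ} (hc0 : 0 < c) (hc1 : c ≤ π / 2)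
    {E : ℕ → Set (EuclideanSpace ℝ (Fin 3))}
    (hE0 : E 0 = {p | ∃ θ z : ℝ, θ ∈ Icc (-π) π ∧ z ∈ Icc 0 (2 * π) ∧ p = cylPt θ z})
    (hE : ∀ n q, q ∈ E (n + 1) ↔ ∃ p ∈ E n, Step c p q) (m : ℕ) (hm : 0 < m) :
    ENNReal.ofReal (Real.log (T m).card / ((m + 3 : ℕ) * Real.log 2)) ≤ dimH (⋂ n : ℕ, E n) := by
  have hpi := Real.pi_pos
  set N := (T m).card with hN
  have hN1 : 1 < N := by
    have h1 := card_lower m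
    have h2 : (1 : ℝ) < (2 + √2) ^ m :=
      one_lt_pow₀ (by have := Real.sqrt_nonneg 2; linarith) hm.ne'
    have : (1 : ℝ) < N := by linarith
    exact_mod_cast this
  set q : ℝ := ((2 : ℝ) ^ (m + 3))⁻¹ with hqdef
  have hq0 : 0 < q := by positivity
  have hp0 : (0 : ℝ) < 2 ^ m := by positivity
  have hp1 : (1 : ℝ) ≤ 2 ^ m := one_le_pow₀ (by norm_num)
  have hpow : (2 : ℝ) ^ (m + 3) = 8 * 2 ^ m := by ring
  have hpow1 : (2 : ℝ) ^ (m + 1) = 2 * 2 ^ m := by ring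
  have hq : q ≤ 1 / 8 := by
    rw [hqdef, hpow, inv_le_comm₀ (by positivity) (by norm_num)]; linarith
  set u : Fin N → ℤ × ℤ := fun i => ((T m).equivFin.symm i).1 with hu
  have huinj : Function.Injective u :=
    Subtype.val_injective.comp (T m).equivFin.symm.injective
  have huT : ∀ i, ((u i).1, (u i).2) ∈ T m := fun i => ((T m).equivFin.symm i).2
  have hx0 : ∀ i, (0 : ℝ) ≤ (u i).1 := fun i => by exact_mod_cast (T_bounds (huT i)).1
  have hx : ∀ i, |((u i).1 : ℝ)| * q ≤ 1 / 4 := by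
    intro i
    have h2 : ((u i).1 : ℝ) + 1 ≤ 2 ^ (m + 1) := by exact_mod_cast (T_bounds (huT i)).2.1
    rw [abs_of_nonneg (hx0 i), hqdef, ← div_eq_mul_inv, div_le_iff₀ (by positivity)]
    linarith
  have hy : ∀ i, |2 * ((u i).2 : ℝ)| * q ≤ 1 / 4 := by
    intro i
    have h2 : ((u i).2 : ℝ) + 1 ≤ 2 ^ m := by exact_mod_cast (T_bounds (huT i)).2.2.1
    have h3 : -((2 : ℝ) ^ m) ≤ (u i).2 - 1 := by exact_mod_cast (T_bounds (huT i)).2.2.2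
    rw [hqdef, ← div_eq_mul_inv, div_le_iff₀ (by positivity), abs_le]
    constructor <;> linarith
  set SX := Ser q (fun i => ((u i).1 : ℝ)) with hSX
  set SV := Ser q (fun i => 2 * ((u i).2 : ℝ)) with hSV
  have hX0 : ∀ a, 0 ≤ SX a := ser_nonneg hq0.le hx0
  have hX1 : ∀ a, |SX a| ≤ 2 / 7 := ser_abs_le hq0.le hq hx
  have hV1 : ∀ a, |SV a| ≤ 2 / 7 := ser_abs_le hq0.le hq hy
  set Φ : (ℕ → Fin N) → EuclideanSpace ℝ (Fin 3) := fun a => P c (SX a) (SV a) with hΦ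
  have hmem : ∀ (X V : ℝ), (X, V) ∈ range (fun a => (SX a, SV a)) →
      ∃ (m : ℕ) (x y : ℤ) (X' V' : ℝ), (x, y) ∈ T m ∧ (X', V') ∈ range (fun a => (SX a, SV a)) ∧
      X = (x + X') / 2 ^ (m + 1) ∧ V = (2 * y + V') / 2 ^ (m + 1) := by
    rintro X V ⟨a, ha⟩
    rw [Prod.mk.injEq] at ha
    obtain ⟨rfl, rfl⟩ := ha
    refine ⟨m + 2, (u (a 0)).1, (u (a 0)).2, _, _, T_pad (huT _), ⟨fun j => a (j + 1), rfl⟩, ?_, ?_⟩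
    · rw [hSX, ser_step hq0.le hq hx a, div_eq_inv_mul]
    · rw [hSV, ser_step hq0.le hq hy a, div_eq_inv_mul]
  have hsub : range Φ ⊆ ⋂ n : ℕ, E n := by
    rintro _ ⟨a, rfl⟩
    rw [mem_iInter]
    intro n
    obtain ⟨m', x, y, X', V', hT, hXV, hX, hV⟩ := hmem (SX a) (SV a) ⟨a, rfl⟩
    have := tail_mem hc0.le hc1 hE0 hE (range (fun a => (SX a, SV a))) ?_ hmem n m' x y X' V' hT hXV
    · rw [← hX, ← hV] at this
      exact this
    · rintro X V ⟨a, ha⟩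
      rw [Prod.mk.injEq] at ha
      obtain ⟨rfl, rfl⟩ := ha
      have h1 := hX0 a
      have h2 := (abs_le.1 (hX1 a)).2
      have h3 := hV1 a
      exact ⟨h1, by linarith, by linarith⟩
  refine le_trans ?_ (dimH_mono hsub)
  refine holder_lower hN1 (by omega) Φ (min 1 (2 * c) * (q / 4)) (by positivity) ?_
  intro k a b hab hk
  have hmin1 : min 1 (2 * c) ≤ 1 := min_le_left _ _
  have hmin2 : min 1 (2 * c) ≤ 2 * c := min_le_right _ _
  have hmin0 : 0 < min 1 (2 * c) := by positivity
  have hQ : 0 < q ^ (k + 1) * (1 / 4) := by positivity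
  have heq : min 1 (2 * c) * (q / 4) * q ^ k = min 1 (2 * c) * (q ^ (k + 1) * (1 / 4)) := by ring
  rw [← hqdef, heq]
  rcases ser_sep hq0 hq huinj hx0 hx hy k a b hab hk with h | h
  · have hle : |2 * π * SX a - 2 * π * SX b| ≤ π := by
      have h1 := hX0 a
      have h2 := (abs_le.1 (hX1 a)).2
      have h3 := hX0 b
      have h4 := (abs_le.1 (hX1 b)).2
      rw [abs_le]; constructor <;> nlinarith
    have h5 := le_dist_cylPt_left (2 * π * SX a) (π + 2 * c * SV a) (2 * π * SX b)
      (π + 2 * c * SV b) hle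
    refine le_trans ?_ h5
    have h6 : 2 / π * |2 * π * SX a - 2 * π * SX b| = 4 * |SX a - SX b| := by
      rw [← mul_sub, abs_mul, abs_of_pos (by positivity)]
      field_simp; ring
    rw [h6]
    have := abs_nonneg (SX a - SX b)
    nlinarith
  · have h5 := le_dist_cylPt_right (2 * π * SX a) (π + 2 * c * SV a) (2 * π * SX b)
      (π + 2 * c * SV b)
    refine le_trans ?_ h5
    have h6 : |π + 2 * c * SV a - (π + 2 * c * SV b)| = 2 * c * |SV a - SV b| := by
      rw [add_sub_add_left_eq_sub, ← mul_sub, abs_mul, abs_of_pos (by positivity)]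
    rw [h6]
    exact mul_le_mul hmin2 h hQ.le (by positivity)

open Filter Topology in
lemma lower_bound {c : ℝ} (hc0 : 0 < c) (hc1 : c ≤ π / 2)
    {E : ℕ → Set (EuclideanSpace ℝ (Fin 3))}
    (hE0 : E 0 = {p | ∃ θ z : ℝ, θ ∈ Icc (-π) π ∧ z ∈ Icc 0 (2 * π) ∧ p = cylPt θ z})
    (hE : ∀ n q, q ∈ E (n + 1) ↔ ∃ p ∈ E n, Step c p q) :
    ENNReal.ofReal (Real.log (2 + √2) / Real.log 2) ≤ dimH (⋂ n : ℕ, E n) := by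
  have hl2 : 0 < Real.log 2 := Real.log_pos (by norm_num)
  have hlim : Tendsto (fun m : ℕ => ENNReal.ofReal
      ((m : ℝ) / (m + 3) * (Real.log (2 + √2) / Real.log 2))) atTop
      (𝓝 (ENNReal.ofReal (Real.log (2 + √2) / Real.log 2))) := by
    apply ENNReal.tendsto_ofReal
    have h := (tendsto_natCast_div_add_atTop (3 : ℝ)).mul_const (Real.log (2 + √2) / Real.log 2)
    rwa [one_mul] at h
  refine le_of_tendsto hlim ?_
  filter_upwards [eventually_gt_atTop 0] with m hm
  refine le_trans (ENNReal.ofReal_le_ofReal ?_) (lower_bound_aux hc0 hc1 hE0 hE m hm)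
  have h1 : m * Real.log (2 + √2) ≤ Real.log (T m).card := by
    rw [← Real.log_pow]
    exact Real.log_le_log (by positivity) (card_lower m)
  rw [div_mul_div_comm]
  push_cast
  gcongr

end CylEx

/-- Example 5.5 of the paper.  On the cylinder
`E₀ = {(cos θ, sin θ, z) : θ ∈ [−π,π], z ∈ [0,2π]}` (realized isometrically—up to
bi-Lipschitz equivalence, which does not change Hausdorff dimension—as a subset of
`ℝ³`), with `r ∈ [0, π/2)` and the four overlapping relations `R₁, R₂, R₃, R₄` given
by half-angle maps (single-valued off `H = {(−1,0,z)}`, doubly valued on `H`), the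
attractor `K = ⋂_n E_n` has Hausdorff dimension `log(2 + √2) / log 2`. -/
theorem hausdorff_dimension_cylinder_gftc_example
    (r : ℝ) (hr0 : 0 ≤ r) (hr : r < π / 2)
    (R : Fin 4 → EuclideanSpace ℝ (Fin 3) → Set (EuclideanSpace ℝ (Fin 3)))
    (hR₁ : ∀ p, R 0 p = {q | ∃ θ z : ℝ, θ ∈ Icc (-π) π ∧
      p = cylPt θ z ∧ q = cylPt (θ / 2 + π) (z / 2 + π / 2)})
    (hR₂ : ∀ p, R 1 p = {q | ∃ θ z : ℝ, θ ∈ Icc (-π) π ∧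
      p = cylPt θ z ∧ q = cylPt (θ / 2) (z / 2 + π - r)})
    (hR₃ : ∀ p, R 2 p = {q | ∃ θ z : ℝ, θ ∈ Icc (-π) π ∧
      p = cylPt θ z ∧ q = cylPt (θ / 2) (z / 2 + π / 2)})
    (hR₄ : ∀ p, R 3 p = {q | ∃ θ z : ℝ, θ ∈ Icc (-π) π ∧
      p = cylPt θ z ∧ q = cylPt (θ / 2) (z / 2 + r)})
    (E : ℕ → Set (EuclideanSpace ℝ (Fin 3)))
    (hE0 : E 0 = {p | ∃ θ z : ℝ, θ ∈ Icc (-π) π ∧ z ∈ Icc 0 (2 * π) ∧ p = cylPt θ z})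
    (hEsucc : ∀ n : ℕ, E (n + 1) = ⋃ t : Fin 4, relImage (R t) (E n)) :
    dimH (⋂ n : ℕ, E n) = ENNReal.ofReal (Real.log (2 + Real.sqrt 2) / Real.log 2) := by
  have hE : ∀ n q, q ∈ E (n + 1) ↔ ∃ p ∈ E n, CylEx.Step (π / 2 - r) p q := by
    intro n q
    rw [hEsucc]
    simp only [mem_iUnion, relImage, exists_prop]
    constructor
    · rintro ⟨t, p, hp, hq⟩
      refine ⟨p, hp, ?_⟩
      fin_cases t
      · obtain ⟨θ, z, hθ, h1, h2⟩ : q ∈ {q | _} := (hR₁ p) ▸ hq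
        exact ⟨θ, z, hθ, h1, Or.inl h2⟩
      · obtain ⟨θ, z, hθ, h1, h2⟩ : q ∈ {q | _} := (hR₂ p) ▸ hq
        refine ⟨θ, z, hθ, h1, Or.inr ⟨1, by omega, ?_⟩⟩
        rw [h2]; congr 1; push_cast; ring
      · obtain ⟨θ, z, hθ, h1, h2⟩ : q ∈ {q | _} := (hR₃ p) ▸ hq
        refine ⟨θ, z, hθ, h1, Or.inr ⟨0, by omega, ?_⟩⟩
        rw [h2]; congr 1; push_cast; ring
      · obtain ⟨θ, z, hθ, h1, h2⟩ : q ∈ {q | _} := (hR₄ p) ▸ hq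
        refine ⟨θ, z, hθ, h1, Or.inr ⟨-1, by omega, ?_⟩⟩
        rw [h2]; congr 1; push_cast; ring
    · rintro ⟨p, hp, θ, z, hθ, h1, h2 | ⟨ε, rfl | rfl | rfl, h2⟩⟩
      · refine ⟨0, p, hp, ?_⟩
        rw [hR₁]; exact ⟨θ, z, hθ, h1, h2⟩
      · refine ⟨2, p, hp, ?_⟩
        rw [hR₃]; refine ⟨θ, z, hθ, h1, ?_⟩
        rw [h2]; congr 1; push_cast; ring
      · refine ⟨1, p, hp, ?_⟩
        rw [hR₂]; refine ⟨θ, z, hθ, h1, ?_⟩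
        rw [h2]; congr 1; push_cast; ring
      · refine ⟨3, p, hp, ?_⟩
        rw [hR₄]; refine ⟨θ, z, hθ, h1, ?_⟩
        rw [h2]; congr 1; push_cast; ring
  exact le_antisymm (CylEx.upper_bound hE0 hE)
    (CylEx.lower_bound (by linarith) (by linarith) hE0 hE)
end

section
/- Let 𝕋² := ℝ²/ℤ² be the flat 2-torus with the quotient metric induced from the Euclidean metric on ℝ². Consider the four contractive similitudes on ℝ²: g₁(x) = x/2 + (0, 1/4), g₂(x) = x/2 + (1/4, 1/4), g₃(x) = x/2 + (1/2, 1/4), g₄(x) = x/2 + (1/4, 3/4). Let E₀ := 𝕋² and let {R_t}_{t=1}^4 be the induced IRS on 𝕋²: for each point p of 𝕋², R_t(p) is the set of images in 𝕋² under g_t (composed with the quotient map) of all representatives of p in [0,1]²; R_t is single-valued off the identified boundary H := ({0} × [0,1]) ∪ ([0,1] × {0}) and multivalued on H. Let E_{n+1} := ⋃_{t=1}^4 R_t(E_n) and K := ⋂_{n=0}^∞ E_n. Then the Hausdorff dimension of K equals log(2 + √2) / log 2. -/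
open Set

/-- The flat 2-torus `𝕋² = ℝ²/ℤ²`, realized as a product of two circles with the
quotient (flat) metric. -/
abbrev Torus2 : Type := AddCircle (1 : ℝ) × AddCircle (1 : ℝ)


namespace TorusEx

/-- Offsets in the first coordinate attached to a word (the head of the word is the innermost map). -/
def offs : List Bool → Finset ℤ
  | [] => {0}
  | true :: l => (offs l).image (fun z => 2 * z) ∪
      ((offs l).image (fun z => 2 * z + 1) ∪ (offs l).image (fun z => 2 * z - 1))
  | false :: l => (offs l).image (fun z => 2 * z)

/-- Adjacent pairs. -/
def adj (S : Finset ℤ) : Finset ℤ := S.filter (fun z => z + 1 ∈ S)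

lemma card_img (S : Finset ℤ) (k : ℤ) : (S.image (fun z => 2 * z + k)).card = S.card :=
  Finset.card_image_of_injective _ (fun a b h => by simpa using h)

lemma card_true (S : Finset ℤ) :
    (S.image (fun z => 2 * z) ∪
      (S.image (fun z => 2 * z + 1) ∪ S.image (fun z => 2 * z - 1))).card + (adj S).card
      = 3 * S.card := by
  have h0 := card_img S 0
  have h1 := card_img S 1
  have h2 := card_img S (-1)
  simp only [add_zero] at h0
  simp only [← sub_eq_add_neg] at h2
  rw [Finset.card_union_of_disjoint]
  · have := Finset.card_union_add_card_inter (S.image (fun z => 2 * z + 1)) (S.image (fun z => 2 * z - 1))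
    have h3 : S.image (fun z => 2 * z + 1) ∩ S.image (fun z => 2 * z - 1)
        = (adj S).image (fun z => 2 * z + 1) := by
      ext x
      simp only [adj, Finset.mem_inter, Finset.mem_image, Finset.mem_filter]
      constructor
      · rintro ⟨⟨a, ha, rfl⟩, b, hb, h⟩
        refine ⟨a, ⟨ha, ?_⟩, rfl⟩
        have : a + 1 = b := by omega
        rwa [this]
      · rintro ⟨a, ⟨ha, hb⟩, rfl⟩
        exact ⟨⟨a, ha, rfl⟩, a + 1, hb, by ring⟩
    rw [h3, card_img] at this
    omega
  · rw [Finset.disjoint_left]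
    intro x hx hx'
    simp only [Finset.mem_union, Finset.mem_image] at hx hx'
    obtain ⟨a, _, rfl⟩ := hx
    rcases hx' with ⟨b, _, h⟩ | ⟨b, _, h⟩ <;> omega

lemma card_adj_true (S : Finset ℤ) :
    (adj (S.image (fun z => 2 * z) ∪
      (S.image (fun z => 2 * z + 1) ∪ S.image (fun z => 2 * z - 1)))).card = 2 * S.card := by
  have h0 := card_img S 0
  have h2 := card_img S (-1)
  simp only [add_zero] at h0
  simp only [← sub_eq_add_neg] at h2
  have : adj (S.image (fun z => 2 * z) ∪
      (S.image (fun z => 2 * z + 1) ∪ S.image (fun z => 2 * z - 1))) =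
      S.image (fun z => 2 * z) ∪ S.image (fun z => 2 * z - 1) := by
    ext x
    simp only [adj, Finset.mem_union, Finset.mem_image, Finset.mem_filter]
    constructor
    · rintro ⟨h | h, h'⟩
      · exact Or.inl h
      · rcases h' with ⟨b, hb, h'⟩ | ⟨b, hb, h'⟩ | ⟨b, hb, h'⟩
        · exact Or.inr ⟨b, hb, by omega⟩
        · exact Or.inl ⟨b, hb, by omega⟩
        · rcases h with ⟨a, _, h⟩ | ⟨a, _, h⟩ <;> omega
    · rintro (⟨a, ha, rfl⟩ | ⟨a, ha, rfl⟩)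
      · exact ⟨Or.inl ⟨a, ha, rfl⟩, Or.inr (Or.inl ⟨a, ha, rfl⟩)⟩
      · exact ⟨Or.inr (Or.inr ⟨a, ha, rfl⟩), Or.inl ⟨a, ha, by ring⟩⟩
  rw [this, Finset.card_union_of_disjoint]
  · omega
  · rw [Finset.disjoint_left]
    intro x hx hx'
    simp only [Finset.mem_image] at hx hx'
    obtain ⟨a, _, rfl⟩ := hx
    obtain ⟨b, _, h⟩ := hx'
    omega

lemma card_adj_false (S : Finset ℤ) : (adj (S.image (fun z => 2 * z))).card = 0 := by
  rw [Finset.card_eq_zero, Finset.eq_empty_iff_forall_notMem]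
  intro x hx
  simp only [adj, Finset.mem_image, Finset.mem_filter] at hx
  obtain ⟨⟨a, _, h⟩, b, _, h'⟩ := hx
  omega

/-- The growth rate. -/
noncomputable def lam : ℝ := 2 + Real.sqrt 2

lemma lam_sq : lam * lam = 4 * lam - 2 := by
  have := Real.mul_self_sqrt (show (0 : ℝ) ≤ 2 by norm_num)
  unfold lam; nlinarith

lemma lam_ge : 2 < lam := by
  have := Real.sqrt_pos.2 (show (0 : ℝ) < 2 by norm_num)
  unfold lam; linarith

/-- All words of length `n`. -/
def words : ℕ → Finset (List Bool)
  | 0 => {[]}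
  | n + 1 => (words n).image (List.cons true) ∪ (words n).image (List.cons false)

lemma mem_words {n : ℕ} {l : List Bool} : l ∈ words n ↔ l.length = n := by
  induction n generalizing l with
  | zero => simp [words]
  | succ n ih =>
    cases l with
    | nil => simp [words]
    | cons c l => cases c <;> simp [words, ih]

/-- Weighted count of a word (times `lam`). -/
noncomputable def phi (l : List Bool) : ℝ := lam * (offs l).card - (adj (offs l)).card

lemma phi_step (l : List Bool) : phi (true :: l) + phi (false :: l) = lam * phi l := by
  have h1 := card_true (offs l)
  have h2 := card_adj_true (offs l)
  have h3 := card_adj_false (offs l)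
  have h4 := card_img (offs l) 0
  simp only [add_zero] at h4
  unfold phi
  simp only [offs]
  rw [h2, h3, h4]
  have h1' : (((offs l).image (fun z => 2 * z) ∪
      ((offs l).image (fun z => 2 * z + 1) ∪ (offs l).image (fun z => 2 * z - 1))).card : ℝ)
      = 3 * (offs l).card - (adj (offs l)).card := by
    rw [eq_sub_iff_add_eq]; exact_mod_cast h1
  rw [h1']
  push_cast
  linear_combination (-((offs l).card : ℝ)) * lam_sq

lemma sum_words_succ (f : List Bool → ℝ) (n : ℕ) :
    ∑ l ∈ words (n + 1), f l = ∑ l ∈ words n, (f (true :: l) + f (false :: l)) := by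
  rw [words, Finset.sum_union, Finset.sum_image, Finset.sum_image, Finset.sum_add_distrib]
  · intro a _ b _ h; simpa using h
  · intro a _ b _ h; simpa using h
  · rw [Finset.disjoint_left]
    intro x hx hx'
    simp only [Finset.mem_image] at hx hx'
    obtain ⟨a, _, rfl⟩ := hx
    obtain ⟨b, _, h⟩ := hx'
    simp at h

lemma sum_phi (n : ℕ) : ∑ l ∈ words n, phi l = lam ^ (n + 1) := by
  induction n with
  | zero => simp [words, phi, offs, adj]
  | succ n ih =>
    rw [sum_words_succ]
    simp only [phi_step]
    rw [← Finset.mul_sum, ih]; ring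

/-- All codes of level `n`. -/
def codes (n : ℕ) : Finset (Σ _ : List Bool, ℤ) := (words n).sigma offs

lemma card_codes_ge (n : ℕ) : lam ^ n ≤ (codes n).card := by
  have h := sum_phi n
  have hl := lam_ge
  have : ∑ l ∈ words n, phi l ≤ ∑ l ∈ words n, lam * ((offs l).card : ℝ) :=
    Finset.sum_le_sum fun l _ => by
      unfold phi
      have : (0 : ℝ) ≤ (adj (offs l)).card := by positivity
      linarith
  rw [h, ← Finset.mul_sum, pow_succ'] at this
  rw [codes, Finset.card_sigma]
  push_cast
  exact le_of_mul_le_mul_left this (by linarith)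

lemma card_codes_le (n : ℕ) : ((codes n).card : ℝ) ≤ lam * lam ^ n := by
  have h := sum_phi n
  have hl := lam_ge
  have : ∑ l ∈ words n, ((offs l).card : ℝ) ≤ ∑ l ∈ words n, phi l :=
    Finset.sum_le_sum fun l _ => by
      unfold phi
      have h1 : ((adj (offs l)).card : ℝ) ≤ (offs l).card := by
        exact_mod_cast Finset.card_filter_le _ _
      have : (0 : ℝ) ≤ (offs l).card := by positivity
      nlinarith
  rw [h, pow_succ'] at this
  rw [codes, Finset.card_sigma]
  push_cast
  exact this

/-! ### Generic coding lemmas -/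

lemma exists_coding {D X : Type*} [MetricSpace X] [CompleteSpace X] (Q : Set X)
    (hQc : IsClosed Q) (hQne : Q.Nonempty) (B : ℝ)
    (hB : ∀ p ∈ Q, ∀ q ∈ Q, dist p q ≤ B) (F : D → X → X) (hF : ∀ d, ∀ p ∈ Q, F d p ∈ Q)
    (ρ : ℝ) (h0 : 0 < ρ) (h1 : ρ < 1) (hd : ∀ d p q, dist (F d p) (F d q) = ρ * dist p q) :
    ∃ π : (ℕ → D) → X, ∀ a, π a ∈ Q ∧ π a = F (a 0) (π (fun n => a (n + 1))) := by
  obtain ⟨q0, hq0⟩ := hQne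
  let v : ℕ → (ℕ → D) → X := fun n => Nat.rec (fun _ => q0)
    (fun _ f a => F (a 0) (f (fun n => a (n + 1)))) n
  have vs : ∀ n a, v (n + 1) a = F (a 0) (v n (fun n => a (n + 1))) := fun n a => rfl
  have vQ : ∀ n a, v n a ∈ Q := by
    intro n
    induction n with
    | zero => intro a; exact hq0
    | succ n ih => intro a; rw [vs]; exact hF _ _ (ih _)
  have vd : ∀ n a, dist (v n a) (v (n + 1) a) ≤ B * ρ ^ n := by
    intro n
    induction n with
    | zero => intro a; simpa using hB _ (vQ 0 a) _ (vQ 1 a)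
    | succ n ih =>
      intro a
      rw [vs n, vs (n + 1), hd, pow_succ]
      have := mul_le_mul_of_nonneg_left (ih (fun n => a (n + 1))) h0.le
      linarith
  have hc : ∀ a, ∃ x, Filter.Tendsto (fun n => v n a) Filter.atTop (nhds x) := fun a =>
    cauchySeq_tendsto_of_complete (cauchySeq_of_le_geometric ρ B h1 (fun n => vd n a))
  choose π hπ using hc
  refine ⟨π, fun a => ⟨hQc.mem_of_tendsto (hπ a) (Filter.Eventually.of_forall fun n => vQ n a), ?_⟩⟩
  have hcont : Continuous (F (a 0)) := by
    have : LipschitzWith ⟨ρ, h0.le⟩ (F (a 0)) := LipschitzWith.of_dist_le_mul fun p q => (hd _ p q).le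
    exact this.continuous
  have e1 : Filter.Tendsto (fun n => v (n + 1) a) Filter.atTop (nhds (π a)) :=
    (hπ a).comp (Filter.tendsto_add_atTop_nat 1)
  have e2 : Filter.Tendsto (fun n => v (n + 1) a) Filter.atTop
      (nhds (F (a 0) (π (fun n => a (n + 1))))) :=
    (hcont.tendsto _).comp (hπ (fun n => a (n + 1)))
  exact tendsto_nhds_unique e1 e2

lemma coding_sep {D X : Type*} [MetricSpace X] (Q : Set X)
    (F : D → X → X) (ρ : ℝ) (h0 : 0 < ρ) (hd : ∀ d p q, dist (F d p) (F d q) = ρ * dist p q)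
    (κ : ℝ) (hsep : ∀ d d', d ≠ d' → ∀ p ∈ Q, ∀ q ∈ Q, κ ≤ dist (F d p) (F d' q))
    (π : (ℕ → D) → X) (hπ : ∀ a, π a ∈ Q ∧ π a = F (a 0) (π (fun n => a (n + 1)))) (k : ℕ) :
    ∀ a b : ℕ → D, (∀ i < k, a i = b i) → a k ≠ b k → κ * ρ ^ k ≤ dist (π a) (π b) := by
  induction k with
  | zero =>
    intro a b _ h
    rw [(hπ a).2, (hπ b).2]
    simpa using hsep _ _ h _ (hπ _).1 _ (hπ _).1
  | succ k ih =>
    intro a b h h'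
    rw [(hπ a).2, (hπ b).2, h 0 (by omega), hd, pow_succ]
    have := ih (fun n => a (n + 1)) (fun n => b (n + 1)) (fun i hi => h _ (by omega)) h'
    have := mul_le_mul_of_nonneg_left this h0.le
    linarith

lemma dimH_ge_of_coding {Y : Type*} [MetricSpace Y] (M : ℕ) (hM : 1 < M)
    (ρ κ r : ℝ) (h0 : 0 < ρ) (hκ : 0 < κ) (hr : 0 < r) (hMr : (M : ℝ)⁻¹ ≤ ρ ^ r)
    (π : (ℕ → Fin M) → Y)
    (hsep : ∀ k a b, (∀ i < k, a i = b i) → a k ≠ b k → κ * ρ ^ k ≤ dist (π a) (π b)) :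
    ENNReal.ofReal r ≤ dimH (range π) := by
  have key : ∀ a b, |Real.ofDigits a - Real.ofDigits b| ≤ κ ^ (-r) * dist (π a) (π b) ^ r := by
    intro a b
    by_cases hab : a = b
    · subst hab
      simp only [sub_self, abs_zero]; positivity
    · have hex : ∃ k, a k ≠ b k := by
        by_contra! h; exact hab (funext h)
      classical
      have h1 := Nat.find_spec hex
      have h2 : ∀ i < Nat.find hex, a i = b i := fun i hi => by
        simpa using Nat.find_min hex hi
      set k := Nat.find hex
      have h3 := hsep k a b h2 h1
      have h4 := Real.abs_ofDigits_sub_ofDigits_le h2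
      have h5 : (κ * ρ ^ k) ^ r ≤ dist (π a) (π b) ^ r := by
        apply Real.rpow_le_rpow (by positivity) h3 hr.le
      rw [Real.mul_rpow hκ.le (by positivity), ← Real.rpow_natCast, ← Real.rpow_mul h0.le,
        mul_comm (k : ℝ), Real.rpow_mul h0.le, Real.rpow_natCast] at h5
      have h6 : ((M : ℝ) ^ k)⁻¹ ≤ (ρ ^ r) ^ k := by
        rw [← inv_pow]; exact pow_le_pow_left₀ (by positivity) hMr k
      have h7 : κ ^ (-r) * κ ^ r = 1 := by
        rw [← Real.rpow_add hκ]; simp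
      calc _ ≤ (ρ ^ r) ^ k := h4.trans h6
        _ = κ ^ (-r) * (κ ^ r * (ρ ^ r) ^ k) := by rw [← mul_assoc, h7, one_mul]
        _ ≤ _ := mul_le_mul_of_nonneg_left h5 (by positivity)
  have : Nonempty (ℕ → Fin M) := ⟨fun _ => ⟨0, by omega⟩⟩
  let f : Y → ℝ := fun y => Real.ofDigits (Function.invFun π y)
  have hf : ∀ a, f (π a) = Real.ofDigits a := by
    intro a
    have e : π (Function.invFun π (π a)) = π a := Function.invFun_eq ⟨a, rfl⟩
    have := key (Function.invFun π (π a)) a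
    rw [e, dist_self, Real.zero_rpow hr.ne', mul_zero] at this
    have := abs_nonpos_iff.1 this
    simp only [f]; linarith
  have hH : HolderOnWith (Real.toNNReal (κ ^ (-r))) (Real.toNNReal r) f (range π) := by
    rintro _ ⟨a, rfl⟩ _ ⟨b, rfl⟩
    rw [hf, hf, edist_dist, edist_dist, Real.dist_eq, Real.coe_toNNReal r hr.le,
      ENNReal.ofReal_rpow_of_nonneg dist_nonneg hr.le, ← ENNReal.ofReal, ← ENNReal.ofReal_mul (by positivity)]
    exact ENNReal.ofReal_le_ofReal (key a b)
  have h1 := hH.dimH_image_le (by simpa using hr)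
  have h2 : Icc (0 : ℝ) 1 ⊆ f '' range π := by
    intro y hy
    obtain ⟨a, _, ha⟩ := Real.ofDigits_SurjOn hM hy
    exact ⟨π a, ⟨a, rfl⟩, by rw [hf, ha]⟩
  have h3 : dimH (Icc (0 : ℝ) 1) = 1 := by
    rw [Real.dimH_of_nonempty_interior (by simp [interior_Icc])]; simp
  have h4 : 1 ≤ dimH (range π) / ENNReal.ofReal r := (h3 ▸ dimH_mono h2).trans h1
  have hr0 : ENNReal.ofReal r ≠ 0 := by simpa using hr
  rw [ENNReal.le_div_iff_mul_le (Or.inl hr0) (Or.inl ENNReal.ofReal_ne_top), one_mul] at h4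
  exact h4


/-! ### Geometry -/

/-- The two vertical (folded) maps. -/
noncomputable def jm (c : Bool) (s : ℝ) : ℝ := if c then s / 2 else 1 - s / 2

/-- Composition of vertical maps along a word. -/
noncomputable def J : List Bool → ℝ → ℝ
  | [], s => s
  | c :: l, s => J l (jm c s)

lemma J_dist (l : List Bool) (s t : ℝ) : |J l s - J l t| = |s - t| / 2 ^ l.length := by
  induction l generalizing s t with
  | nil => simp [J]
  | cons c l ih =>
    simp only [J, ih, List.length_cons, pow_succ]
    have : |jm c s - jm c t| = |s - t| / 2 := by
      cases c
      · have : jm false s - jm false t = -((s - t) / 2) := by simp [jm]; ring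
        rw [this, abs_neg, abs_div]; norm_num
      · have : jm true s - jm true t = ((s - t) / 2) := by simp [jm]; ring
        rw [this, abs_div]; norm_num
    rw [this]; field_simp

lemma jm_mem (c : Bool) {s : ℝ} (hs : s ∈ Icc (0 : ℝ) 1) : jm c s ∈ Icc (0 : ℝ) 1 := by
  obtain ⟨h1, h2⟩ := hs
  cases c <;> simp only [jm, mem_Icc] <;> constructor <;> norm_num <;> linarith

lemma J_mem (l : List Bool) {s : ℝ} (hs : s ∈ Icc (0 : ℝ) 1) : J l s ∈ Icc (0 : ℝ) 1 := by
  induction l generalizing s with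
  | nil => simpa [J] using hs
  | cons c l ih => exact ih (jm_mem c hs)

lemma J_sep (l : List Bool) : ∀ (l' : List Bool) (_ : l.length = l'.length) (_ : l ≠ l')
    (δ s t : ℝ) (_ : 0 ≤ δ) (_ : s ∈ Icc δ (1 - δ)) (_ : t ∈ Icc δ (1 - δ)),
    2 * δ / 2 ^ l.length ≤ |J l s - J l' t| := by
  induction l with
  | nil =>
    intro l' h h'
    exact absurd (List.length_eq_zero_iff.1 h.symm).symm h'
  | cons c l ih =>
    intro l' h h' δ s t h0 hs ht
    cases l' with
    | nil => simp at h
    | cons c' l' =>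
      simp only [List.length_cons, add_left_inj] at h
      simp only [J]
      obtain ⟨hs1, hs2⟩ := hs
      obtain ⟨ht1, ht2⟩ := ht
      by_cases hl : l = l'
      · subst hl
        have hc : c ≠ c' := fun e => h' (by rw [e])
        rw [J_dist, List.length_cons, pow_succ]
        have : δ ≤ |jm c s - jm c' t| := by
          rw [le_abs]
          cases c <;> cases c' <;> simp [jm] at hc ⊢
          · left; linarith
          · right; linarith
        rw [mul_comm ((2 : ℝ) ^ _), ← div_div]
        gcongr
        linarith
      · have key : ∀ (c : Bool) (s : ℝ), δ ≤ s → s ≤ 1 - δ → jm c s ∈ Icc (δ / 2) (1 - δ / 2) := by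
          intro c s h1 h2
          cases c <;> simp only [jm, mem_Icc] <;> constructor <;> norm_num <;> linarith
        have := ih l' h hl (δ / 2) (jm c s) (jm c' t) (by linarith) (key c s hs1 hs2)
          (key c' t ht1 ht2)
        refine le_trans (le_of_eq ?_) this
        rw [List.length_cons, pow_succ]
        field_simp

/-- Centered coordinates on the torus. -/
noncomputable def Phi (w z : ℝ) : Torus2 :=
  ((((1 + w) / 2 : ℝ) : AddCircle (1 : ℝ)), (((1 + z) / 2 : ℝ) : AddCircle (1 : ℝ)))

lemma coe_eq_iff (x y : ℝ) : (x : AddCircle (1 : ℝ)) = y ↔ ∃ k : ℤ, x = y + k := by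
  rw [← sub_eq_zero, ← AddCircle.coe_sub, AddCircle.coe_eq_zero_iff]
  constructor
  · rintro ⟨n, hn⟩; exact ⟨n, by simp at hn; linarith⟩
  · rintro ⟨n, hn⟩; exact ⟨n, by simp; linarith⟩

lemma Phi_eq_iff (w z w' z' : ℝ) :
    Phi w z = Phi w' z' ↔ (∃ k : ℤ, w = w' + 2 * k) ∧ ∃ k : ℤ, z = z' + 2 * k := by
  unfold Phi
  rw [Prod.mk.injEq, coe_eq_iff, coe_eq_iff]
  constructor
  · rintro ⟨⟨k, h⟩, j, h'⟩
    exact ⟨⟨k, by linarith⟩, j, by linarith⟩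
  · rintro ⟨⟨k, h⟩, j, h'⟩
    exact ⟨⟨k, by linarith⟩, j, by linarith⟩

lemma norm_coe_le (x : ℝ) : ‖(x : AddCircle (1 : ℝ))‖ ≤ |x| := by
  rw [AddCircle.norm_eq]
  simpa using round_le x 0

lemma dist_coe (x y : ℝ) : dist (x : AddCircle (1 : ℝ)) y = ‖((x - y : ℝ) : AddCircle (1 : ℝ))‖ := by
  rw [dist_eq_norm, AddCircle.coe_sub]

/-- The step relation in centered coordinates. -/
def IsStep (E : ℕ → Set Torus2) : Prop := ∀ n q, q ∈ E (n + 1) ↔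
  ∃ w z : ℝ, w ∈ Icc (-1 : ℝ) 1 ∧ z ∈ Icc (-1 : ℝ) 1 ∧ Phi w z ∈ E n ∧
    ((∃ e : ℤ, (e = -1 ∨ e = 0 ∨ e = 1) ∧ q = Phi ((w + e) / 2) (z / 2)) ∨
      q = Phi (w / 2) (z / 2 + 1))

lemma E_anti {E : ℕ → Set Torus2} (h0 : E 0 = univ) (hE : IsStep E) (n : ℕ) :
    E (n + 1) ⊆ E n := by
  induction n with
  | zero => rw [h0]; exact subset_univ _
  | succ n ih =>
    intro q hq
    obtain ⟨w, z, hw, hz, h, h'⟩ := (hE _ _).1 hq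
    exact (hE _ _).2 ⟨w, z, hw, hz, ih h, h'⟩

/-- The unfolded square. -/
def Q : Set (ℝ × ℝ) := Icc (-1 : ℝ) 1 ×ˢ Icc (0 : ℝ) 1

/-- Points whose two lifts lie in `E n`. -/
def G (E : ℕ → Set Torus2) (n : ℕ) : Set (ℝ × ℝ) :=
  {p | p ∈ Q ∧ ∀ z, |z| = p.2 → Phi p.1 z ∈ E n}

lemma G_true {E : ℕ → Set Torus2} (hE : IsStep E) {n : ℕ} {w s : ℝ} (h : (w, s) ∈ G E n)
    (e : ℤ) (he : e = -1 ∨ e = 0 ∨ e = 1) : ((w + e) / 2, s / 2) ∈ G E (n + 1) := by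
  obtain ⟨⟨⟨h1, h2⟩, h3, h4⟩, h5⟩ := h
  simp only at h1 h2 h3 h4 h5
  have he' : (-1 : ℝ) ≤ e ∧ (e : ℝ) ≤ 1 := by rcases he with rfl | rfl | rfl <;> norm_num
  refine ⟨⟨⟨by simp only; linarith, by simp only; linarith⟩, by simp only; linarith, by simp only; linarith⟩, ?_⟩
  intro z hz
  simp only at hz
  have hz' : |2 * z| = s := by rw [abs_mul, hz]; norm_num; ring
  refine (hE _ _).2 ⟨w, 2 * z, ⟨h1, h2⟩, abs_le.1 (by linarith), h5 _ hz', Or.inl ⟨e, he, ?_⟩⟩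
  congr 1; ring

lemma G_false {E : ℕ → Set Torus2} (hE : IsStep E) {n : ℕ} {w s : ℝ} (h : (w, s) ∈ G E n) :
    (w / 2, 1 - s / 2) ∈ G E (n + 1) := by
  obtain ⟨⟨⟨h1, h2⟩, h3, h4⟩, h5⟩ := h
  simp only at h1 h2 h3 h4 h5
  refine ⟨⟨⟨by simp only; linarith, by simp only; linarith⟩, by simp only; linarith, by simp only; linarith⟩, ?_⟩
  intro z hz
  simp only at hz
  rcases (abs_eq (by linarith)).1 hz with hz | hz
  · refine (hE _ _).2 ⟨w, -s, ⟨h1, h2⟩, ⟨by linarith, by linarith⟩,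
      h5 _ (by rw [abs_neg, abs_of_nonneg h3]), Or.inr ?_⟩
    congr 1; linarith
  · refine (hE _ _).2 ⟨w, s, ⟨h1, h2⟩, ⟨by linarith, by linarith⟩,
      h5 _ (by rw [abs_of_nonneg h3]), Or.inr ?_⟩
    rw [Phi_eq_iff]
    exact ⟨⟨0, by simp⟩, -1, by push_cast; linarith⟩

lemma mem_offs_true {l : List Bool} {N : ℤ} : N ∈ offs (true :: l) ↔
    ∃ N' ∈ offs l, ∃ e : ℤ, (e = -1 ∨ e = 0 ∨ e = 1) ∧ N = 2 * N' + e := by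
  simp only [offs, Finset.mem_union, Finset.mem_image]
  constructor
  · rintro (⟨a, ha, rfl⟩ | ⟨a, ha, rfl⟩ | ⟨a, ha, rfl⟩)
    · exact ⟨a, ha, 0, by simp, by ring⟩
    · exact ⟨a, ha, 1, by simp, by ring⟩
    · exact ⟨a, ha, -1, by simp, by ring⟩
  · rintro ⟨a, ha, e, rfl | rfl | rfl, rfl⟩
    · exact Or.inr (Or.inr ⟨a, ha, by ring⟩)
    · exact Or.inl ⟨a, ha, by ring⟩
    · exact Or.inr (Or.inl ⟨a, ha, by ring⟩)

lemma mem_offs_false {l : List Bool} {N : ℤ} : N ∈ offs (false :: l) ↔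
    ∃ N' ∈ offs l, N = 2 * N' := by
  simp only [offs, Finset.mem_image, eq_comm]

lemma G_word {E : ℕ → Set Torus2} (hE : IsStep E) (l : List Bool) :
    ∀ (N : ℤ) (_ : N ∈ offs l) (n : ℕ) (w s : ℝ) (_ : (w, s) ∈ G E n),
    ((w + N) / 2 ^ l.length, J l s) ∈ G E (n + l.length) := by
  induction l with
  | nil =>
    intro N hN n w s h
    have : N = 0 := by simpa [offs] using hN
    subst this
    simpa [J] using h
  | cons c l ih =>
    intro N hN n w s h
    have e0 : n + (c :: l).length = (n + 1) + l.length := by simp; ring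
    rw [e0]
    cases c
    · obtain ⟨N', hN', rfl⟩ := mem_offs_false.1 hN
      have := ih N' hN' (n + 1) _ _ (G_false hE h)
      convert this using 2
      · rw [List.length_cons, pow_succ]; push_cast; field_simp
      · simp [J, jm]
    · obtain ⟨N', hN', e, he, rfl⟩ := mem_offs_true.1 hN
      have := ih N' hN' (n + 1) _ _ (G_true hE h e he)
      convert this using 2
      · rw [List.length_cons, pow_succ]; push_cast; field_simp; ring
      · simp [J, jm]

/-- Folded version of `E n`. -/
def H (E : ℕ → Set Torus2) (n : ℕ) : Set (ℝ × ℝ) :=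
  {p | ∃ w z : ℝ, w ∈ Icc (-1 : ℝ) 1 ∧ z ∈ Icc (-1 : ℝ) 1 ∧ |p.1| = |w| ∧ p.2 = |z| ∧
    Phi w z ∈ E n}

lemma eq_or_neg_of_mod {a b : ℝ} (ha : |a| ≤ 1) (hb : |b| ≤ 1) (k : ℤ) (h : a = b + 2 * k) :
    |a| = |b| := by
  rw [abs_le] at ha hb
  rw [abs_eq_abs]
  have h1 : (k : ℝ) ≤ 1 := by linarith
  have h2 : (-1 : ℝ) ≤ k := by linarith
  have h1' : k ≤ 1 := by exact_mod_cast h1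
  have h2' : -1 ≤ k := by exact_mod_cast h2
  interval_cases k
  · right; norm_num at h; linarith
  · left; norm_num at h; linarith
  · right; norm_num at h; linarith

lemma H_step {E : ℕ → Set Torus2} (hE : IsStep E) {n : ℕ} {w s : ℝ} (h : (w, s) ∈ H E (n + 1)) :
    (∃ e : ℤ, ∃ w1 s1 : ℝ, (e = -1 ∨ e = 0 ∨ e = 1) ∧ (w1, s1) ∈ H E n ∧ w = (w1 + e) / 2 ∧
      s = s1 / 2) ∨
    (∃ w1 s1 : ℝ, (w1, s1) ∈ H E n ∧ w = w1 / 2 ∧ s = 1 - s1 / 2) := by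
  obtain ⟨w', z', hw', hz', hww, hss, hm⟩ := h
  simp only at hww hss
  obtain ⟨w1, z1, hw1, hz1, hm1, h'⟩ := (hE _ _).1 hm
  have hw'' := abs_le.2 hw'
  have hz'' := abs_le.2 hz'
  have hw1'' := abs_le.2 hw1
  have hz1'' := abs_le.2 hz1
  have hmem : (w1, |z1|) ∈ H E n := ⟨w1, z1, hw1, hz1, rfl, rfl, hm1⟩
  have hmem' : (-w1, |z1|) ∈ H E n := ⟨w1, z1, hw1, hz1, abs_neg _, rfl, hm1⟩
  rcases h' with ⟨e, he, h'⟩ | h'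
  · left
    obtain ⟨⟨k, hk⟩, j, hj⟩ := (Phi_eq_iff _ _ _ _).1 h'
    have he' : (-1 : ℝ) ≤ e ∧ (e : ℝ) ≤ 1 := by rcases he with rfl | rfl | rfl <;> norm_num
    have ha : |(w1 + e) / 2| ≤ 1 := by
      rw [abs_le]; constructor <;> linarith [hw1.1, hw1.2]
    have hs : s = |z1| / 2 := by
      have hb : |z1 / 2| ≤ 1 := by rw [abs_le]; constructor <;> linarith [hz1.1, hz1.2]
      rw [hss, eq_or_neg_of_mod hz'' hb j hj, abs_div]; norm_num
    have hw := hww.trans (eq_or_neg_of_mod hw'' ha k hk)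
    rcases abs_eq_abs.1 hw with hw | hw
    · exact ⟨e, w1, _, he, hmem, hw, hs⟩
    · exact ⟨-e, -w1, _, by omega, hmem', by rw [hw]; push_cast; ring, hs⟩
  · right
    obtain ⟨⟨k, hk⟩, j, hj⟩ := (Phi_eq_iff _ _ _ _).1 h'
    have ha : |w1 / 2| ≤ 1 := by
      rw [abs_le]; constructor <;> linarith [hw1.1, hw1.2]
    have hs : s = 1 - |z1| / 2 := by
      rw [hss]
      have h1 : (j : ℝ) ≤ 1 / 4 := by linarith [hz'.2, hz1.1]
      have h2 : (-5 / 4 : ℝ) ≤ j := by linarith [hz'.1, hz1.2]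
      have h1' : j < 1 := by
        have : (j : ℝ) < 1 := by linarith
        exact_mod_cast this
      have h2' : -2 < j := by
        have : (-2 : ℝ) < j := by linarith
        exact_mod_cast this
      have : j = -1 ∨ j = 0 := by omega
      rcases this with rfl | rfl
      · push_cast at hj
        rw [abs_of_nonpos (by linarith [hz1.2]), abs_of_nonneg (by linarith [hz'.1])]
        linarith
      · push_cast at hj
        rw [abs_of_nonneg (by linarith [hz1.1]), abs_of_nonpos (by linarith [hz'.2])]
        linarith
    have hw := hww.trans (eq_or_neg_of_mod hw'' ha k hk)
    rcases abs_eq_abs.1 hw with hw | hw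
    · exact ⟨w1, _, hmem, hw, hs⟩
    · exact ⟨-w1, _, hmem', by rw [hw]; ring, hs⟩

lemma H_word {E : ℕ → Set Torus2} (hE : IsStep E) (k : ℕ) :
    ∀ (n : ℕ) (w s : ℝ) (_ : (w, s) ∈ H E (n + k)), ∃ l : List Bool, l.length = k ∧
      ∃ N ∈ offs l, ∃ w1 s1 : ℝ, (w1, s1) ∈ H E n ∧ w = (w1 + (N : ℤ)) / 2 ^ k ∧ s = J l s1 := by
  induction k with
  | zero =>
    intro n w s h
    exact ⟨[], rfl, 0, by simp [offs], w, s, h, by simp, rfl⟩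
  | succ k ih =>
    intro n w s h
    obtain ⟨l, hl, N, hN, w1, s1, h1, rfl, rfl⟩ := ih (n + 1) w s
      (by rwa [show n + 1 + k = n + (k + 1) by ring])
    rcases H_step hE h1 with ⟨e, w2, s2, he, h2, rfl, rfl⟩ | ⟨w2, s2, h2, rfl, rfl⟩
    · refine ⟨true :: l, by simp [hl], 2 * N + e, mem_offs_true.2 ⟨N, hN, e, he, rfl⟩, w2, s2, h2, ?_, rfl⟩
      rw [pow_succ]; push_cast; field_simp; ring
    · refine ⟨false :: l, by simp [hl], 2 * N, mem_offs_false.2 ⟨N, hN, rfl⟩, w2, s2, h2, ?_, rfl⟩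
      rw [pow_succ]; push_cast; field_simp

lemma H_sub {E : ℕ → Set Torus2} {n : ℕ} {w s : ℝ} (h : (w, s) ∈ H E n) : (w, s) ∈ Q := by
  obtain ⟨w', z', hw', hz', hww, hss, _⟩ := h
  simp only at hww hss
  refine ⟨abs_le.1 (hww ▸ abs_le.2 hw'), ?_, ?_⟩
  · simp only [hss]; positivity
  · simp only [hss]; exact abs_le.2 hz'

/-! ### Upper bound -/

/-- The dimension. -/
noncomputable def dimS : ℝ := Real.log lam / Real.log 2

lemma dimS_pos : 0 < dimS :=
  div_pos (Real.log_pos (by linarith [lam_ge])) (Real.log_pos (by norm_num))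

lemma two_rpow_dimS : (2 : ℝ) ^ dimS = lam := by
  have hl := lam_ge
  have h2 : Real.log 2 ≠ 0 := (Real.log_pos (by norm_num)).ne'
  rw [Real.rpow_def_of_pos (by norm_num), dimS, mul_div_cancel₀ _ h2, Real.exp_log (by linarith)]

/-- The covering cells. -/
def cell (n : ℕ) (i : (codes n) × Bool) : Set Torus2 :=
  (fun p : ℝ × ℝ => Phi ((p.1 + (i.1.1.2 : ℤ)) / 2 ^ n)
    ((if i.2 then 1 else -1) * J i.1.1.1 p.2)) '' Q

lemma cell_diam (n : ℕ) (i : (codes n) × Bool) :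
    Metric.ediam (cell n i) ≤ ENNReal.ofReal ((1 / 2) ^ n) := by
  obtain ⟨⟨⟨l, N⟩, hi⟩, b⟩ := i
  have hl : l.length = n := mem_words.1 (Finset.mem_sigma.1 hi).1
  apply Metric.ediam_le
  rintro _ ⟨⟨w, s⟩, ⟨⟨hw1, hw2⟩, hs1, hs2⟩, rfl⟩ _ ⟨⟨w', s'⟩, ⟨⟨hw1', hw2'⟩, hs1', hs2'⟩, rfl⟩
  simp only at hw1 hw2 hs1 hs2 hw1' hw2' hs1' hs2'
  rw [edist_dist]
  apply ENNReal.ofReal_le_ofReal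
  simp only [Phi]
  rw [Prod.dist_eq]
  apply max_le
  · simp only
    rw [dist_coe]
    refine (norm_coe_le _).trans ?_
    have : (1 + (w + N) / 2 ^ n) / 2 - (1 + (w' + N) / 2 ^ n) / 2 = ((w - w') / 2) * (1 / 2) ^ n := by
      rw [one_div, inv_pow]; field_simp; ring
    rw [this, abs_mul, abs_of_nonneg (show (0 : ℝ) ≤ (1 / 2) ^ n by positivity)]
    have h1 : |(w - w') / 2| ≤ 1 := by rw [abs_le]; constructor <;> linarith
    exact mul_le_of_le_one_left (by positivity) h1
  · simp only
    rw [dist_coe]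
    refine (norm_coe_le _).trans ?_
    have : (1 + (if b = true then (1 : ℝ) else -1) * J l s) / 2 -
        (1 + (if b = true then (1 : ℝ) else -1) * J l s') / 2 =
        ((if b = true then (1 : ℝ) else -1) / 2) * (J l s - J l s') := by ring
    rw [this, abs_mul, J_dist, hl]
    have h1 : |(if b = true then (1 : ℝ) else -1) / 2| ≤ 1 := by
      cases b <;> simp [abs_le] <;> norm_num
    have h2 : |s - s'| ≤ 1 := by rw [abs_le]; constructor <;> linarith
    calc _ ≤ (1 : ℝ) * (1 / (2 : ℝ) ^ n) := by gcongr
      _ = (1 / 2) ^ n := by rw [one_mul, one_div_pow]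

lemma exists_rep (q : Torus2) : ∃ w z : ℝ, w ∈ Icc (-1 : ℝ) 1 ∧ z ∈ Icc (-1 : ℝ) 1 ∧ q = Phi w z := by
  have key : ∀ c : AddCircle (1 : ℝ), ∃ w ∈ Icc (-1 : ℝ) 1, c = (((1 + w) / 2 : ℝ) : AddCircle (1 : ℝ)) := by
    intro c
    induction c using QuotientAddGroup.induction_on with
    | H x =>
      refine ⟨2 * Int.fract x - 1, ⟨by linarith [Int.fract_nonneg x], by linarith [Int.fract_lt_one x]⟩, ?_⟩
      refine (coe_eq_iff _ _).2 ⟨⌊x⌋, ?_⟩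
      have := Int.fract_add_floor x
      linarith
  obtain ⟨w, hw, h1⟩ := key q.1
  obtain ⟨z, hz, h2⟩ := key q.2
  exact ⟨w, z, hw, hz, Prod.ext h1 h2⟩

lemma cover {E : ℕ → Set Torus2} (hE : IsStep E) (n : ℕ) : E n ⊆ ⋃ i, cell n i := by
  intro q hq
  obtain ⟨w, z, hw, hz, rfl⟩ := exists_rep q
  have hm : (w, |z|) ∈ H E (0 + n) := ⟨w, z, hw, hz, rfl, rfl, by simpa using hq⟩
  obtain ⟨l, hl, N, hN, w1, s1, h1, h2, h3⟩ := H_word hE n 0 w |z| hm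
  have hc : (⟨l, N⟩ : Σ _ : List Bool, ℤ) ∈ codes n := Finset.mem_sigma.2 ⟨mem_words.2 hl, hN⟩
  rw [mem_iUnion]
  rcases abs_choice z with hz' | hz'
  · refine ⟨⟨⟨_, hc⟩, true⟩, (w1, s1), H_sub h1, ?_⟩
    simp only [if_true, one_mul]
    rw [← h2, ← h3, hz']
  · refine ⟨⟨⟨_, hc⟩, false⟩, (w1, s1), H_sub h1, ?_⟩
    simp only [Bool.false_eq_true, if_false]
    rw [← h2, ← h3, hz']
    simp

lemma upper {E : ℕ → Set Torus2} (hE : IsStep E) :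
    dimH (⋂ n, E n) ≤ ENNReal.ofReal dimS := by
  borelize Torus2
  have hl := lam_ge
  have hb : MeasureTheory.Measure.hausdorffMeasure dimS (⋂ n, E n)
      ≤ ENNReal.ofReal (2 * lam) := by
    have hr : Filter.Tendsto (fun n : ℕ => ENNReal.ofReal ((1 / 2 : ℝ) ^ n)) Filter.atTop (nhds 0) := by
      rw [← ENNReal.ofReal_zero]
      exact ENNReal.tendsto_ofReal (tendsto_pow_atTop_nhds_zero_of_lt_one (by norm_num) (by norm_num))
    refine (MeasureTheory.Measure.hausdorffMeasure_le_liminf_sum (ι := fun n => (codes n) × Bool)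
      dimS (⋂ n, E n) (fun n : ℕ => ENNReal.ofReal ((1 / 2 : ℝ) ^ n)) hr cell
      (Filter.Eventually.of_forall fun n i => cell_diam n i)
      (Filter.Eventually.of_forall fun n => (iInter_subset _ n).trans (cover hE n))).trans ?_
    refine Filter.liminf_le_of_frequently_le' (Filter.Eventually.of_forall fun n => ?_).frequently
    have h1 : ∀ i : (codes n) × Bool, Metric.ediam (cell n i) ^ dimS ≤ ENNReal.ofReal ((lam ^ n)⁻¹) := by
      intro i
      refine (ENNReal.rpow_le_rpow (cell_diam n i) dimS_pos.le).trans (le_of_eq ?_)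
      rw [ENNReal.ofReal_rpow_of_nonneg (by positivity) dimS_pos.le]
      congr 1
      rw [← Real.rpow_natCast, ← Real.rpow_mul (by norm_num), mul_comm, Real.rpow_mul (by norm_num),
        Real.rpow_natCast, one_div, Real.inv_rpow (by norm_num), two_rpow_dimS, inv_pow]
    refine (Finset.sum_le_sum fun i _ => h1 i).trans ?_
    rw [Finset.sum_const, Finset.card_univ, nsmul_eq_mul, Fintype.card_prod, Fintype.card_coe,
      Fintype.card_bool, ← ENNReal.ofReal_natCast, ← ENNReal.ofReal_mul (by positivity)]
    apply ENNReal.ofReal_le_ofReal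
    have h2 := card_codes_le n
    have h3 : (0 : ℝ) < lam ^ n := by positivity
    push_cast
    rw [← div_eq_mul_inv, div_le_iff₀ h3]
    linarith
  have hS : ((dimS.toNNReal : NNReal) : ℝ) = dimS := Real.coe_toNNReal _ dimS_pos.le
  refine dimH_le_of_hausdorffMeasure_ne_top (d := dimS.toNNReal) ?_
  rw [hS]
  exact (hb.trans_lt ENNReal.ofReal_lt_top).ne

/-! ### Lower bound -/

/-- Block maps. -/
noncomputable def blk (m : ℕ) (d : codes m) (p : ℝ × ℝ) : ℝ × ℝ :=
  ((p.1 / 4 + (d.1.2 : ℤ)) / 2 ^ m, J d.1.1 (1 / 2 + p.2 / 4))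

lemma blk_dist (m : ℕ) (d : codes m) (p q : ℝ × ℝ) :
    dist (blk m d p) (blk m d q) = (1 / 2) ^ (m + 2) * dist p q := by
  obtain ⟨⟨l, N⟩, hi⟩ := d
  have hl : l.length = m := mem_words.1 (Finset.mem_sigma.1 hi).1
  rw [Prod.dist_eq, Prod.dist_eq, mul_max_of_nonneg _ _ (by positivity)]
  simp only [blk, Real.dist_eq]
  rw [J_dist, hl]
  congr 1
  · have : (p.1 / 4 + N) / 2 ^ m - (q.1 / 4 + N) / 2 ^ m = (1 / 2) ^ (m + 2) * (p.1 - q.1) := by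
      rw [one_div_pow, pow_add]; field_simp; ring
    rw [this, abs_mul, abs_of_nonneg (by positivity)]
  · have : (1 / 2 + p.2 / 4) - (1 / 2 + q.2 / 4) = (1 / 4) * (p.2 - q.2) := by ring
    rw [this, abs_mul, abs_of_nonneg (by positivity), one_div_pow, pow_add]
    field_simp; norm_num; ring

lemma blk_sep (m : ℕ) (d d' : codes m) (hd : d ≠ d') (p q : ℝ × ℝ) (hp : p ∈ Q) (hq : q ∈ Q) :
    1 / 2 / 2 ^ m ≤ dist (blk m d p) (blk m d' q) := by
  obtain ⟨⟨l, N⟩, hi⟩ := d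
  obtain ⟨⟨l', N'⟩, hi'⟩ := d'
  have hl : l.length = m := mem_words.1 (Finset.mem_sigma.1 hi).1
  have hl' : l'.length = m := mem_words.1 (Finset.mem_sigma.1 hi').1
  obtain ⟨⟨hp1, hp2⟩, hp3, hp4⟩ := hp
  obtain ⟨⟨hq1, hq2⟩, hq3, hq4⟩ := hq
  rw [Prod.dist_eq]
  simp only [blk, Real.dist_eq]
  by_cases hll : l = l'
  · have hN : N ≠ N' := by
      rintro rfl; subst hll; exact hd rfl
    refine le_max_of_le_left ?_
    rw [← sub_div, abs_div, abs_of_nonneg (show (0 : ℝ) ≤ 2 ^ m by positivity)]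
    gcongr
    rw [le_abs]
    rcases lt_or_gt_of_ne hN with h | h
    · right
      have : (N : ℝ) + 1 ≤ N' := by exact_mod_cast h
      linarith
    · left
      have : (N' : ℝ) + 1 ≤ N := by exact_mod_cast h
      linarith
  · refine le_max_of_le_right ?_
    have := J_sep l l' (hl.trans hl'.symm) hll (1 / 4) (1 / 2 + p.2 / 4) (1 / 2 + q.2 / 4) (by norm_num)
      ⟨by linarith, by linarith⟩ ⟨by linarith, by linarith⟩
    rw [hl] at this
    refine le_trans (le_of_eq ?_) this
    norm_num

lemma blk_G {E : ℕ → Set Torus2} (hE : IsStep E) (m : ℕ) (d : codes m) (n : ℕ) (p : ℝ × ℝ)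
    (hp : p ∈ G E n) : blk m d p ∈ G E (n + 2 + m) := by
  obtain ⟨⟨l, N⟩, hi⟩ := d
  obtain ⟨w, s⟩ := p
  have hl : l.length = m := mem_words.1 (Finset.mem_sigma.1 hi).1
  have h1 := G_word hE l N (Finset.mem_sigma.1 hi).2 _ _ _ (G_false hE (G_false hE hp))
  rw [hl] at h1
  convert h1 using 2
  · simp only [blk]; ring
  · simp only [blk]; congr 1; ring

lemma blk_Q (m : ℕ) (d : codes m) (p : ℝ × ℝ) (hp : p ∈ Q) : blk m d p ∈ Q := by
  let E : ℕ → Set Torus2 := fun n => Nat.rec univ (fun _ A =>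
    {q | ∃ w z : ℝ, w ∈ Icc (-1 : ℝ) 1 ∧ z ∈ Icc (-1 : ℝ) 1 ∧ Phi w z ∈ A ∧
    ((∃ e : ℤ, (e = -1 ∨ e = 0 ∨ e = 1) ∧ q = Phi ((w + e) / 2) (z / 2)) ∨
      q = Phi (w / 2) (z / 2 + 1))}) n
  have hE : IsStep E := fun n q => Iff.rfl
  exact (blk_G hE m d 0 p ⟨hp, fun z _ => mem_univ _⟩).1

lemma Phi_dist_ge (p q : ℝ × ℝ) (hp : p ∈ Q) (hq : q ∈ Q) :
    dist p q / 4 ≤ dist (Phi (p.1 / 2) (1 - p.2 / 2)) (Phi (q.1 / 2) (1 - q.2 / 2)) := by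
  obtain ⟨⟨hp1, hp2⟩, hp3, hp4⟩ := hp
  obtain ⟨⟨hq1, hq2⟩, hq3, hq4⟩ := hq
  rw [Prod.dist_eq, Prod.dist_eq, ← max_div_div_right (by norm_num)]
  simp only [Phi]
  rw [dist_coe, dist_coe]
  have e1 : (1 + p.1 / 2) / 2 - (1 + q.1 / 2) / 2 = (p.1 - q.1) / 4 := by ring
  have e2 : (1 + (1 - p.2 / 2)) / 2 - (1 + (1 - q.2 / 2)) / 2 = -((p.2 - q.2) / 4) := by ring
  rw [e1, e2]
  have h1 : |(p.1 - q.1) / 4| ≤ |(1 : ℝ)| / 2 := by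
    rw [abs_one, abs_le]; constructor <;> linarith
  have h2 : |-((p.2 - q.2) / 4)| ≤ |(1 : ℝ)| / 2 := by
    rw [abs_one, abs_le]; constructor <;> linarith
  rw [(AddCircle.norm_coe_eq_abs_iff (1 : ℝ) one_ne_zero).2 h1,
    (AddCircle.norm_coe_eq_abs_iff (1 : ℝ) one_ne_zero).2 h2, abs_neg, abs_div, abs_div,
    Real.dist_eq, Real.dist_eq]
  norm_num

lemma Q_dist (p q : ℝ × ℝ) (hp : p ∈ Q) (hq : q ∈ Q) : dist p q ≤ 2 := by
  obtain ⟨⟨hp1, hp2⟩, hp3, hp4⟩ := hp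
  obtain ⟨⟨hq1, hq2⟩, hq3, hq4⟩ := hq
  rw [Prod.dist_eq, Real.dist_eq, Real.dist_eq]
  apply max_le <;> rw [abs_le] <;> constructor <;> linarith

lemma lower_aux {E : ℕ → Set Torus2} (h0 : E 0 = univ) (hE : IsStep E) (m : ℕ) (hm : 1 ≤ m) :
    ENNReal.ofReal (m / (m + 2) * dimS) ≤ dimH (⋂ n, E n) := by
  have hl := lam_ge
  have hm' : (0 : ℝ) < m := by exact_mod_cast hm
  let M := (codes m).card
  let eqv := (codes m).equivFin
  let F : Fin M → ℝ × ℝ → ℝ × ℝ := fun i => blk m (eqv.symm i)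
  have hM : lam ^ m ≤ M := card_codes_ge m
  have hM1 : 1 < M := by
    have : (1 : ℝ) < M := lt_of_lt_of_le (one_lt_pow₀ (by linarith) (by omega)) hM
    exact_mod_cast this
  have hρ0 : (0 : ℝ) < (1 / 2) ^ (m + 2) := by positivity
  have hρ1 : (1 / 2 : ℝ) ^ (m + 2) < 1 := pow_lt_one₀ (by norm_num) (by norm_num) (by omega)
  obtain ⟨π, hπ⟩ := exists_coding Q (isClosed_Icc.prod isClosed_Icc) ⟨(0, 0), by simp [Q]⟩ 2
    (fun p hp q hq => Q_dist p q hp hq) F (fun d p hp => blk_Q m _ p hp) _ hρ0 hρ1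
    (fun d p q => blk_dist m _ p q)
  have hs := coding_sep Q F _ hρ0 (fun d p q => blk_dist m _ p q) (1 / 2 / 2 ^ m)
    (fun d d' hd p hp q hq => blk_sep m _ _ (fun h => hd (eqv.symm.injective h)) p q hp hq) π hπ
  have hanti : Antitone E := antitone_nat_of_succ_le (E_anti h0 hE)
  have hG : ∀ n a, π a ∈ G E n := by
    intro n
    induction n with
    | zero => intro a; exact ⟨(hπ a).1, fun z _ => by rw [h0]; exact mem_univ _⟩
    | succ n ih =>
      intro a
      rw [(hπ a).2]
      have := blk_G hE m (eqv.symm (a 0)) n _ (ih (fun n => a (n + 1)))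
      exact ⟨this.1, fun z hz => hanti (by omega) (this.2 z hz)⟩
  let ψ : (ℕ → Fin M) → Torus2 := fun a => Phi ((π a).1 / 2) (1 - (π a).2 / 2)
  have hψ : range ψ ⊆ ⋂ n, E n := by
    rintro _ ⟨a, rfl⟩
    rw [mem_iInter]
    intro n
    have h1 := G_false hE (hG n a)
    refine hanti (Nat.le_succ n) (h1.2 _ (abs_of_nonneg ?_))
    exact h1.1.2.1
  refine le_trans ?_ (dimH_mono hψ)
  refine dimH_ge_of_coding M hM1 ((1 / 2) ^ (m + 2)) (1 / 2 / 2 ^ m / 4) _ hρ0 (by positivity)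
    (mul_pos (by positivity) dimS_pos) ?_ ψ ?_
  · have : ((1 / 2 : ℝ) ^ (m + 2)) ^ ((m : ℝ) / (m + 2) * dimS) = (lam ^ m)⁻¹ := by
      rw [← Real.rpow_natCast, ← Real.rpow_mul (by norm_num)]
      have : ((m + 2 : ℕ) : ℝ) * ((m : ℝ) / (m + 2) * dimS) = dimS * m := by
        push_cast; field_simp
      rw [this, Real.rpow_mul (by norm_num), Real.rpow_natCast, one_div, Real.inv_rpow (by norm_num),
        two_rpow_dimS, inv_pow]
    rw [this]
    exact inv_anti₀ (by positivity) hM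
  · intro k a b h1 h2
    have h3 := hs k a b h1 h2
    have h4 := Phi_dist_ge (π a) (π b) (hπ a).1 (hπ b).1
    simp only [ψ]
    refine le_trans ?_ h4
    linarith

lemma lower {E : ℕ → Set Torus2} (h0 : E 0 = univ) (hE : IsStep E) :
    ENNReal.ofReal dimS ≤ dimH (⋂ n, E n) := by
  have h1 : Filter.Tendsto (fun m : ℕ => (m : ℝ) / (m + 2) * dimS) Filter.atTop (nhds (1 * dimS)) :=
    (tendsto_natCast_div_add_atTop (2 : ℝ)).mul_const _
  rw [one_mul] at h1
  refine le_of_tendsto (ENNReal.tendsto_ofReal h1) ?_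
  filter_upwards [Filter.eventually_ge_atTop 1] with m hm
  exact lower_aux h0 hE m hm

end TorusEx

/-- Example 5.6 of the paper.  On the flat torus `𝕋² = ℝ²/ℤ²`,
the IRS `{R_t}_{t=1}^4` induced by the overlapping similitudes
`g₁(x) = x/2 + (0,1/4)`, `g₂(x) = x/2 + (1/4,1/4)`, `g₃(x) = x/2 + (1/2,1/4)`,
`g₄(x) = x/2 + (1/4,3/4)` of `ℝ²` (where `R_t(p)` consists of the images under `g_t`,
composed with the quotient map, of all representatives of `p` in `[0,1]²`) has an
attractor `K = ⋂_n E_n` of Hausdorff dimension `log(2 + √2) / log 2`. -/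
theorem hausdorff_dimension_torus_gftc_example
    (b : Fin 4 → ℝ × ℝ)
    (hb : b 0 = (0, 1 / 4) ∧ b 1 = (1 / 4, 1 / 4) ∧ b 2 = (1 / 2, 1 / 4) ∧
      b 3 = (1 / 4, 3 / 4))
    (R : Fin 4 → Torus2 → Set Torus2)
    (hR : ∀ t p, R t p = {q | ∃ x y : ℝ, x ∈ Icc (0 : ℝ) 1 ∧ y ∈ Icc (0 : ℝ) 1 ∧
      p = ((x : AddCircle (1 : ℝ)), (y : AddCircle (1 : ℝ))) ∧
      q = (((x / 2 + (b t).1 : ℝ) : AddCircle (1 : ℝ)),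
           ((y / 2 + (b t).2 : ℝ) : AddCircle (1 : ℝ)))})
    (E : ℕ → Set Torus2) (hE0 : E 0 = Set.univ)
    (hEsucc : ∀ n : ℕ, E (n + 1) = ⋃ t : Fin 4, relImage (R t) (E n)) :
    dimH (⋂ n : ℕ, E n) = ENNReal.ofReal (Real.log (2 + Real.sqrt 2) / Real.log 2) := by
  have hstep : TorusEx.IsStep E := by
    obtain ⟨hb0, hb1, hb2, hb3⟩ := hb
    intro n q
    rw [hEsucc]
    simp only [relImage, mem_iUnion, hR, mem_ofPred_eq, exists_prop]
    constructor
    · rintro ⟨t, p, hp, x, y, hx, hy, rfl, rfl⟩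
      refine ⟨2 * x - 1, 2 * y - 1, ⟨by linarith [hx.1], by linarith [hx.2]⟩,
        ⟨by linarith [hy.1], by linarith [hy.2]⟩, ?_, ?_⟩
      · convert hp using 1
        unfold TorusEx.Phi
        congr 2 <;> ring
      · fin_cases t
        · left
          refine ⟨-1, by simp, ?_⟩
          simp only [Fin.zero_eta, hb0, TorusEx.Phi]
          push_cast
          congr 2 <;> ring
        · left
          refine ⟨0, by simp, ?_⟩
          simp only [Fin.mk_one, hb1, TorusEx.Phi]
          push_cast
          congr 2 <;> ring
        · left
          refine ⟨1, by simp, ?_⟩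
          simp only [Fin.reduceFinMk, hb2, TorusEx.Phi]
          push_cast
          congr 2 <;> ring
        · right
          simp only [Fin.reduceFinMk, hb3, TorusEx.Phi]
          congr 2 <;> ring
    · rintro ⟨w, z, hw, hz, hm, h⟩
      have key : ∀ t : Fin 4, q = ((((1 + w) / 2 / 2 + (b t).1 : ℝ) : AddCircle (1 : ℝ)),
          (((1 + z) / 2 / 2 + (b t).2 : ℝ) : AddCircle (1 : ℝ))) →
          ∃ i, ∃ i_1, i_1 ∈ E n ∧ ∃ x y : ℝ, x ∈ Icc (0 : ℝ) 1 ∧ y ∈ Icc (0 : ℝ) 1 ∧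
          i_1 = ((x : AddCircle (1 : ℝ)), (y : AddCircle (1 : ℝ))) ∧
          q = (((x / 2 + (b i).1 : ℝ) : AddCircle (1 : ℝ)),
           ((y / 2 + (b i).2 : ℝ) : AddCircle (1 : ℝ))) := fun t ht =>
        ⟨t, _, hm, (1 + w) / 2, (1 + z) / 2, ⟨by linarith [hw.1], by linarith [hw.2]⟩,
          ⟨by linarith [hz.1], by linarith [hz.2]⟩, rfl, ht⟩
      rcases h with ⟨e, rfl | rfl | rfl, h⟩ | h
      · apply key 0
        rw [h, hb0]
        simp only [TorusEx.Phi]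
        push_cast
        congr 2 <;> ring
      · apply key 1
        rw [h, hb1]
        simp only [TorusEx.Phi]
        push_cast
        congr 2 <;> ring
      · apply key 2
        rw [h, hb2]
        simp only [TorusEx.Phi]
        push_cast
        congr 2 <;> ring
      · apply key 3
        rw [h, hb3]
        simp only [TorusEx.Phi]
        congr 2 <;> ring
  exact le_antisymm (TorusEx.upper hstep) (TorusEx.lower hE0 hstep)
end
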